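/- For every positive integer ℓ there are infinitely many squarefree positive integers d such that the 2-class group Cl₂(−d) of the imaginary quadratic field ℚ(√−d) is isomorphic to (ℤ/2ℤ) × (ℤ/2^ℓℤ). -/

import Mathlib

open NumberField

/-- `twoClassGroupIso d G` says: for any realization `K` of the imaginary quadratic field
`ℚ(√-d)` (i.e. a number field generated over `ℚ` by a square root of `-d`), every Sylow
2-subgroup of the ideal class group of its ring of integers (the 2-class group `Cl₂(-d)`)
is isomorphic to `G`. -/
def twoClassGroupIso (d : ℕ) (G : Type) [Group G] : Prop :=
  ∀ (K : Type) [Field K] [NumberField K] (α : K),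
    α ^ 2 = -(d : K) →
    IntermediateField.adjoin ℚ {α} = ⊤ →
    ∀ P : Sylow 2 (ClassGroup (NumberField.RingOfIntegers K)),
      Nonempty ((P : Subgroup (ClassGroup (NumberField.RingOfIntegers K))) ≃* G)

section
open MeasureTheory Filter Topology Set

/-- Fejer kernel. -/
noncomputable def fej (l v : ℝ) : ℝ := if v = 0 then l else 2 * (1 - Real.cos (l * v)) / (l * v ^ 2)

lemma fej_nonneg {l : ℝ} (hl : 0 < l) (v : ℝ) : 0 ≤ fej l v := by
  unfold fej
  split_ifs
  · exact hl.le
  · have := Real.cos_le_one (l * v)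
    exact div_nonneg (by linarith) (by positivity)

lemma fej_le {l : ℝ} (hl : 0 < l) (v : ℝ) : fej l v ≤ (l + 4 / l) * (1 + v ^ 2)⁻¹ := by
  unfold fej
  split_ifs with h
  · subst h; simp; positivity
  · rw [← div_eq_mul_inv, div_le_div_iff₀ (by positivity) (by positivity)]
    have h1 : 1 - Real.cos (l * v) ≤ (l * v) ^ 2 / 2 := by
      have := Real.one_sub_sq_div_two_le_cos (x := l * v); linarith
    have h2 := Real.neg_one_le_cos (l * v)
    have e : (l + 4 / l) * (l * v ^ 2) = (l * v) ^ 2 + 4 * v ^ 2 := by field_simp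
    rw [e]
    nlinarith [sq_nonneg v]

lemma fej_meas (l : ℝ) : Measurable (fej l) := by
  unfold fej
  refine Measurable.ite (measurableSet_singleton 0) measurable_const (by fun_prop)

lemma fej_int {l : ℝ} (hl : 0 < l) : Integrable (fej l) := by
  refine (integrable_inv_one_add_sq.const_mul (l + 4 / l)).mono' (fej_meas l).aestronglyMeasurable ?_
  exact Eventually.of_forall fun v => by
    rw [Real.norm_of_nonneg (fej_nonneg hl v)]; exact fej_le hl v

lemma fej_scale {l : ℝ} (hl : 0 < l) (v : ℝ) : fej l v = l * fej 1 (l * v) := by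
  unfold fej
  by_cases h : v = 0
  · simp [h]
  · simp [h, hl.ne']; field_simp

/-- triangle function -/
noncomputable def tri (l t : ℝ) : ℝ := max 0 (1 - |t| / l)

lemma tri_cont (l : ℝ) : Continuous (tri l) := by unfold tri; fun_prop
lemma tri_nonneg (l t : ℝ) : 0 ≤ tri l t := le_max_left _ _
lemma tri_le {l : ℝ} (hl : 0 < l) (t : ℝ) : tri l t ≤ 1 := by
  unfold tri; have := div_nonneg (abs_nonneg t) hl.le; apply max_le <;> linarith
lemma tri_zero {l : ℝ} (hl : 0 < l) {t : ℝ} (h : t ∉ Icc (-l) l) : tri l t = 0 := by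
  unfold tri
  apply max_eq_left
  have : l ≤ |t| := by
    by_contra hh; push Not at hh; exact h ⟨(abs_lt.1 hh).1.le, (abs_lt.1 hh).2.le⟩
  have := (one_le_div hl).2 this
  linarith
lemma tri_supp {l : ℝ} (hl : 0 < l) : HasCompactSupport (tri l) :=
  HasCompactSupport.intro isCompact_Icc fun _ h => tri_zero hl h
lemma tri_int {l : ℝ} (hl : 0 < l) : Integrable (tri l) :=
  (tri_cont l).integrable_of_hasCompactSupport (tri_supp hl)

lemma half_int {l : ℝ} (hl : 0 < l) (v : ℝ) :
    ∫ t in (0 : ℝ)..l, (1 - t / l) * Real.cos (t * v) = fej l v / 2 := by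
  unfold fej
  split_ifs with h
  · subst h
    simp
    field_simp; ring
  · have hd : ∀ t ∈ uIcc (0 : ℝ) l, HasDerivAt
        (fun t => (1 - t / l) * (Real.sin (t * v) / v) - Real.cos (t * v) / (l * v ^ 2))
        ((1 - t / l) * Real.cos (t * v)) t := by
      intro t _
      have h1 : HasDerivAt (fun t => t * v) v t := by simpa using (hasDerivAt_id t).mul_const v
      have h2 : HasDerivAt (fun t : ℝ => 1 - t / l) (-(1 / l)) t := by
        simpa using ((hasDerivAt_id t).div_const l).const_sub 1
      have := (h2.mul (h1.sin.div_const v)).sub (h1.cos.div_const (l * v ^ 2))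
      convert! this using 1
      field_simp
      ring
    rw [intervalIntegral.integral_eq_sub_of_hasDerivAt hd
      (Continuous.intervalIntegrable (by fun_prop) _ _)]
    simp [hl.ne']
    field_simp
    ring

lemma tri_fourier {l : ℝ} (hl : 0 < l) (v : ℝ) :
    ∫ t : ℝ, (tri l t : ℂ) * Complex.exp (-(Complex.I * t * v)) = (fej l v : ℂ) := by
  have hi : Integrable (fun t : ℝ => (tri l t : ℂ) * Complex.exp (-(Complex.I * t * v))) := by
    refine Continuous.integrable_of_hasCompactSupport ?_ ?_
    · have := tri_cont l; fun_prop
    · exact HasCompactSupport.intro isCompact_Icc (K := Icc (-l) l) fun t h => by simp [tri_zero hl h]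
  have hs : ∫ t : ℝ, (tri l t : ℂ) * Complex.exp (-(Complex.I * t * v))
      = ∫ t : ℝ, ((tri l t * Real.cos (t * v) : ℝ) : ℂ) := by
    have e1 := integral_neg_eq_self (fun t : ℝ => (tri l t : ℂ) * Complex.exp (-(Complex.I * t * v))) volume
    have e2 : ∀ t : ℝ, (tri l t : ℂ) * Complex.exp (-(Complex.I * t * v)) +
        (tri l (-t) : ℂ) * Complex.exp (-(Complex.I * (-t : ℝ) * v))
        = 2 * ((tri l t * Real.cos (t * v) : ℝ) : ℂ) := by
      intro t
      have : tri l (-t) = tri l t := by simp [tri]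
      rw [this]
      push_cast
      rw [Complex.cos]
      ring_nf
    have e3 := integral_add hi hi.comp_neg
    rw [e1] at e3
    simp_rw [e2] at e3
    rw [integral_const_mul] at e3
    linear_combination -e3 / 2
  rw [hs, integral_complex_ofReal]
  congr 1
  have hi2 : Integrable (fun t : ℝ => tri l t * Real.cos (t * v)) := by
    refine Continuous.integrable_of_hasCompactSupport ?_ (tri_supp hl).mul_right
    have := tri_cont l; fun_prop
  have e4 : ∀ t : ℝ, tri l t * Real.cos (t * v) = (fun s => tri l s * Real.cos (s * v)) |t| := by
    intro t
    rcases abs_cases t with ⟨h, _⟩ | ⟨h, _⟩ <;> simp [h, tri]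
  rw [show (fun t : ℝ => tri l t * Real.cos (t * v)) = fun t => (fun s => tri l s * Real.cos (s * v)) |t| from funext e4]
  rw [integral_comp_abs (f := fun s => tri l s * Real.cos (s * v))]
  have : ∫ x in Ioi (0 : ℝ), tri l x * Real.cos (x * v) = fej l v / 2 := by
    rw [← half_int hl, intervalIntegral.integral_of_le hl.le]
    have : Ioi (0 : ℝ) = Ioc 0 l ∪ Ioi l := (Ioc_union_Ioi_eq_Ioi hl.le).symm
    rw [this, setIntegral_union (Ioc_disjoint_Ioi le_rfl) measurableSet_Ioi hi2.integrableOn hi2.integrableOn]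
    rw [setIntegral_eq_zero_of_forall_eq_zero (t := Ioi l), add_zero]
    · refine setIntegral_congr_fun measurableSet_Ioc fun t ht => ?_
      simp only [tri]
      rw [abs_of_pos ht.1, max_eq_right]
      have := (div_le_one hl).2 ht.2; linarith
    · intro t ht
      rw [tri_zero hl (fun h => absurd h.2 (not_le.2 ht)), zero_mul]
  rw [this]; ring
end

section
open MeasureTheory Filter Topology Set

lemma tauber_kernel {D : ℝ → ℝ} (hDm : Measurable D) {C : ℝ} (hC : ∀ u, |D u| ≤ C) {G : ℂ → ℂ}
    (hG : ContinuousOn G {s | 0 ≤ s.re})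
    (hDG : ∀ ε : ℝ, 0 < ε → ∀ t : ℝ, ∫ u in Ioi (0 : ℝ), (D u : ℂ) * Complex.exp (-((ε + Complex.I * t) * u))
      = G (ε + Complex.I * t)) {l : ℝ} (hl : 0 < l) :
    Tendsto (fun y => ∫ u in Ioi (0 : ℝ), D u * fej l (u - y)) atTop (𝓝 0) := by
  have hC0 : 0 ≤ C := (abs_nonneg _).trans (hC 0)
  have hGi : Continuous (fun t : ℝ => G (Complex.I * t)) :=
    hG.comp_continuous (by fun_prop) (by intro t; simp)
  -- identity at ε
  have key : ∀ ε > 0, ∀ y : ℝ, ∫ u in Ioi (0 : ℝ), ((D u * Real.exp (-(ε * u)) * fej l (u - y) : ℝ) : ℂ)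
      = ∫ t : ℝ, (tri l t : ℂ) * Complex.exp (Complex.I * t * y) * G (ε + Complex.I * t) := by
    intro ε hε y
    have h1 : ∀ u : ℝ, ((D u * Real.exp (-(ε * u)) * fej l (u - y) : ℝ) : ℂ) =
        ∫ t : ℝ, (tri l t : ℂ) * Complex.exp (Complex.I * t * y) *
          ((D u : ℂ) * Complex.exp (-((ε + Complex.I * t) * u))) := by
      intro u
      push_cast
      rw [← tri_fourier hl, ← integral_const_mul]
      congr 1; ext t
      have : Complex.exp (-(Complex.I * t * ((u - y : ℝ) : ℂ))) * Complex.exp (-(ε * u)) =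
          Complex.exp (Complex.I * t * y) * Complex.exp (-((ε + Complex.I * t) * u)) := by
        rw [← Complex.exp_add, ← Complex.exp_add]; congr 1; push_cast; ring
      linear_combination (D u : ℂ) * tri l t * this
    simp_rw [h1]
    rw [integral_integral_swap]
    · congr 1; ext t
      rw [integral_const_mul, hDG ε hε t]
    · have hexp : IntegrableOn (fun u : ℝ => Real.exp (-(ε * u))) (Ioi 0) := by
        simpa using exp_neg_integrableOn_Ioi 0 hε
      have hp := Integrable.mul_prod (hexp.integrable.const_mul C) (tri_int hl)
      refine hp.mono' ?_ ?_
      · refine Measurable.aestronglyMeasurable ?_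
        have := (tri_cont l).measurable
        simp only [Function.uncurry_def]
        fun_prop
      · refine Eventually.of_forall fun z => ?_
        simp only [Function.uncurry_def, norm_mul, Complex.norm_exp, Complex.norm_real,
          Real.norm_eq_abs, abs_of_nonneg (tri_nonneg l z.2)]
        have e1 : (Complex.I * (z.2 : ℂ) * y).re = 0 := by simp
        have e2 : (-((ε + Complex.I * (z.2 : ℂ)) * z.1)).re = -(ε * z.1) := by simp
        rw [e1, e2, Real.exp_zero]
        have := mul_le_mul_of_nonneg_right (hC z.1) (mul_nonneg (Real.exp_pos (-(ε * z.1))).le (tri_nonneg l z.2))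
        nlinarith
  -- pass to the limit
  have lim : ∀ y : ℝ, ∫ u in Ioi (0 : ℝ), ((D u * fej l (u - y) : ℝ) : ℂ)
      = ∫ t : ℝ, (tri l t : ℂ) * Complex.exp (Complex.I * t * y) * G (Complex.I * t) := by
    intro y
    set ε : ℕ → ℝ := fun n => 1 / ((n : ℝ) + 1) with hε
    have hε0 : ∀ n, 0 < ε n := fun n => by positivity
    have hε1 : ∀ n, ε n ≤ 1 := fun n => by
      rw [hε]; simp only; rw [div_le_one (by positivity)]; simp
    have hεl : Tendsto ε atTop (𝓝 0) := tendsto_one_div_add_atTop_nhds_zero_nat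
    refine tendsto_nhds_unique (f := fun n => ∫ u in Ioi (0 : ℝ), ((D u * Real.exp (-(ε n * u)) * fej l (u - y) : ℝ) : ℂ)) (l := atTop) ?_ ?_
    · refine tendsto_integral_of_dominated_convergence (fun u => C * fej l (u - y)) ?_ ?_ ?_ ?_
      · intro n
        have := fej_meas l
        exact Measurable.aestronglyMeasurable (by fun_prop)
      · exact ((fej_int hl).comp_sub_right y |>.const_mul C).integrableOn
      · intro n
        filter_upwards [ae_restrict_mem measurableSet_Ioi] with u hu
        rw [Complex.norm_real, norm_mul, norm_mul, Real.norm_of_nonneg (fej_nonneg hl _), Real.norm_eq_abs,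
          Real.norm_of_nonneg (Real.exp_pos _).le]
        have h3 : Real.exp (-(ε n * u)) ≤ 1 := Real.exp_le_one_iff.2 (by
          have := mul_pos (hε0 n) hu; linarith)
        have := mul_le_mul (hC u) h3 (Real.exp_pos _).le hC0
        rw [mul_one] at this
        exact mul_le_mul_of_nonneg_right this (fej_nonneg hl _)
      · refine Eventually.of_forall fun u => ?_
        have h4 : Tendsto (fun n => D u * Real.exp (-(ε n * u)) * fej l (u - y)) atTop
            (𝓝 (D u * Real.exp (-(0 * u)) * fej l (u - y))) :=
          (((Real.continuous_exp.tendsto _).comp (hεl.mul_const u).neg).const_mul _).mul_const _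
        simp only [zero_mul, neg_zero, Real.exp_zero, mul_one] at h4
        exact (Complex.continuous_ofReal.tendsto _).comp h4
    · simp_rw [fun n => key (ε n) (hε0 n) y]
      -- bound of G
      obtain ⟨K, hK⟩ := (isCompact_Icc.prod isCompact_Icc : IsCompact (Icc (0:ℝ) 1 ×ˢ Icc (-l) l)).exists_bound_of_continuousOn
        (f := fun z : ℝ × ℝ => G (z.1 + Complex.I * z.2)) (by
          refine hG.comp (by fun_prop) ?_
          rintro ⟨a, b⟩ ⟨h1, h2⟩
          simpa using h1.1)
      refine tendsto_integral_of_dominated_convergence (fun t => tri l t * K) ?_ ?_ ?_ ?_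
      · intro n
        have := tri_cont l
        have hc : Continuous (fun t : ℝ => G (ε n + Complex.I * t)) :=
          hG.comp_continuous (by fun_prop) (by intro t; simpa using (hε0 n).le)
        refine Continuous.aestronglyMeasurable (Continuous.mul ?_ hc)
        fun_prop
      · exact (tri_int hl).mul_const K
      · intro n
        refine Eventually.of_forall fun t => ?_
        have e1 : (Complex.I * (t : ℂ) * y).re = 0 := by simp
        rw [norm_mul, norm_mul, Complex.norm_exp, e1, Real.exp_zero, mul_one, Complex.norm_real, Real.norm_of_nonneg (tri_nonneg l t)]
        by_cases ht : t ∈ Icc (-l) l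
        · exact mul_le_mul_of_nonneg_left (hK (ε n, t) ⟨⟨(hε0 n).le, hε1 n⟩, ht⟩) (tri_nonneg l t)
        · simp [tri_zero hl ht]
      · refine Eventually.of_forall fun t => ?_
        refine Tendsto.const_mul _ ?_
        have h5 : ContinuousWithinAt G {s | 0 ≤ s.re} (Complex.I * t) := hG _ (by simp)
        refine h5.tendsto.comp (tendsto_nhdsWithin_iff.2 ⟨?_, Eventually.of_forall fun n => by simpa using (hε0 n).le⟩)
        have := ((Complex.continuous_ofReal.tendsto 0).comp hεl).add_const (Complex.I * (t:ℂ))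
        simpa using this
  -- Riemann-Lebesgue
  have rl := Real.tendsto_integral_exp_smul_cocompact (fun t : ℝ => (tri l t : ℂ) * G (Complex.I * t))
  have hcoc : Tendsto (fun y : ℝ => -(y / (2 * Real.pi))) atTop (cocompact ℝ) :=
    (tendsto_neg_atTop_atBot.comp (tendsto_id.atTop_div_const (by positivity))).mono_right atBot_le_cocompact
  have rl2 := rl.comp hcoc
  have fin : Tendsto (fun y => ((∫ u in Ioi (0 : ℝ), D u * fej l (u - y) : ℝ) : ℂ)) atTop (𝓝 0) := by
    refine rl2.congr fun y => ?_
    rw [← integral_complex_ofReal, lim y]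
    simp only [Function.comp]
    congr 1; ext t
    rw [Circle.smul_def, Real.fourierChar_apply, smul_eq_mul]
    have : (((2 * Real.pi * -(t * -(y / (2 * Real.pi))) : ℝ) : ℂ) * Complex.I) = Complex.I * t * y := by
      have : 2 * Real.pi * -(t * -(y / (2 * Real.pi))) = t * y := by field_simp
      rw [this]; push_cast; ring
    rw [this]; ring
  have := (Complex.continuous_re.tendsto _).comp fin
  simpa [Function.comp_def] using this
end

section
open MeasureTheory Filter Topology Set

lemma fej_total {l : ℝ} (hl : 0 < l) : ∫ v, fej l v = ∫ v, fej 1 v := by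
  simp_rw [fej_scale hl]
  rw [integral_const_mul, Measure.integral_comp_mul_left (fej 1), smul_eq_mul, abs_of_pos (by positivity),
    ← mul_assoc, mul_inv_cancel₀ hl.ne', one_mul]

lemma fej_kappa_pos : 0 < ∫ v, fej 1 v := by
  rw [integral_pos_iff_support_of_nonneg (fun v => fej_nonneg one_pos v) (fej_int one_pos)]
  refine lt_of_lt_of_le (b := volume (Ioo (0 : ℝ) 1)) (by simp) (measure_mono ?_)
  intro v hv
  simp only [Function.mem_support, fej, hv.1.ne', if_false]
  have h1 : Real.cos (1 * v) < 1 := by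
    rw [one_mul]
    refine lt_of_lt_of_eq (b := Real.cos 0) ?_ Real.cos_zero
    apply Real.cos_lt_cos_of_nonneg_of_le_pi_div_two le_rfl
    · have := Real.pi_gt_three; linarith [hv.2]
    · linarith [hv.1]
  have : 0 < 2 * (1 - Real.cos (1 * v)) / (1 * v ^ 2) := by
    apply div_pos; linarith
    have := hv.1; positivity
  exact this.ne'

lemma fej_conc {η : ℝ} (hη : 0 < η) :
    ∃ l > 0, (∫ v, fej 1 v) * (1 - η) ≤ ∫ v in Icc (-η) η, fej l v := by
  have hk := fej_kappa_pos
  have hmon : Monotone (fun n : ℕ => Icc (-(η * n)) (η * n)) := by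
    intro a b hab
    have : η * (a : ℝ) ≤ η * b := mul_le_mul_of_nonneg_left (by exact_mod_cast hab) hη.le
    apply Icc_subset_Icc <;> linarith
  have hU : (⋃ n : ℕ, Icc (-(η * n)) (η * n)) = univ := by
    refine eq_univ_of_forall fun x => mem_iUnion.2 ?_
    obtain ⟨n, hn⟩ := exists_nat_ge (|x| / η)
    refine ⟨n, abs_le.1 ?_⟩
    rw [div_le_iff₀ hη] at hn; linarith
  have ht := tendsto_setIntegral_of_monotone (μ := volume) (f := fej 1) (fun n => measurableSet_Icc) hmon
    (fej_int one_pos).integrableOn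
  rw [hU, setIntegral_univ] at ht
  have hlt : (∫ v, fej 1 v) * (1 - η) < ∫ v, fej 1 v := by nlinarith
  obtain ⟨n, hn, hn1⟩ := ((ht.eventually (lt_mem_nhds hlt)).and (eventually_ge_atTop 1)).exists
  have hn0 : (0 : ℝ) < n := by exact_mod_cast hn1
  refine ⟨n, hn0, hn.le.trans (le_of_eq ?_)⟩
  simp_rw [fun v => fej_scale hn0 v]
  rw [integral_const_mul, integral_Icc_eq_integral_Ioc, integral_Icc_eq_integral_Ioc,
    ← intervalIntegral.integral_of_le (by nlinarith), ← intervalIntegral.integral_of_le (by linarith),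
    intervalIntegral.integral_comp_mul_left _ hn0.ne', smul_eq_mul, ← mul_assoc, mul_inv_cancel₀ hn0.ne', one_mul]
  congr 1 <;> ring

lemma shift_Icc (g : ℝ → ℝ) (z η : ℝ) :
    ∫ u in Icc (z - η) (z + η), g (u - z) = ∫ v in Icc (-η) η, g v := by
  have := (measurePreserving_sub_right volume z).setIntegral_preimage_emb
    (MeasurableEquiv.subRight z).measurableEmbedding g (Icc (-η) η)
  rw [← this]
  congr 2
  ext u; simp only [mem_Icc, mem_preimage]
  constructor <;> rintro ⟨h1, h2⟩ <;> constructor <;> linarith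

lemma wiener {B : ℝ → ℝ} (hBm : Measurable B) {C c : ℝ} (hB0 : ∀ u, 0 ≤ B u) (hBC : ∀ u, B u ≤ C)
    (slow : ∀ u v, 0 ≤ u → u ≤ v → B u * Real.exp (-(v - u)) ≤ B v) (hc : 0 ≤ c)
    (ker : ∀ l > 0, Tendsto (fun y => ∫ u in Ioi (0 : ℝ), (B u - c) * fej l (u - y)) atTop (𝓝 0)) :
    Tendsto B atTop (𝓝 c) := by
  have hC0 : 0 ≤ C := (hB0 0).trans (hBC 0)
  set κ := ∫ v, fej 1 v with hκ
  have hk : 0 < κ := fej_kappa_pos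
  have main : ∀ η : ℝ, 0 < η → η < 1 → ∀ᶠ y in atTop,
      B y ≤ (c + η) * Real.exp (2 * η) / (1 - η) ∧
      (c * (1 - η) - η - C * η) * Real.exp (-(2 * η)) ≤ B y := by
    intro η hη hη1
    obtain ⟨l, hl, hconc⟩ := fej_conc hη
    have hfi := fej_int hl
    have hf0 := fej_nonneg hl
    have htot := fej_total hl
    have hsh : ∀ z, Integrable (fun u => fej l (u - z)) := fun z => hfi.comp_sub_right z
    have hBi : ∀ z, Integrable (fun u => B u * fej l (u - z)) := fun z => by
      refine ((hsh z).const_mul C).mono' (hBm.aestronglyMeasurable.mul (hsh z).1) ?_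
      refine Eventually.of_forall fun u => ?_
      rw [Real.norm_of_nonneg (mul_nonneg (hB0 u) (hf0 _))]
      exact mul_le_mul_of_nonneg_right (hBC u) (hf0 _)
    have hsp : ∀ z, ∫ u in Ioi (0 : ℝ), (B u - c) * fej l (u - z) =
        (∫ u in Ioi (0 : ℝ), B u * fej l (u - z)) - c * ∫ u in Ioi (0 : ℝ), fej l (u - z) := by
      intro z
      rw [← integral_const_mul, ← integral_sub (hBi z).integrableOn ((hsh z).const_mul c).integrableOn]
      congr 1; ext u; ring
    have hall : ∀ z, ∫ u, fej l (u - z) = κ := fun z => by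
      rw [integral_sub_right_eq_self (fej l) z, htot]
    have hle : ∀ z (S : Set ℝ), ∫ u in S, fej l (u - z) ≤ κ := fun z S => by
      rw [← hall z]; exact setIntegral_le_integral (hsh z) (Eventually.of_forall fun u => hf0 _)
    have hk1 := ((ker l hl).comp (tendsto_atTop_add_const_right atTop η tendsto_id)).eventually
      (Metric.ball_mem_nhds 0 (mul_pos hη hk))
    have hk2 := ((ker l hl).comp (tendsto_atTop_add_const_right atTop (-η) tendsto_id)).eventually
      (Metric.ball_mem_nhds 0 (mul_pos hη hk))
    filter_upwards [hk1, hk2, eventually_gt_atTop (2 * η)] with y h1 h2 hy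
    simp only [Function.comp, id, dist_zero_right, Real.norm_eq_abs, hsp] at h1 h2
    have h1 := (abs_lt.1 h1).2
    have h2 := (abs_lt.1 h2).1
    constructor
    · have a1 := shift_Icc (fej l) (y + η) η
      have hsub : Icc (y + η - η) (y + η + η) ⊆ Ioi 0 := fun u hu => by
        have := hu.1; simp only [mem_Ioi]; linarith
      have a2 : B y * Real.exp (-(2 * η)) * ∫ u in Icc (y + η - η) (y + η + η), fej l (u - (y + η))
          ≤ ∫ u in Ioi (0 : ℝ), B u * fej l (u - (y + η)) := by
        rw [← integral_const_mul]
        refine le_trans (setIntegral_mono_on ((hsh _).const_mul _).integrableOn (hBi _).integrableOn measurableSet_Icc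
          fun u hu => ?_) (setIntegral_mono_set (hBi _).integrableOn
            (Eventually.of_forall fun u => mul_nonneg (hB0 u) (hf0 _)) (Eventually.of_forall hsub))
        refine mul_le_mul_of_nonneg_right ?_ (hf0 _)
        refine le_trans (mul_le_mul_of_nonneg_left (Real.exp_le_exp.2 ?_) (hB0 y)) (slow y u (by linarith) (by linarith [hu.1]))
        linarith [hu.2]
      rw [a1] at a2
      have a3 := hle (y + η) (Ioi 0)
      have a4 := mul_le_mul_of_nonneg_left hconc (mul_nonneg (hB0 y) (Real.exp_pos (-(2 * η))).le)
      have a5 : B y * Real.exp (-(2 * η)) * (1 - η) ≤ c + η := by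
        have : κ * (B y * Real.exp (-(2 * η)) * (1 - η)) ≤ κ * (c + η) := by nlinarith
        exact le_of_mul_le_mul_left this hk
      rw [le_div_iff₀ (by linarith)]
      have e : Real.exp (-(2 * η)) * Real.exp (2 * η) = 1 := by rw [← Real.exp_add]; simp
      calc B y * (1 - η) = (B y * Real.exp (-(2 * η)) * (1 - η)) * Real.exp (2 * η) := by
            linear_combination -(B y * (1 - η)) * e
        _ ≤ _ := mul_le_mul_of_nonneg_right a5 (Real.exp_pos _).le
    · have a1 := shift_Icc (fej l) (y + -η) η
      set I := Icc (y + -η - η) (y + -η + η) with hI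
      have hsub : I ⊆ Ioi 0 := fun u hu => by
        have := hu.1; simp only [mem_Ioi]; linarith
      have b1 : ∫ u in I, fej l (u - (y + -η)) ≤ ∫ u in Ioi (0 : ℝ), fej l (u - (y + -η)) :=
        setIntegral_mono_set (hsh _).integrableOn (Eventually.of_forall fun u => hf0 _) (Eventually.of_forall hsub)
      have b2 : ∫ u in I, B u * fej l (u - (y + -η)) ≤ B y * Real.exp (2 * η) * κ := by
        have : ∫ u in I, B u * fej l (u - (y + -η)) ≤ B y * Real.exp (2 * η) * ∫ u in I, fej l (u - (y + -η)) := by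
          rw [← integral_const_mul]
          refine setIntegral_mono_on (hBi _).integrableOn ((hsh _).const_mul _).integrableOn measurableSet_Icc
            fun u hu => mul_le_mul_of_nonneg_right ?_ (hf0 _)
          have hu1 := hu.1
          have hu2 := hu.2
          have s := slow u y (by linarith) (by linarith)
          have : B u = B u * Real.exp (-(y - u)) * Real.exp (y - u) := by
            rw [mul_assoc, ← Real.exp_add]; simp
          rw [this]
          exact mul_le_mul s (Real.exp_le_exp.2 (by linarith)) (Real.exp_pos _).le (hB0 y)
        exact this.trans (mul_le_mul_of_nonneg_left (hle _ _) (mul_nonneg (hB0 y) (Real.exp_pos _).le))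
      have b3 : ∫ u in Ioi (0 : ℝ) \ I, B u * fej l (u - (y + -η)) ≤ C * (η * κ) := by
        have : ∫ u in Ioi (0 : ℝ) \ I, B u * fej l (u - (y + -η)) ≤ C * ∫ u in Ioi (0 : ℝ) \ I, fej l (u - (y + -η)) := by
          rw [← integral_const_mul]
          exact setIntegral_mono (hBi _).integrableOn ((hsh _).const_mul _).integrableOn
            fun u => mul_le_mul_of_nonneg_right (hBC u) (hf0 _)
        refine this.trans (mul_le_mul_of_nonneg_left ?_ hC0)
        rw [setIntegral_sdiff measurableSet_Icc (hsh _).integrableOn hsub, a1]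
        have := hle (y + -η) (Ioi 0)
        nlinarith
      rw [setIntegral_sdiff measurableSet_Icc (hBi _).integrableOn hsub] at b3
      rw [a1] at b1
      have b4 := mul_le_mul_of_nonneg_left (hconc.trans b1) hc
      have b5 : c * (1 - η) - η - C * η ≤ B y * Real.exp (2 * η) := by
        have : κ * (c * (1 - η) - η - C * η) ≤ κ * (B y * Real.exp (2 * η)) := by nlinarith
        exact le_of_mul_le_mul_left this hk
      have e : Real.exp (2 * η) * Real.exp (-(2 * η)) = 1 := by rw [← Real.exp_add]; simp
      calc _ ≤ B y * Real.exp (2 * η) * Real.exp (-(2 * η)) := mul_le_mul_of_nonneg_right b5 (Real.exp_pos _).le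
        _ = B y := by rw [mul_assoc, e, mul_one]
  rw [tendsto_order]
  have small : ∀ᶠ η : ℝ in 𝓝[>] 0, 0 < η ∧ η < 1 := by
    filter_upwards [Ioo_mem_nhdsGT (zero_lt_one (α := ℝ))] with η h using h
  constructor
  · intro a ha
    have hcont : Tendsto (fun η : ℝ => (c * (1 - η) - η - C * η) * Real.exp (-(2 * η))) (𝓝[>] 0) (𝓝 c) := by
      have : Continuous (fun η : ℝ => (c * (1 - η) - η - C * η) * Real.exp (-(2 * η))) := by fun_prop
      have := this.tendsto 0
      simp only [mul_zero, sub_zero, neg_zero, Real.exp_zero, mul_one] at this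
      exact this.mono_left nhdsWithin_le_nhds
    obtain ⟨η, h1, h2⟩ := ((hcont.eventually (lt_mem_nhds ha)).and small).exists
    filter_upwards [main η h2.1 h2.2] with y hy using h1.trans_le hy.2
  · intro a ha
    have hcont : Tendsto (fun η : ℝ => (c + η) * Real.exp (2 * η) / (1 - η)) (𝓝[>] 0) (𝓝 c) := by
      have : ContinuousAt (fun η : ℝ => (c + η) * Real.exp (2 * η) / (1 - η)) 0 := by
        refine ContinuousAt.div (by fun_prop) (by fun_prop) (by norm_num)
      have := this.tendsto
      simp only [mul_zero, sub_zero, add_zero, Real.exp_zero, mul_one, div_one] at this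
      exact this.mono_left nhdsWithin_le_nhds
    obtain ⟨η, h1, h2⟩ := ((hcont.eventually (gt_mem_nhds ha)).and small).exists
    filter_upwards [main η h2.1 h2.2] with y hy using hy.1.trans_lt h1
end

section
open MeasureTheory Filter Topology Set
open ArithmeticFunction ArithmeticFunction.vonMangoldt

lemma residue_sum_le {q : ℕ} (a : ZMod q) (x : ℝ) (hx : 0 ≤ x) :
    ∑ k ∈ Finset.Icc 1 ⌊x⌋₊, residueClass a k ≤ (Real.log 4 + 4) * x := by
  refine le_trans ?_ (Chebyshev.psi_le_const_mul_self hx)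
  rw [Chebyshev.psi]
  exact Finset.sum_le_sum fun k _ => residueClass_le a k

lemma pnt_ap {q : ℕ} [NeZero q] {a : ZMod q} (ha : IsUnit a) :
    Tendsto (fun x : ℝ => (∑ k ∈ Finset.Icc 1 ⌊x⌋₊, residueClass a k) / x) atTop (𝓝 ((q.totient : ℝ)⁻¹)) := by
  set c : ℝ := (q.totient : ℝ)⁻¹ with hcdef
  set A : ℝ → ℝ := fun x => ∑ k ∈ Finset.Icc 1 ⌊x⌋₊, residueClass a k with hA
  have hA0 : ∀ x, 0 ≤ A x := fun x => Finset.sum_nonneg fun k _ => residueClass_nonneg a k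
  have hAm : Monotone A := fun x y hxy =>
    Finset.sum_le_sum_of_subset_of_nonneg (Finset.Icc_subset_Icc le_rfl (Nat.floor_mono hxy))
      fun k _ _ => residueClass_nonneg a k
  set B : ℝ → ℝ := fun u => A (Real.exp u) * Real.exp (-u) with hB
  have hBm : Measurable B := (hAm.measurable.comp Real.measurable_exp).mul (by fun_prop)
  have hB0 : ∀ u, 0 ≤ B u := fun u => mul_nonneg (hA0 _) (Real.exp_pos _).le
  have hBC : ∀ u, B u ≤ Real.log 4 + 4 := fun u => by
    have := residue_sum_le a (Real.exp u) (Real.exp_pos u).le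
    calc B u ≤ (Real.log 4 + 4) * Real.exp u * Real.exp (-u) :=
          mul_le_mul_of_nonneg_right this (Real.exp_pos _).le
      _ = _ := by rw [mul_assoc, ← Real.exp_add]; simp
  have hc : 0 ≤ c := by positivity
  have slow : ∀ u v, 0 ≤ u → u ≤ v → B u * Real.exp (-(v - u)) ≤ B v := by
    intro u v _ huv
    calc B u * Real.exp (-(v - u)) = A (Real.exp u) * Real.exp (-v) := by
          simp only [hB]; rw [mul_assoc, ← Real.exp_add]; congr 2; ring
      _ ≤ _ := mul_le_mul_of_nonneg_right (hAm (Real.exp_le_exp.2 huv)) (Real.exp_pos _).le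
  set G : ℂ → ℂ := fun z => (LFunctionResidueClassAux a (1 + z) - c) / (1 + z) with hG
  have hGc : ContinuousOn G {s | 0 ≤ s.re} := by
    refine ContinuousOn.div (ContinuousOn.sub ?_ continuousOn_const) (by fun_prop) ?_
    · refine (continuousOn_LFunctionResidueClassAux a).comp (by fun_prop) ?_
      intro z hz
      simp only [mem_ofPred_eq, Complex.add_re, Complex.one_re] at hz ⊢
      linarith
    · intro z hz h
      have := congrArg Complex.re h
      simp only [Complex.add_re, Complex.one_re, Complex.zero_re, mem_ofPred_eq] at this hz
      linarith
  have hO : (fun n : ℕ => ∑ k ∈ Finset.Icc 1 n, residueClass a k) =O[atTop] fun n => (n : ℝ) ^ (1 : ℝ) := by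
    refine Asymptotics.IsBigO.of_bound (Real.log 4 + 4) (Eventually.of_forall fun n => ?_)
    have := residue_sum_le a n (Nat.cast_nonneg n)
    rw [Nat.floor_natCast] at this
    rw [Real.norm_of_nonneg (Finset.sum_nonneg fun k _ => residueClass_nonneg a k), Real.rpow_one,
      Real.norm_of_nonneg (Nat.cast_nonneg n)]
    exact this
  have himg : Real.exp '' Ioi 0 = Ioi 1 := by
    ext x; constructor
    · rintro ⟨u, hu, rfl⟩; exact Real.one_lt_exp_iff.2 hu
    · intro hx; exact ⟨Real.log x, Real.log_pos hx, Real.exp_log (zero_lt_one.trans hx)⟩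
  have hLap : ∀ ε : ℝ, 0 < ε → ∀ t : ℝ,
      ∫ u in Ioi (0 : ℝ), ((B u - c : ℝ) : ℂ) * Complex.exp (-((ε + Complex.I * t) * u)) = G (ε + Complex.I * t) := by
    intro ε hε t
    set z : ℂ := ε + Complex.I * t with hz
    have hzre : z.re = ε := by simp [hz]
    have hz0 : z ≠ 0 := fun h => by rw [h] at hzre; simp at hzre; linarith
    have h1 : 1 < (1 + z).re := by simp [hzre, hε]
    have h1z : 1 + z ≠ 0 := fun h => by rw [h] at h1; simp at h1; linarith
    have hL := LSeries_eq_mul_integral_of_nonneg (residueClass a) zero_le_one h1 hO (residueClass_nonneg a)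
    have hX := eqOn_LFunctionResidueClassAux ha h1
    simp only at hX
    rw [hL, ← himg, integral_image_eq_integral_abs_deriv_smul measurableSet_Ioi
      (fun x _ => (Real.hasDerivAt_exp x).hasDerivWithinAt) (Real.exp_injective.injOn)] at hX
    have e1 : ∀ u : ℝ, |Real.exp u| • ((∑ k ∈ Finset.Icc 1 ⌊Real.exp u⌋₊, (residueClass a k : ℂ)) *
        (Real.exp u : ℂ) ^ (-((1 + z) + 1))) = (B u : ℂ) * Complex.exp (-(z * u)) := by
      intro u
      rw [abs_of_pos (Real.exp_pos u), Complex.real_smul, Complex.cpow_def_of_ne_zero (by simp),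
        ← Complex.ofReal_log (Real.exp_pos u).le, Real.log_exp]
      simp only [hB, hA]
      push_cast
      have : Complex.exp u * Complex.exp (u * -(1 + z + 1)) = Complex.exp (-u) * Complex.exp (-(z * u)) := by
        rw [← Complex.exp_add, ← Complex.exp_add]; congr 1; ring
      linear_combination (∑ k ∈ Finset.Icc 1 ⌊Real.exp u⌋₊, (residueClass a k : ℂ)) * this
    simp_rw [e1] at hX
    have hre : (-z).re < 0 := by simp [hzre, hε]
    have hI1 : IntegrableOn (fun u : ℝ => Complex.exp (-z * u)) (Ioi 0) := integrableOn_exp_mul_complex_Ioi hre 0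
    have hI2 : IntegrableOn (fun u : ℝ => (B u : ℂ) * Complex.exp (-(z * u))) (Ioi 0) := by
      have := hI1.norm.const_mul (Real.log 4 + 4)
      refine Integrable.mono' this ?_ ?_
      · exact (Measurable.aestronglyMeasurable (by fun_prop))
      · refine Eventually.of_forall fun u => ?_
        rw [norm_mul, Complex.norm_real, Real.norm_of_nonneg (hB0 u), ← neg_mul]
        exact mul_le_mul_of_nonneg_right (hBC u) (norm_nonneg _)
    have e2 : ∀ u : ℝ, ((B u - c : ℝ) : ℂ) * Complex.exp (-(z * u)) =
        (B u : ℂ) * Complex.exp (-(z * u)) - c * Complex.exp (-z * u) := by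
      intro u; push_cast; rw [neg_mul]; ring
    simp_rw [e2]
    rw [integral_sub hI2 (hI1.const_mul _), integral_const_mul, integral_exp_mul_complex_Ioi hre]
    simp only [hG]
    rw [hX]
    have : ((q.totient : ℂ)⁻¹) = (c : ℂ) := by simp [hcdef]
    rw [this]
    simp only [Complex.ofReal_zero, mul_zero, Complex.exp_zero, add_sub_cancel_left]
    field_simp
    ring
  have hD : ∀ u, |B u - c| ≤ Real.log 4 + 4 + c := fun u => by
    rw [abs_le]; constructor <;> linarith [hB0 u, hBC u, (hB0 u).trans (hBC u)]
  have hw := wiener hBm hB0 hBC slow hc (fun l hl => tauber_kernel (D := fun u => B u - c)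
    (hBm.sub_const c) hD hGc hLap hl)
  refine (hw.comp Real.tendsto_log_atTop).congr' ?_
  filter_upwards [eventually_gt_atTop 0] with x hx
  simp only [Function.comp, hB]
  rw [Real.exp_neg, Real.exp_log hx, div_eq_mul_inv]
end

section
open Finset

/-- additive character -/
noncomputable def ec (x : ℝ) : ℂ := Complex.exp (2 * Real.pi * x * Complex.I)

lemma ec_add (x y : ℝ) : ec (x + y) = ec x * ec y := by
  unfold ec; rw [← Complex.exp_add]; congr 1; push_cast; ring
lemma ec_zero : ec 0 = 1 := by simp [ec]
lemma ec_norm (x : ℝ) : ‖ec x‖ = 1 := by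
  unfold ec; rw [← Complex.norm_exp_ofReal_mul_I (2 * Real.pi * x)]; push_cast; rfl
lemma ec_int (n : ℤ) : ec n = 1 := by
  unfold ec; rw [Complex.exp_eq_one_iff]; exact ⟨n, by push_cast; ring⟩
lemma ec_add_int (x : ℝ) (n : ℤ) : ec (x + n) = ec x := by rw [ec_add, ec_int, mul_one]
lemma ec_conj (x : ℝ) : (starRingEnd ℂ) (ec x) = ec (-x) := by
  unfold ec; rw [← Complex.exp_conj]; congr 1
  rw [map_mul, Complex.conj_I, show (2 * Real.pi * x : ℂ) = ((2 * Real.pi * x : ℝ) : ℂ) by push_cast; ring, Complex.conj_ofReal]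
  push_cast; ring
lemma ec_sub (x y : ℝ) : ec (x - y) = ec x * (starRingEnd ℂ) (ec y) := by
  rw [ec_conj, sub_eq_add_neg, ec_add]
lemma ec_nsmul (n : ℕ) (x : ℝ) : ec (n * x) = ec x ^ n := by
  unfold ec; rw [← Complex.exp_nat_mul]; congr 1; push_cast; ring

lemma ec_sub_one_norm (x : ℝ) : ‖ec x - 1‖ = 2 * |Real.sin (Real.pi * x)| := by
  have := Complex.norm_exp_I_mul_ofReal_sub_one (2 * Real.pi * x)
  unfold ec
  have e : (2 * Real.pi * x * Complex.I : ℂ) = Complex.I * ((2 * Real.pi * x : ℝ) : ℂ) := by push_cast; ring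
  rw [e, this, norm_mul, Real.norm_eq_abs, Real.norm_eq_abs]
  norm_num
  congr 1; ring_nf

lemma ec_sub_one_le (x : ℝ) : ‖ec x - 1‖ ≤ 2 * Real.pi * |x| := by
  rw [ec_sub_one_norm, mul_assoc]
  refine mul_le_mul_of_nonneg_left ?_ (by norm_num)
  refine Real.abs_sin_le_abs.trans ?_
  rw [abs_mul, abs_of_pos Real.pi_pos]

lemma ec_sub_one_ge (x : ℝ) : 4 * |x - round x| ≤ ‖ec x - 1‖ := by
  have h : ec x = ec (x - round x) := by
    have := ec_add_int (x - round x) (round x); rwa [sub_add_cancel] at this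
  rw [h, ec_sub_one_norm]
  have h1 := abs_sub_round x
  have hp := Real.pi_pos
  have h2 : |Real.pi * (x - round x)| ≤ Real.pi / 2 := by
    rw [abs_mul, abs_of_pos hp]; nlinarith
  have h3 := Real.mul_abs_le_abs_sin h2
  rw [abs_mul, abs_of_pos hp] at h3
  have : 2 / Real.pi * (Real.pi * |x - round x|) = 2 * |x - round x| := by field_simp
  linarith

lemma vdc_id (z : ℕ → ℂ) (hz : ∀ n, ‖z n‖ = 1) (N : ℕ) :
    ‖∑ n ∈ range N, z n‖ ^ 2 = N + 2 * (∑ h ∈ range N, ∑ n ∈ range (N - 1 - h), z (n + h + 1) * (starRingEnd ℂ) (z n)).re := by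
  induction N with
  | zero => simp
  | succ N ih =>
    rw [sum_range_succ]
    have e1 : ‖∑ n ∈ range N, z n + z N‖ ^ 2 = ‖∑ n ∈ range N, z n‖ ^ 2 + ‖z N‖ ^ 2 +
        2 * (z N * (starRingEnd ℂ) (∑ n ∈ range N, z n)).re := by
      rw [← Complex.normSq_eq_norm_sq, ← Complex.normSq_eq_norm_sq, ← Complex.normSq_eq_norm_sq, Complex.normSq_add]
      congr 2
      simp [Complex.mul_re]; ring
    rw [e1, ih, hz]
    have e2 : ∑ h ∈ range (N + 1), ∑ n ∈ range (N + 1 - 1 - h), z (n + h + 1) * (starRingEnd ℂ) (z n)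
        = (∑ h ∈ range N, ∑ n ∈ range (N - 1 - h), z (n + h + 1) * (starRingEnd ℂ) (z n)) +
          z N * (starRingEnd ℂ) (∑ n ∈ range N, z n) := by
      rw [sum_range_succ]
      simp only [Nat.add_sub_cancel, Nat.sub_self, range_zero, sum_empty, add_zero]
      rw [← sum_range_reflect z N, map_sum, mul_sum, ← sum_add_distrib]
      refine sum_congr rfl fun h hh => ?_
      have hh := mem_range.1 hh
      rw [show N - h = (N - 1 - h) + 1 by omega, sum_range_succ, show N - 1 - h + h + 1 = N by omega]
    rw [e2]
    push_cast
    rw [Complex.add_re]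
    ring

lemma vdc (z : ℕ → ℂ) (hz : ∀ n, ‖z n‖ = 1) (N : ℕ) :
    ‖∑ n ∈ range N, z n‖ ^ 2 ≤ N + 2 * ∑ h ∈ range N, ‖∑ n ∈ range (N - 1 - h), z (n + (h + 1)) * (starRingEnd ℂ) (z n)‖ := by
  rw [vdc_id z hz N]
  have := (Complex.re_le_norm _).trans (norm_sum_le (range N)
    (fun h => ∑ n ∈ range (N - 1 - h), z (n + h + 1) * (starRingEnd ℂ) (z n)))
  simp only [← add_assoc]
  linarith

/-- `f` is a polynomial of degree at most d with `d`-th difference γ -/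
def QP : ℕ → ℝ → (ℕ → ℝ) → Prop
  | 0, γ, f => ∀ n, f n = γ
  | d + 1, γ, f => ∀ h : ℕ, QP d (h * γ) (fun n => f (n + h) - f n)

lemma QP_add {d : ℕ} : ∀ {γ γ' : ℝ} {f g : ℕ → ℝ}, QP d γ f → QP d γ' g → QP d (γ + γ') (fun n => f n + g n) := by
  induction d with
  | zero => intro γ γ' f g hf hg n; simp only [QP] at hf hg; simp only [hf, hg]
  | succ d ih =>
    intro γ γ' f g hf hg h
    have := ih (hf h) (hg h)
    rw [← mul_add] at this
    convert this using 2; ring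

lemma QP_smul {d : ℕ} (c : ℝ) : ∀ {γ : ℝ} {f : ℕ → ℝ}, QP d γ f → QP d (c * γ) (fun n => c * f n) := by
  induction d with
  | zero => intro γ f hf n; simp only [QP] at hf; simp only [hf]
  | succ d ih =>
    intro γ f hf h
    have := ih (hf h)
    convert this using 1
    · ring
    · ext n; ring

lemma QP_shift {d : ℕ} (a : ℕ) : ∀ {γ : ℝ} {f : ℕ → ℝ}, QP d γ f → QP d γ (fun n => f (n + a)) := by
  induction d with
  | zero => intro γ f hf n; exact hf _
  | succ d ih =>
    intro γ f hf h
    have := ih (hf h)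
    convert this using 3; ring_nf

lemma QP_mul {d : ℕ} (c : ℝ) : ∀ {γ : ℝ} {f : ℕ → ℝ}, QP d γ f → QP (d + 1) ((d + 1) * γ) (fun n => (n + c) * f n) := by
  induction d with
  | zero => intro γ f hf h n; simp only [QP] at hf; simp only [hf]; push_cast; ring
  | succ d ih =>
    intro γ f hf h
    have h1 := ih (hf h)
    have h2 := QP_smul (h : ℝ) (QP_shift h hf)
    have := QP_add h1 h2
    convert this using 2
    · push_cast; ring
    · push_cast; ring

lemma QP_pow (c : ℝ) (k : ℕ) : QP k k.factorial (fun n => (n + c) ^ k) := by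
  induction k with
  | zero => intro n; simp
  | succ k ih =>
    have := QP_mul c ih
    convert this using 2
    · rw [Nat.factorial_succ]; push_cast; ring
    · ring
end

section
open Finset

lemma vino {M Q Q1 : ℕ} (hQ : 1 ≤ Q) (hQ1 : 1 ≤ Q1) (hM : 256 * Q1 ^ 2 * Q ≤ M) {H : Finset ℕ}
    (hH : H ⊆ range M) (hc : M ≤ Q1 * H.card) {γ δ : ℝ} (hδ : δ * M ≤ Q)
    (hγ : ∀ h ∈ H, ∃ a : ℤ, |h * γ - a| ≤ δ) :
    ∃ q : ℕ, 1 ≤ q ∧ q ≤ 2 * Q1 ∧ ∃ a : ℤ, |q * γ - a| * M ≤ 512 * Q1 ^ 2 * Q * δ := by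
  have hQQ : Q1 ≤ Q1 ^ 2 := by nlinarith
  have hM1 : 256 * (Q1 * Q) ≤ M := by nlinarith
  have hM2 : 256 * Q ≤ M := by nlinarith
  have hM3 : 256 * Q1 ≤ M := by nlinarith
  have hMpos : 0 < M := by omega
  have diff : ∀ x ∈ H, ∀ y ∈ H, x ≤ y → ∃ a : ℤ, |((y - x : ℕ) : ℝ) * γ - a| ≤ 2 * δ := by
    intro x hx y hy hxy
    obtain ⟨a, ha⟩ := hγ x hx
    obtain ⟨b, hb⟩ := hγ y hy
    refine ⟨b - a, ?_⟩
    push_cast [Nat.cast_sub hxy]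
    have e : ((y : ℝ) - x) * γ - (b - a) = (y * γ - b) - (x * γ - a) := by ring
    rw [e]
    exact (abs_sub _ _).trans (by linarith)
  -- gap
  obtain ⟨q, hq1, hq2, a, ha⟩ : ∃ q : ℕ, 1 ≤ q ∧ q ≤ 2 * Q1 ∧ ∃ a : ℤ, |q * γ - a| ≤ 2 * δ := by
    have hcard : (range (M / (2 * Q1) + 1)).card < H.card := by
      rw [card_range]
      have := Nat.div_mul_le_self M (2 * Q1)
      by_contra hh
      push Not at hh
      nlinarith
    obtain ⟨x, hx, y, hy, hxy, he⟩ := exists_ne_map_eq_of_card_lt_of_maps_to hcard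
      (f := fun h => h / (2 * Q1)) (fun h hh => by
        have := mem_range.1 (hH hh)
        simp only [coe_range, Set.mem_Iio]
        exact Nat.lt_succ_of_le (Nat.div_le_div_right this.le))
    have aux : ∀ x ∈ H, ∀ y ∈ H, x < y → x / (2 * Q1) = y / (2 * Q1) →
        ∃ q : ℕ, 1 ≤ q ∧ q ≤ 2 * Q1 ∧ ∃ a : ℤ, |q * γ - a| ≤ 2 * δ := by
      intro x hx y hy hxy he
      refine ⟨y - x, by omega, ?_, diff x hx y hy hxy.le⟩
      have h1 := Nat.div_add_mod x (2 * Q1)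
      have h2 := Nat.div_add_mod y (2 * Q1)
      have h3 := Nat.mod_lt y (show 0 < 2 * Q1 by omega)
      rw [he] at h1
      omega
    rcases lt_or_gt_of_ne hxy with h | h
    · exact aux x hx y hy h he
    · exact aux y hy x hx h he.symm
  refine ⟨q, hq1, hq2, a, ?_⟩
  set L := M / (16 * Q) with hL
  have hL1 : 16 * Q * L ≤ M := by rw [hL]; exact Nat.mul_div_le M (16 * Q)
  have hL2 : M < 16 * Q * L + 16 * Q := by
    have := Nat.lt_mul_div_succ M (show 0 < 16 * Q by omega)
    rw [← hL] at this; linarith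
  have hL0 : 1 ≤ L := by
    by_contra h
    have : L = 0 := Nat.lt_one_iff.1 (not_le.1 h)
    rw [this] at hL2; omega
  have hW : M / L ≤ 32 * Q := by
    apply Nat.div_le_of_le_mul
    nlinarith
  set n := M / (128 * (Q1 ^ 2 * Q)) with hn
  have hD : 0 < 128 * (Q1 ^ 2 * Q) := by positivity
  have hn1 : 128 * (Q1 ^ 2 * Q) * n ≤ M := Nat.mul_div_le M _
  have hn2 : M < 128 * (Q1 ^ 2 * Q) * n + 128 * (Q1 ^ 2 * Q) := by
    have := Nat.lt_mul_div_succ M hD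
    rw [← hn] at this; linarith
  have hn0 : 1 ≤ n := by
    by_contra h
    have : n = 0 := Nat.lt_one_iff.1 (not_le.1 h)
    rw [this] at hn2; nlinarith
  have hfib : (range (M / L + 1) ×ˢ range q).card * n < H.card := by
    rw [card_product, card_range, card_range]
    have h1 : M / L + 1 ≤ 33 * Q := by omega
    have h2 : (M / L + 1) * q ≤ 33 * Q * (2 * Q1) := Nat.mul_le_mul h1 hq2
    have h3 : (M / L + 1) * q * n ≤ 33 * Q * (2 * Q1) * n := Nat.mul_le_mul_right n h2
    have h4 : Q1 * (33 * Q * (2 * Q1) * n) < M := by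
      have : 0 < Q1 ^ 2 * Q * n := by positivity
      nlinarith
    have h5 : Q1 * ((M / L + 1) * q * n) < Q1 * H.card :=
      lt_of_le_of_lt (Nat.mul_le_mul_left Q1 h3) (lt_of_lt_of_le h4 hc)
    exact lt_of_mul_lt_mul_left h5 (Nat.zero_le _)
  obtain ⟨w, hw, hwc⟩ := exists_lt_card_fiber_of_mul_lt_card_of_maps_to (f := fun h => (h / L, h % q))
    (fun h hh => by
      have := mem_range.1 (hH hh)
      simp only [mem_product, mem_range]
      exact ⟨Nat.lt_succ_of_le (Nat.div_le_div_right this.le), Nat.mod_lt _ (by omega)⟩) hfib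
  set F := H.filter (fun h => (h / L, h % q) = w) with hF
  have hFne : F.Nonempty := card_pos.1 (by omega)
  set x := F.min' hFne with hx
  set y := F.max' hFne with hy
  have hxF : x ∈ F := min'_mem _ _
  have hyF : y ∈ F := max'_mem _ _
  have hxy : x ≤ y := min'_le _ _ hyF
  have hx' := mem_filter.1 hxF
  have hy' := mem_filter.1 hyF
  have hxy1 : x / L = y / L := by
    have := hx'.2.trans hy'.2.symm; exact (Prod.ext_iff.1 this).1
  have hmod : ∀ z ∈ F, ∃ J, z = x + q * J := by
    intro z hz
    have hz' := mem_filter.1 hz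
    have hxz : x ≤ z := min'_le _ _ hz
    have : z % q = x % q := (Prod.ext_iff.1 (hz'.2.trans hx'.2.symm)).2
    have : q ∣ z - x := (Nat.modEq_iff_dvd' hxz).1 this.symm
    obtain ⟨J, hJ⟩ := this
    exact ⟨J, by omega⟩
  obtain ⟨J, hJ⟩ := hmod y hyF
  have hJn : n ≤ J := by
    have : F.card ≤ (range (J + 1)).card := by
      refine card_le_card_of_injOn (fun z => (z - x) / q) ?_ ?_
      · intro z hz
        obtain ⟨I, hI⟩ := hmod z hz
        have hzy : z ≤ y := le_max' _ _ hz
        simp only [coe_range, Set.mem_Iio]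
        rw [hI, Nat.add_sub_cancel_left, Nat.mul_div_cancel_left _ (by omega)]
        have : q * I ≤ q * J := by omega
        have := Nat.le_of_mul_le_mul_left this (by omega)
        omega
      · intro z hz z' hz' he
        obtain ⟨I, hI⟩ := hmod z hz
        obtain ⟨I', hI'⟩ := hmod z' hz'
        simp only at he
        rw [hI, hI', Nat.add_sub_cancel_left, Nat.add_sub_cancel_left, Nat.mul_div_cancel_left _ (by omega),
          Nat.mul_div_cancel_left _ (by omega)] at he
        rw [hI, hI', he]
    rw [card_range] at this
    omega
  have hJL : J ≤ L := by
    have h1 := Nat.div_add_mod x L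
    have h2 := Nat.div_add_mod y L
    have h3 := Nat.mod_lt y (show 0 < L by omega)
    rw [hxy1] at h1
    have : q * J ≤ L := by omega
    nlinarith
  obtain ⟨b, hb⟩ := diff x hx'.1 y hy'.1 hxy
  rw [hJ, Nat.add_sub_cancel_left] at hb
  set θ := (q : ℝ) * γ - a with hθ
  have hMr : (0 : ℝ) < M := by exact_mod_cast hMpos
  have hJr : (16 * Q * J : ℝ) ≤ M := by exact_mod_cast (Nat.mul_le_mul_left (16 * Q) hJL).trans hL1
  have hQr : (0 : ℝ) < Q := by exact_mod_cast hQ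
  have hM2r : (256 * Q : ℝ) ≤ M := by exact_mod_cast hM2
  have hδ0 : 0 ≤ δ := by have := (abs_nonneg _).trans ha; linarith
  have hδ1 : 256 * δ ≤ 1 := by
    have : (256 * δ) * M ≤ 1 * M := by nlinarith
    exact le_of_mul_le_mul_right this hMr
  have hJδ : 16 * (J * δ) ≤ 1 := by
    have h1 : 16 * Q * J * δ ≤ M * δ := mul_le_mul_of_nonneg_right hJr hδ0
    have : Q * (16 * (J * δ)) ≤ Q * 1 := by linarith
    exact le_of_mul_le_mul_left this hQr
  have hJ0 : (0 : ℝ) ≤ J := Nat.cast_nonneg J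
  have e1 : |(J : ℝ) * θ| ≤ J * (2 * δ) := by
    rw [abs_mul, abs_of_nonneg hJ0]; exact mul_le_mul_of_nonneg_left ha hJ0
  have e2 : ((q * J : ℕ) : ℝ) * γ - b = J * θ + ((J * a - b : ℤ) : ℝ) := by
    rw [hθ]; push_cast; ring
  rw [e2] at hb
  have hz : (J * a - b : ℤ) = 0 := by
    have h1 : |((J * a - b : ℤ) : ℝ)| < 1 := by
      have := abs_sub (↑J * θ + ((J * a - b : ℤ) : ℝ)) (J * θ)
      rw [add_sub_cancel_left] at this
      linarith
    have : |(J * a - b : ℤ)| < 1 := by exact_mod_cast h1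
    exact Int.abs_lt_one_iff.1 this
  rw [hz, Int.cast_zero, add_zero, abs_mul, abs_of_nonneg hJ0] at hb
  have hn2r : (M : ℝ) ≤ 256 * (Q1 ^ 2 * Q) * n := by
    have : M ≤ 256 * (Q1 ^ 2 * Q) * n := by linarith [Nat.mul_le_mul_left (128 * (Q1 ^ 2 * Q)) hn0]
    exact_mod_cast this
  have hJnr : (n : ℝ) ≤ J := by exact_mod_cast hJn
  have hA : (0 : ℝ) ≤ 256 * (Q1 ^ 2 * Q) := by positivity
  calc |θ| * M ≤ |θ| * (256 * (Q1 ^ 2 * Q) * J) := by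
        refine mul_le_mul_of_nonneg_left (hn2r.trans (mul_le_mul_of_nonneg_left hJnr hA)) (abs_nonneg _)
    _ = 256 * (Q1 ^ 2 * Q) * (J * |θ|) := by ring
    _ ≤ 256 * (Q1 ^ 2 * Q) * (2 * δ) := mul_le_mul_of_nonneg_left hb hA
    _ = _ := by ring
end

section
open Finset

lemma weyl_base (t M M' : ℕ) (f : ℕ → ℝ) (γ : ℝ) (hf : QP 1 γ f)
    (hS : (M : ℝ) ≤ 2 ^ t * ‖∑ n ∈ range M', ec (f n)‖) : |γ - round γ| * M ≤ 2 ^ t := by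
  have h1 : ∀ n, ec (f n) = ec (f 0) * ec γ ^ n := by
    intro n
    have := hf n 0
    simp only [zero_add] at this
    rw [← ec_nsmul, ← ec_add, ← this]; congr 1; ring
  have h2 : ‖∑ n ∈ range M', ec (f n)‖ * ‖ec γ - 1‖ ≤ 2 := by
    rw [sum_congr rfl fun n _ => h1 n, ← mul_sum, norm_mul, ec_norm, one_mul, ← norm_mul, geom_sum_mul]
    refine (norm_sub_le _ _).trans ?_
    rw [norm_pow, ec_norm]; norm_num
  have h3 := ec_sub_one_ge γ
  set S := ‖∑ n ∈ range M', ec (f n)‖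
  have hS0 : 0 ≤ S := norm_nonneg _
  have h4 : |γ - round γ| * M ≤ |γ - round γ| * (2 ^ t * S) := mul_le_mul_of_nonneg_left hS (abs_nonneg _)
  have h5 : S * (4 * |γ - round γ|) ≤ 2 := (mul_le_mul_of_nonneg_left h3 hS0).trans h2
  have h6 : (0 : ℝ) < 2 ^ t := by positivity
  nlinarith

lemma pow_bound {c t d Q Q1 : ℕ} (hQ : Q = 2 ^ (c * (2 * t + 4))) (hQ1 : Q1 = 2 ^ (2 * t + 3) * Q) :
    512 * Q1 ^ 2 * Q ^ 2 ≤ 2 ^ ((15 + 16 * c) * (t + 1)) ∧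
    (256 * Q1 ^ 2 * Q) ^ (d + 2) ≤ 2 ^ ((15 + 16 * c) * (d + 2) * (t + 1)) := by
  have e : 512 * Q1 ^ 2 * Q ^ 2 = 2 ^ (9 + 2 * (2 * t + 3) + 4 * (c * (2 * t + 4))) := by
    rw [hQ1, hQ]
    rw [show (512 : ℕ) = 2 ^ 9 by norm_num, mul_pow, ← pow_mul, ← pow_mul, ← pow_add, ← pow_add, ← pow_add]
    congr 1; ring
  have h1 : 512 * Q1 ^ 2 * Q ^ 2 ≤ 2 ^ ((15 + 16 * c) * (t + 1)) := by
    rw [e]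
    apply Nat.pow_le_pow_right (by norm_num)
    nlinarith [Nat.zero_le (c * t)]
  refine ⟨h1, ?_⟩
  have hQp : 1 ≤ Q := by rw [hQ]; exact Nat.one_le_two_pow
  have h2 : 256 * Q1 ^ 2 * Q ≤ 2 ^ ((15 + 16 * c) * (t + 1)) := by
    refine le_trans ?_ h1
    have : Q ≤ Q ^ 2 := by nlinarith
    have := Nat.mul_le_mul_left (256 * Q1 ^ 2) this
    nlinarith [Nat.zero_le (Q1 ^ 2 * Q ^ 2)]
  refine (Nat.pow_le_pow_left h2 (d + 2)).trans (le_of_eq ?_)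
  rw [← pow_mul]; congr 1; ring

theorem weyl (d : ℕ) : ∃ c : ℕ, ∀ (t M M' : ℕ) (f : ℕ → ℝ) (γ : ℝ), M' ≤ M → 1 ≤ M → QP (d + 1) γ f →
    (M : ℝ) ≤ 2 ^ t * ‖∑ n ∈ range M', ec (f n)‖ →
    ∃ r : ℕ, 1 ≤ r ∧ r ≤ 2 ^ (c * (t + 1)) ∧ ∃ a : ℤ, |r * γ - a| * (M : ℝ) ^ (d + 1) ≤ 2 ^ (c * (t + 1)) := by
  induction d with
  | zero =>
    refine ⟨1, fun t M M' f γ _ _ hf hS => ⟨1, le_rfl, Nat.one_le_two_pow, round γ, ?_⟩⟩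
    have := weyl_base t M M' f γ hf hS
    rw [Nat.cast_one, one_mul, zero_add, pow_one]
    refine this.trans (pow_le_pow_right₀ (by norm_num) (by omega))
  | succ d ih =>
    obtain ⟨c, ih⟩ := ih
    refine ⟨(15 + 16 * c) * (d + 2), fun t M M' f γ hM' hM1 hf hS => ?_⟩
    obtain ⟨Q, hQ⟩ : ∃ Q, Q = 2 ^ (c * (2 * t + 4)) := ⟨_, rfl⟩
    obtain ⟨Q1, hQ1⟩ : ∃ Q1, Q1 = 2 ^ (2 * t + 3) * Q := ⟨_, rfl⟩
    obtain ⟨pb1, pb2⟩ := pow_bound (d := d) hQ hQ1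
    have hQp : 1 ≤ Q := by rw [hQ]; exact Nat.one_le_two_pow
    have hQ1p : 1 ≤ Q1 := by rw [hQ1]; exact Nat.mul_pos Nat.one_le_two_pow hQp
    have hMr : (0 : ℝ) < M := by exact_mod_cast hM1
    have hcc : 2 ^ ((15 + 16 * c) * (t + 1)) ≤ 2 ^ ((15 + 16 * c) * (d + 2) * (t + 1)) := by
      apply Nat.pow_le_pow_right (by norm_num)
      refine Nat.mul_le_mul_right _ (Nat.le_mul_of_pos_right _ (by omega))
    by_cases hM : M < 256 * Q1 ^ 2 * Q
    · refine ⟨1, le_rfl, Nat.one_le_two_pow, round γ, ?_⟩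
      rw [Nat.cast_one, one_mul]
      have h1 : (M : ℝ) ^ (d + 2) ≤ 2 ^ ((15 + 16 * c) * (d + 2) * (t + 1)) := by
        exact_mod_cast (Nat.pow_le_pow_left hM.le (d + 2)).trans pb2
      have h2 := abs_sub_round γ
      have h3 : (0 : ℝ) ≤ (M : ℝ) ^ (d + 2) := by positivity
      calc |γ - round γ| * (M : ℝ) ^ (d + 1 + 1) ≤ 1 * (M : ℝ) ^ (d + 2) :=
            mul_le_mul_of_nonneg_right (by linarith) h3
        _ ≤ _ := by rw [one_mul]; exact h1
    push Not at hM
    -- van der Corput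
    set Sh : ℕ → ℝ := fun h => ‖∑ n ∈ range (M' - 1 - h), ec (f (n + (h + 1)) - f n)‖ with hSh
    have hvdc := vdc (fun n => ec (f n)) (fun n => ec_norm _) M'
    simp_rw [← ec_sub] at hvdc
    change _ ≤ (M' : ℝ) + 2 * ∑ h ∈ range M', Sh h at hvdc
    set S := ‖∑ n ∈ range M', ec (f n)‖ with hSdef
    have hS0 : 0 ≤ S := norm_nonneg _
    have hM'r : (M' : ℝ) ≤ M := by exact_mod_cast hM'
    have h2t : (2 : ℝ) ^ (2 * t) = (2 ^ t) ^ 2 := by rw [← pow_mul, mul_comm]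
    have hbig : (M : ℝ) ^ 2 ≤ 2 ^ (2 * t + 2) * ∑ h ∈ range M', Sh h := by
      have h1 : (M : ℝ) ^ 2 ≤ 2 ^ (2 * t) * S ^ 2 := by
        rw [h2t, ← mul_pow]; exact pow_le_pow_left₀ hMr.le hS 2
      have h2 : (2 : ℝ) ^ (2 * t) * 2 ≤ M := by
        have : 2 ^ (2 * t) * 2 ≤ M := by
          refine le_trans ?_ hM
          have h5 : 2 ^ (2 * t) ≤ Q1 := by
            rw [hQ1]
            calc 2 ^ (2 * t) ≤ 2 ^ (2 * t + 3) := Nat.pow_le_pow_right (by norm_num) (by omega)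
              _ ≤ _ := Nat.le_mul_of_pos_right _ hQp
          nlinarith [Nat.mul_le_mul hQ1p hQ1p, Nat.mul_le_mul (Nat.mul_le_mul hQ1p hQ1p) hQp]
        exact_mod_cast this
      have h3 : (2 : ℝ) ^ (2 * t) * S ^ 2 ≤ 2 ^ (2 * t) * (M + 2 * ∑ h ∈ range M', Sh h) :=
        mul_le_mul_of_nonneg_left (by linarith) (by positivity)
      rw [pow_add]
      nlinarith
    set H := (range M').filter (fun h => (M : ℝ) ≤ 2 ^ (2 * t + 3) * Sh h) with hH
    have hShM : ∀ h, Sh h ≤ M := by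
      intro h
      refine (norm_sum_le _ _).trans ?_
      simp only [ec_norm, sum_const, card_range, nsmul_eq_mul, mul_one]
      refine le_trans ?_ hM'r
      exact_mod_cast (by omega : M' - 1 - h ≤ M')
    have hHc : (M : ℝ) ≤ 2 ^ (2 * t + 3) * H.card := by
      have h1 : ∑ h ∈ range M', Sh h ≤ ∑ h ∈ range M', ((if h ∈ H then (M : ℝ) else 0) + M / 2 ^ (2 * t + 3)) := by
        refine sum_le_sum fun h hh => ?_
        split_ifs with hc
        · have := hShM h
          have : (0 : ℝ) ≤ M / 2 ^ (2 * t + 3) := by positivity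
          linarith
        · have : ¬ ((M : ℝ) ≤ 2 ^ (2 * t + 3) * Sh h) := fun hx => hc (mem_filter.2 ⟨hh, hx⟩)
          rw [zero_add, le_div_iff₀ (by positivity)]
          linarith
      rw [sum_add_distrib, sum_ite_mem, inter_eq_right.2 (filter_subset _ _), sum_const, sum_const, card_range,
        nsmul_eq_mul, nsmul_eq_mul] at h1
      have h2 : (M' : ℝ) * (M / 2 ^ (2 * t + 3)) ≤ M * (M / 2 ^ (2 * t + 3)) :=
        mul_le_mul_of_nonneg_right hM'r (by positivity)
      have h3 : (2 : ℝ) ^ (2 * t + 3) * (M * (M / 2 ^ (2 * t + 3))) = M ^ 2 := by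
        field_simp
      have h4 : (2 : ℝ) ^ (2 * t + 3) * ∑ h ∈ range M', Sh h ≤ 2 ^ (2 * t + 3) * (H.card * M) + M ^ 2 := by
        rw [← h3, ← mul_add]
        exact mul_le_mul_of_nonneg_left (by linarith) (by positivity)
      have h5 : (2 : ℝ) ^ (2 * t + 3) = 2 * 2 ^ (2 * t + 2) := by ring
      have h6 : (M : ℝ) * M ≤ (2 ^ (2 * t + 3) * H.card) * M := by nlinarith
      exact le_of_mul_le_mul_right h6 hMr
    -- IH on H
    have hIH : ∀ h ∈ H, ∃ r : ℕ, 1 ≤ r ∧ r ≤ Q ∧ ∃ a : ℤ, |r * (((h + 1 : ℕ) : ℝ) * γ) - a| * (M : ℝ) ^ (d + 1) ≤ Q := by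
      intro h hh
      have := ih (2 * t + 3) M (M' - 1 - h) _ _ (by omega) hM1 (hf (h + 1)) (mem_filter.1 hh).2
      rw [hQ]
      push_cast at this ⊢
      exact this
    choose! ρ hρ1 hρQ hρ using hIH
    have hHne : M ≤ 2 ^ (2 * t + 3) * H.card := by exact_mod_cast hHc
    obtain ⟨r, hr, hrc⟩ := exists_le_card_fiber_of_nsmul_le_card_of_maps_to (s := H) (t := Icc 1 Q) (f := ρ)
      (b := (H.card : ℝ) / Q)
      (fun h hh => mem_Icc.2 ⟨hρ1 h hh, hρQ h hh⟩) ⟨1, mem_Icc.2 ⟨le_rfl, hQp⟩⟩ (by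
        rw [Nat.card_Icc, nsmul_eq_mul, Nat.add_sub_cancel]
        have : (Q : ℝ) ≠ 0 := by positivity
        rw [mul_div_cancel₀ _ this])
    obtain ⟨hr1, hrQ⟩ := mem_Icc.1 hr
    set F := H.filter (fun h => ρ h = r) with hF
    have hQr : (0 : ℝ) < Q := by exact_mod_cast hQp
    rw [div_le_iff₀ hQr] at hrc
    have hFc : H.card ≤ F.card * Q := by exact_mod_cast hrc
    have hFM : M ≤ Q1 * (F.image (fun h => h + 1)).card := by
      rw [card_image_of_injective _ (add_left_injective 1), hQ1]
      calc M ≤ _ := hHne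
        _ ≤ 2 ^ (2 * t + 3) * (F.card * Q) := Nat.mul_le_mul_left _ hFc
        _ = _ := by ring
    have hsub : F.image (fun h => h + 1) ⊆ range M := by
      intro x hx
      obtain ⟨h, hh, rfl⟩ := mem_image.1 hx
      have h1 := mem_filter.1 (mem_filter.1 hh).1
      have h2 := mem_range.1 h1.1
      by_contra hcon
      have : M' - 1 - h = 0 := by have := mem_range.not.1 hcon; omega
      have h3 := h1.2
      simp only [hSh, this, range_zero, sum_empty, norm_zero, mul_zero] at h3
      linarith
    have hMd : (0 : ℝ) < (M : ℝ) ^ (d + 1) := by positivity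
    obtain ⟨q, hq1, hq2, a, ha⟩ := vino hQp hQ1p hM hsub hFM (γ := r * γ) (δ := Q / (M : ℝ) ^ (d + 1)) (by
        rw [div_mul_eq_mul_div, div_le_iff₀ hMd]
        refine mul_le_mul_of_nonneg_left ?_ hQr.le
        calc (M : ℝ) = M ^ 1 := (pow_one _).symm
          _ ≤ _ := pow_le_pow_right₀ (by exact_mod_cast hM1) (by omega)) (by
        intro x hx
        obtain ⟨h, hh, rfl⟩ := mem_image.1 hx
        have h1 := mem_filter.1 hh
        obtain ⟨a, ha⟩ := hρ h h1.1
        refine ⟨a, ?_⟩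
        rw [le_div_iff₀ hMd]
        rw [h1.2] at ha
        have e : ((h + 1 : ℕ) : ℝ) * (r * γ) = r * (((h + 1 : ℕ) : ℝ) * γ) := by ring
        change |((h + 1 : ℕ) : ℝ) * (r * γ) - a| * _ ≤ _
        rw [e]
        exact ha)
    refine ⟨q * r, Nat.mul_pos hq1 hr1, ?_, a, ?_⟩
    · refine le_trans ?_ (pb1.trans hcc)
      calc q * r ≤ 2 * Q1 * Q := Nat.mul_le_mul hq2 hrQ
        _ ≤ 512 * Q1 ^ 2 * Q ^ 2 := by
          have h1 : Q1 * Q ≤ (Q1 * Q) ^ 2 := Nat.le_self_pow (by norm_num) _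
          rw [mul_pow] at h1
          nlinarith
    · have h1 : (512 * Q1 ^ 2 * Q ^ 2 : ℝ) ≤ 2 ^ ((15 + 16 * c) * (d + 2) * (t + 1)) := by
        exact_mod_cast pb1.trans hcc
      refine le_trans ?_ h1
      have h2 := mul_le_mul_of_nonneg_right ha hMd.le
      calc |((q * r : ℕ) : ℝ) * γ - a| * (M : ℝ) ^ (d + 1 + 1) = |q * (r * γ) - a| * M * (M : ℝ) ^ (d + 1) := by
            push_cast; rw [mul_assoc (q : ℝ)]; ring
        _ ≤ _ := h2
        _ = _ := by field_simp
end

section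
open Finset

lemma ec_div_prim {s : ℕ} (hs : 0 < s) : IsPrimitiveRoot (ec (1 / s)) s := by
  have := Complex.isPrimitiveRoot_exp s hs.ne'
  convert this using 1
  unfold ec; congr 1; push_cast; ring

lemma sum_nthRoots {s : ℕ} (hs : 0 < s) (n : ℕ) :
    ∑ z ∈ Polynomial.nthRootsFinset s (1 : ℂ), z ^ n = if s ∣ n then (s : ℂ) else 0 := by
  have hp := ec_div_prim hs
  set w := ec (1 / s)
  have himg : Polynomial.nthRootsFinset s (1 : ℂ) = (range s).image (fun i => w ^ i) := by
    ext z
    rw [Polynomial.mem_nthRootsFinset hs, mem_image]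
    constructor
    · intro hz
      have : NeZero s := ⟨hs.ne'⟩
      obtain ⟨i, hi, h⟩ := hp.eq_pow_of_pow_eq_one hz
      exact ⟨i, mem_range.2 hi, h⟩
    · rintro ⟨i, _, rfl⟩
      rw [← pow_mul, mul_comm, pow_mul, hp.pow_eq_one, one_pow]
  rw [himg, sum_image (fun i hi j hj h => hp.pow_inj (mem_range.1 hi) (mem_range.1 hj) h)]
  have e : ∀ i, (w ^ i) ^ n = (w ^ n) ^ i := fun i => by rw [← pow_mul, ← pow_mul, mul_comm]
  rw [sum_congr rfl fun i _ => e i]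
  split_ifs with h
  · rw [(hp.pow_eq_one_iff_dvd n).2 h]; simp
  · have h1 : w ^ n ≠ 1 := fun h' => h ((hp.pow_eq_one_iff_dvd n).1 h')
    rw [geom_sum_eq h1, ← pow_mul, mul_comm, pow_mul, hp.pow_eq_one, one_pow, sub_self, zero_div]

open ArithmeticFunction in
lemma ram_prim {s : ℕ} (hs : 0 < s) {n : ℕ} (hn : n.Coprime s) :
    ∑ z ∈ primitiveRoots s ℂ, z ^ n = (ArithmeticFunction.moebius s : ℂ) := by
  classical
  have h1 : ∀ m > 0, ∑ i ∈ m.divisors, (∑ z ∈ primitiveRoots i ℂ, z ^ n) = if m ∣ n then (m : ℂ) else 0 := by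
    intro m hm
    rw [← sum_nthRoots hm n, IsPrimitiveRoot.nthRoots_one_eq_biUnion_primitiveRoots,
      sum_biUnion fun i _ j _ hij => IsPrimitiveRoot.disjoint hij]
  have h2 := sum_eq_iff_sum_mul_moebius_eq.1 h1 s hs
  rw [← h2, sum_eq_single (s, 1)]
  · simp
  · rintro ⟨a, b⟩ hab hne
    rw [Nat.mem_divisorsAntidiagonal] at hab
    simp only at hab ⊢
    rw [if_neg, mul_zero]
    intro hbn
    have hb1 : b = 1 := Nat.eq_one_of_dvd_coprimes hn hbn (hab.1 ▸ Dvd.intro_left a rfl)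
    apply hne
    rw [hb1] at hab ⊢
    rw [← hab.1, mul_one]
  · intro h
    exact absurd (Nat.mem_divisorsAntidiagonal.2 ⟨mul_one s, hs.ne'⟩) h

/-- reduced residues -/
def redR (s : ℕ) : Finset ℕ := (range s).filter (fun b => b.Coprime s)

lemma redR_card (s : ℕ) : (redR s).card = s.totient := by
  rw [redR, Nat.totient_eq_card_coprime]
  congr 1; ext b; simp [Nat.coprime_comm]

lemma ram {s : ℕ} (hs : 0 < s) {n : ℕ} (hn : n.Coprime s) :
    ∑ b ∈ redR s, ec (n * (b / s)) = (ArithmeticFunction.moebius s : ℂ) := by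
  rw [← ram_prim hs hn]
  have hp := ec_div_prim hs
  have : NeZero s := ⟨hs.ne'⟩
  have himg : primitiveRoots s ℂ = (redR s).image (fun i => ec (1 / s) ^ i) := by
    ext z
    rw [mem_primitiveRoots hs, hp.isPrimitiveRoot_iff, mem_image]
    simp [redR, and_assoc]
  have hinj : Set.InjOn (fun i => ec (1 / s) ^ i) (redR s) := by
    intro i hi j hj h
    simp only [redR, coe_filter, Set.mem_ofPred_eq, mem_range] at hi hj
    exact hp.pow_inj hi.1 hj.1 h
  rw [himg, sum_image hinj]
  refine sum_congr rfl fun b _ => ?_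
  rw [ec_nsmul, ← ec_nsmul b]
  congr 2; ring

/-- major arcs -/
def arc (R X : ℕ) (α : ℝ) : Prop := ∃ r : ℕ, 1 ≤ r ∧ r ≤ R ∧ ∃ a : ℤ, |α - a / r| * X ≤ R

lemma arc_add_int {R X : ℕ} {α : ℝ} (n : ℤ) (h : arc R X α) : arc R X (α + n) := by
  obtain ⟨r, h1, h2, a, ha⟩ := h
  refine ⟨r, h1, h2, a + n * r, ?_⟩
  have hr : (r : ℝ) ≠ 0 := by positivity
  have : α + n - ((a + n * r : ℤ) : ℝ) / r = α - a / r := by push_cast; field_simp; ring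
  rwa [this]

/-- exponential sum -/
noncomputable def es (f : ℕ → ℝ) (X : ℕ) (α : ℝ) : ℂ := ∑ n ∈ range (X + 1), (f n : ℂ) * ec (n * α)

lemma es_periodic (f : ℕ → ℝ) (X : ℕ) (α : ℝ) (m : ℤ) : es f X (α + m) = es f X α := by
  unfold es
  refine sum_congr rfl fun n _ => ?_
  rw [mul_add, show (n : ℝ) * (m : ℝ) = ((n * m : ℤ) : ℝ) by push_cast; ring, ec_add_int]

lemma shift_grid {N : ℕ} (hN : 0 < N) {g : ℝ → ℝ} (hg : ∀ x (m : ℤ), g (x + m) = g x) (c : ℕ) :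
    ∑ j ∈ range N, g (j / N + c / N) = ∑ j ∈ range N, g (j / N) := by
  induction c with
  | zero => simp
  | succ c ih =>
    rw [← ih]
    have h1 := sum_range_succ (fun j : ℕ => g (j / N + c / N)) N
    have h2 := sum_range_succ' (fun j : ℕ => g (j / N + c / N)) N
    have hN' : (N : ℝ) ≠ 0 := by positivity
    have h3 : g ((N : ℝ) / N + c / N) = g (((0 : ℕ) : ℝ) / N + c / N) := by
      rw [div_self hN', Nat.cast_zero, zero_div, zero_add, ← hg (c / N) 1]; congr 1; push_cast; ring
    have h4 : ∑ j ∈ range N, g ((j : ℝ) / N + (c + 1 : ℕ) / N) = ∑ j ∈ range N, g (((j + 1 : ℕ) : ℝ) / N + c / N) := by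
      refine sum_congr rfl fun j _ => ?_
      congr 1; push_cast; ring
    rw [h4]
    linarith

lemma es_ram {f : ℕ → ℝ} {X s : ℕ} (hs : 0 < s) (hsq : Squarefree s) (hf : ∀ n, f n ≠ 0 → n.Coprime s) (α : ℝ) :
    ‖es f X α‖ ^ 2 ≤ s.totient * ∑ b ∈ redR s, ‖es f X (α + b / s)‖ ^ 2 := by
  have h1 : ∑ b ∈ redR s, es f X (α + b / s) = (ArithmeticFunction.moebius s : ℂ) * es f X α := by
    unfold es
    rw [sum_comm, mul_sum]
    refine sum_congr rfl fun n _ => ?_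
    by_cases hn : f n = 0
    · simp [hn]
    · rw [← ram hs (hf n hn), sum_mul]
      refine sum_congr rfl fun b _ => ?_
      rw [mul_add, ec_add]; ring
  have h2 : ‖es f X α‖ ≤ ∑ b ∈ redR s, ‖es f X (α + b / s)‖ := by
    have h3 : ‖((ArithmeticFunction.moebius s : ℤ) : ℂ)‖ = 1 := by
      rw [ArithmeticFunction.moebius_apply_of_squarefree hsq]; simp
    calc ‖es f X α‖ = ‖(ArithmeticFunction.moebius s : ℂ) * es f X α‖ := by rw [norm_mul, h3, one_mul]
      _ ≤ _ := by rw [← h1]; exact norm_sum_le _ _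
  calc ‖es f X α‖ ^ 2 ≤ (∑ b ∈ redR s, ‖es f X (α + b / s)‖) ^ 2 := pow_le_pow_left₀ (norm_nonneg _) h2 2
    _ ≤ _ := by rw [← redR_card]; exact sq_sum_le_card_mul_sum_sq

lemma arc_sep {R X Z : ℕ} (hX : 2 * R ^ 3 * Z ^ 2 < X) {α : ℝ} {s s' b b' : ℕ} (hs : 0 < s) (hs' : 0 < s')
    (hsZ : s ≤ Z) (hsZ' : s' ≤ Z) (hc : ∀ r, 1 ≤ r → r ≤ R → r.Coprime s) (hc' : ∀ r, 1 ≤ r → r ≤ R → r.Coprime s')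
    (hb : b ∈ redR s) (hb' : b' ∈ redR s') (h : arc R X (α - b / s)) (h' : arc R X (α - b' / s')) :
    s = s' ∧ b = b' := by
  obtain ⟨r, hr1, hrR, a, ha⟩ := h
  obtain ⟨r', hr1', hrR', a', ha'⟩ := h'
  simp only [redR, mem_filter, mem_range] at hb hb'
  have hXr : (0 : ℝ) < X := by exact_mod_cast (Nat.zero_le _).trans_lt hX
  have hd : |((b : ℝ) / s + a / r) - (b' / s' + a' / r')| * X ≤ 2 * R := by
    have : ((b : ℝ) / s + a / r) - (b' / s' + a' / r') = (α - b' / s' - a' / r') - (α - b / s - a / r) := by ring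
    rw [this]
    have := mul_le_mul_of_nonneg_right (abs_sub (α - b' / s' - a' / r') (α - b / s - a / r)) hXr.le
    linarith
  set I : ℤ := (b * s' - b' * s) * (r * r') + (a * r' - a' * r) * (s * s') with hI
  have hs0 : (0 : ℝ) < s := by exact_mod_cast hs
  have hs0' : (0 : ℝ) < s' := by exact_mod_cast hs'
  have hr0 : (0 : ℝ) < r := by exact_mod_cast hr1
  have hr0' : (0 : ℝ) < r' := by exact_mod_cast hr1'
  have e : ((b : ℝ) / s + a / r) - (b' / s' + a' / r') = I / (s * s' * (r * r')) := by
    rw [hI]; push_cast; field_simp; ring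
  have hI0 : I = 0 := by
    rw [e, abs_div, abs_of_pos (by positivity : (0 : ℝ) < s * s' * (r * r')), div_mul_eq_mul_div,
      div_le_iff₀ (by positivity)] at hd
    have h1 : (s * s' * (r * r') : ℝ) ≤ Z * Z * (R * R) := by
      have : s * s' * (r * r') ≤ Z * Z * (R * R) :=
        Nat.mul_le_mul (Nat.mul_le_mul hsZ hsZ') (Nat.mul_le_mul hrR hrR')
      exact_mod_cast this
    have h2 : (2 * R ^ 3 * Z ^ 2 : ℝ) < X := by exact_mod_cast hX
    have h3 : (2 * R : ℝ) * (s * s' * (r * r')) ≤ 2 * R * (Z * Z * (R * R)) :=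
      mul_le_mul_of_nonneg_left h1 (by positivity)
    have h4 : |(I : ℝ)| * X < 1 * X := by nlinarith
    have h5 : |(I : ℝ)| < 1 := lt_of_mul_lt_mul_right h4 hXr.le
    exact Int.abs_lt_one_iff.1 (by exact_mod_cast h5)
  have hdvd : (s * s' : ℤ) ∣ (b * s' - b' * s) * (r * r') := by
    refine ⟨-(a * r' - a' * r), ?_⟩
    have := hI0; rw [hI] at this; linarith
  have hcop : IsCoprime (s * s' : ℤ) (r * r') := by
    have c1 := Nat.isCoprime_iff_coprime.2 (hc r hr1 hrR)
    have c2 := Nat.isCoprime_iff_coprime.2 (hc r' hr1' hrR')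
    have c3 := Nat.isCoprime_iff_coprime.2 (hc' r hr1 hrR)
    have c4 := Nat.isCoprime_iff_coprime.2 (hc' r' hr1' hrR')
    exact ((c1.mul_left c2).symm).mul_left ((c3.mul_left c4).symm)
  have hdvd2 := hcop.dvd_of_dvd_mul_right hdvd
  have k1 : (s : ℤ) ∣ s' := by
    have h1 : (s : ℤ) ∣ b * s' := by
      have := ((Dvd.intro _ rfl : (s : ℤ) ∣ s * s').trans hdvd2).add (Dvd.intro_left (b' : ℤ) rfl : (s : ℤ) ∣ b' * s)
      simpa using this
    exact (Nat.isCoprime_iff_coprime.2 hb.2).symm.dvd_of_dvd_mul_left h1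
  have k2 : (s' : ℤ) ∣ s := by
    have h1 : (s' : ℤ) ∣ b' * s := by
      have := (Dvd.intro_left (b : ℤ) rfl : (s' : ℤ) ∣ b * s').sub ((Dvd.intro_left _ rfl : (s' : ℤ) ∣ s * s').trans hdvd2)
      simpa using this
    exact (Nat.isCoprime_iff_coprime.2 hb'.2).symm.dvd_of_dvd_mul_left h1
  have hss : s = s' := Nat.dvd_antisymm (by exact_mod_cast k1) (by exact_mod_cast k2)
  refine ⟨hss, ?_⟩
  subst hss
  have k3 : (s : ℤ) ∣ b - b' := by
    rw [← sub_mul, mul_comm ((b : ℤ) - b')] at hdvd2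
    exact (mul_dvd_mul_iff_left (by exact_mod_cast hs.ne')).1 hdvd2
  have : b' ≡ b [MOD s] := (Nat.modEq_iff_dvd).2 k3
  exact (Nat.ModEq.eq_of_lt_of_lt this hb'.1 hb.1).symm

open Classical in
lemma arc_L2 {f : ℕ → ℝ} {R X Z N : ℕ} (hN : 0 < N) (hX : 2 * R ^ 3 * Z ^ 2 < X) (𝒮 : Finset ℕ)
    (h0 : ∀ s ∈ 𝒮, 0 < s) (hsq : ∀ s ∈ 𝒮, Squarefree s) (hZ : ∀ s ∈ 𝒮, s ≤ Z) (hdN : ∀ s ∈ 𝒮, s ∣ N)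
    (hc : ∀ s ∈ 𝒮, ∀ r, 1 ≤ r → r ≤ R → r.Coprime s) (hf : ∀ s ∈ 𝒮, ∀ n, f n ≠ 0 → n.Coprime s) :
    (∑ s ∈ 𝒮, (1 : ℝ) / s.totient) * ∑ j ∈ range N, (if arc R X ((j : ℝ) / N) then ‖es f X (j / N)‖ ^ 2 else 0)
      ≤ ∑ j ∈ range N, ‖es f X (j / N)‖ ^ 2 := by
  have hN' : (0 : ℝ) < N := by exact_mod_cast hN
  have step : ∀ s ∈ 𝒮, (1 : ℝ) / s.totient * ∑ j ∈ range N, (if arc R X ((j : ℝ) / N) then ‖es f X (j / N)‖ ^ 2 else 0)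
      ≤ ∑ j ∈ range N, ∑ b ∈ redR s, (if arc R X ((j : ℝ) / N - b / s) then ‖es f X (j / N)‖ ^ 2 else 0) := by
    intro s hs
    have hs0 := h0 s hs
    have hs0r : (s : ℝ) ≠ 0 := by positivity
    rw [sum_comm]
    have e1 : ∀ b ∈ redR s, ∑ j ∈ range N, (if arc R X ((j : ℝ) / N - b / s) then ‖es f X (j / N)‖ ^ 2 else 0)
        = ∑ j ∈ range N, (if arc R X ((j : ℝ) / N) then ‖es f X (j / N + b / s)‖ ^ 2 else 0) := by
      intro b _
      obtain ⟨q, hq⟩ := hdN s hs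
      have := shift_grid hN (g := fun x => if arc R X (x - b / s) then ‖es f X x‖ ^ 2 else 0) (by
        intro x m
        have : arc R X (x + m - b / s) ↔ arc R X (x - b / s) := by
          constructor
          · intro h
            have := arc_add_int (-m) h
            push_cast at this
            convert this using 1; ring
          · intro h
            have := arc_add_int m h
            convert this using 1; ring
        simp only [this, es_periodic]) (b * q)
      rw [← this]
      refine sum_congr rfl fun j _ => ?_
      have e : ((b * q : ℕ) : ℝ) / N = b / s := by
        have : (q : ℝ) ≠ 0 := by
          rintro h; rw [hq] at hN; simp at h; simp [h] at hN
        rw [hq]; push_cast; field_simp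
      simp only [e, add_sub_cancel_right]
    rw [sum_congr rfl e1, sum_comm, mul_sum]
    refine sum_le_sum fun j _ => ?_
    split_ifs with h
    · have ht : (0 : ℝ) < s.totient := by exact_mod_cast Nat.totient_pos.2 hs0
      rw [one_div, inv_mul_le_iff₀ ht]
      exact es_ram hs0 (hsq s hs) (hf s hs) _
    · simp
  rw [sum_mul]
  refine (sum_le_sum step).trans ?_
  rw [sum_comm]
  refine sum_le_sum fun j _ => ?_
  rw [sum_sigma' 𝒮 (fun s => redR s) (fun s b => if arc R X ((j : ℝ) / N - b / s) then ‖es f X (j / N)‖ ^ 2 else 0),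
    ← sum_filter, sum_const, nsmul_eq_mul]
  have hle : (#{x ∈ 𝒮.sigma fun s => redR s | arc R X ((j : ℝ) / N - x.2 / x.1)} : ℝ) ≤ 1 := by
    have : #{x ∈ 𝒮.sigma fun s => redR s | arc R X ((j : ℝ) / N - x.2 / x.1)} ≤ 1 := by
      refine card_le_one.2 ?_
      rintro ⟨s, b⟩ hx ⟨s', b'⟩ hx'
      simp only [mem_filter, mem_sigma] at hx hx'
      obtain ⟨h1, h2⟩ := arc_sep hX (h0 s hx.1.1) (h0 s' hx'.1.1) (hZ s hx.1.1) (hZ s' hx'.1.1) (hc s hx.1.1) (hc s' hx'.1.1)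
        hx.1.2 hx'.1.2 hx.2 hx'.2
      subst h1; subst h2; rfl
    exact_mod_cast this
  calc _ ≤ 1 * ‖es f X (j / N)‖ ^ 2 := mul_le_mul_of_nonneg_right hle (by positivity)
    _ = _ := one_mul _
end

section
open Finset

noncomputable def kK (k M : ℕ) (α : ℝ) : ℂ := ∑ n ∈ range M, ec ((2 * (4 * n + 3) ^ k : ℕ) * α)

lemma weyl_K (k : ℕ) (hk : 1 ≤ k) : ∃ c : ℕ, ∀ (t M : ℕ) (α : ℝ), 1 ≤ M → (M : ℝ) ≤ 2 ^ t * ‖kK k M α‖ →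
    arc (2 ^ (c * (t + 1))) (2 * (4 * M) ^ k) α := by
  obtain ⟨d, rfl⟩ : ∃ d, k = d + 1 := ⟨k - 1, by omega⟩
  obtain ⟨c, hc⟩ := weyl d
  set A : ℕ := 2 * 4 ^ (d + 1) * (d + 1).factorial with hA
  have hA1 : 1 ≤ A := Nat.one_le_iff_ne_zero.2 (by positivity)
  refine ⟨c + A, fun t M α hM h => ?_⟩
  have hq := QP_smul (2 * 4 ^ (d + 1) * α) (QP_pow (3 / 4) (d + 1))
  have e : ∀ n : ℕ, (2 * 4 ^ (d + 1) * α) * ((n : ℝ) + 3 / 4) ^ (d + 1) = (2 * (4 * n + 3) ^ (d + 1) : ℕ) * α := by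
    intro n
    push_cast
    rw [show (4 * (n : ℝ) + 3) = 4 * (n + 3 / 4) by ring, mul_pow]; ring
  have h' : (M : ℝ) ≤ 2 ^ t * ‖∑ n ∈ range M, ec ((2 * 4 ^ (d + 1) * α) * ((n : ℝ) + 3 / 4) ^ (d + 1))‖ := by
    simp only [e]; exact h
  obtain ⟨r, h1, h2, a, ha⟩ := hc t M M _ _ le_rfl hM hq h'
  have hAp : A ≤ 2 ^ (A * (t + 1)) := Nat.lt_two_pow_self.le.trans (Nat.pow_le_pow_right (by norm_num) (Nat.le_mul_of_pos_right _ (by omega)))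
  refine ⟨r * A, Nat.mul_pos h1 hA1, ?_, a, ?_⟩
  · rw [add_mul, pow_add]; exact Nat.mul_le_mul h2 hAp
  · have hr0 : (0 : ℝ) < r := by exact_mod_cast h1
    have hA0 : (0 : ℝ) < A := by exact_mod_cast hA1
    have hf : (1 : ℝ) ≤ (d + 1).factorial := by exact_mod_cast (d + 1).factorial_pos
    have hAe : (A : ℝ) = 2 * 4 ^ (d + 1) * (d + 1).factorial := by rw [hA]; push_cast; ring
    have e1 : α - a / (r * A : ℕ) = (r * (2 * 4 ^ (d + 1) * α * (d + 1).factorial) - a) / (r * A) := by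
      push_cast; rw [hAe]; field_simp
    have hr1 : (1 : ℝ) ≤ r := by exact_mod_cast h1
    rw [e1, abs_div, abs_of_pos (by positivity : (0 : ℝ) < r * A), div_mul_eq_mul_div, div_le_iff₀ (by positivity)]
    push_cast
    calc |(r : ℝ) * (2 * 4 ^ (d + 1) * α * (d + 1).factorial) - a| * (2 * (4 * M) ^ (d + 1))
        = (|(r : ℝ) * (2 * 4 ^ (d + 1) * α * (d + 1).factorial) - a| * M ^ (d + 1)) * (2 * 4 ^ (d + 1)) := by rw [mul_pow]; ring
      _ ≤ 2 ^ (c * (t + 1)) * A := by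
          refine mul_le_mul ha ?_ (by positivity) (by positivity)
          rw [hAe]; exact le_mul_of_one_le_right (by positivity) hf
      _ ≤ 2 ^ ((c + A) * (t + 1)) * (r * A) := by
          refine mul_le_mul (pow_le_pow_right₀ (by norm_num) ?_) (le_mul_of_one_le_left hA0.le hr1) hA0.le (by positivity)
          exact Nat.mul_le_mul_right _ (by omega)
end

section
open Finset

def prU (x : ℕ) : Finset ℕ := (Ioc 0 x).filter Nat.Prime
noncomputable def PP (x : ℕ) : ℝ := ∏ p ∈ prU x, (1 + 1 / (p : ℝ))

lemma mem_prU {x p : ℕ} : p ∈ prU x ↔ p ≤ x ∧ p.Prime := by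
  simp only [prU, mem_filter, mem_Ioc]
  exact ⟨fun h => ⟨h.1.2, h.2⟩, fun h => ⟨⟨h.2.pos, h.1⟩, h.2⟩⟩

lemma theta_nat_le (x : ℕ) : ∑ p ∈ prU x, Real.log p ≤ Real.log 4 * x := by
  have := Chebyshev.theta_le_log4_mul_x (x := (x : ℝ)) (by positivity)
  rwa [Chebyshev.theta, Nat.floor_natCast] at this

lemma dyadic_sum (i : ℕ) (hi : 1 ≤ i) :
    ∑ p ∈ (prU (2 ^ (i + 1))) \ (prU (2 ^ i)), 1 / (p : ℝ) ≤ 4 / i := by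
  have hi0 : (0 : ℝ) < i := by exact_mod_cast hi
  have hl : 0 < Real.log 2 := Real.log_pos (by norm_num)
  have h1 : ∀ p ∈ (prU (2 ^ (i + 1))) \ (prU (2 ^ i)), 1 / (p : ℝ) ≤ Real.log p * (1 / (2 ^ i * (i * Real.log 2))) := by
    intro p hp
    rw [mem_sdiff, mem_prU, mem_prU] at hp
    have hp2 : 2 ^ i < p := by by_contra h; exact hp.2 ⟨not_lt.1 h, hp.1.2⟩
    have hp2' : (2 : ℝ) ^ i ≤ p := by exact_mod_cast hp2.le
    have hlog : i * Real.log 2 ≤ Real.log p := by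
      rw [← Real.log_pow]; exact Real.log_le_log (by positivity) hp2'
    have : 1 / (p : ℝ) ≤ 1 / 2 ^ i := one_div_le_one_div_of_le (by positivity) hp2'
    refine this.trans ?_
    rw [mul_one_div, div_le_div_iff₀ (by positivity) (by positivity)]
    nlinarith [pow_pos (two_pos : (0 : ℝ) < 2) i]
  refine (sum_le_sum h1).trans ?_
  rw [← sum_mul]
  have h2 : ∑ p ∈ (prU (2 ^ (i + 1))) \ (prU (2 ^ i)), Real.log p ≤ Real.log 4 * 2 ^ (i + 1) := by
    refine (sum_le_sum_of_subset_of_nonneg sdiff_subset fun p _ _ => Real.log_natCast_nonneg p).trans ?_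
    have := theta_nat_le (2 ^ (i + 1)); push_cast at this; exact this
  refine (mul_le_mul_of_nonneg_right h2 (by positivity)).trans ?_
  have h4 : Real.log 4 = 2 * Real.log 2 := by
    rw [show (4 : ℝ) = 2 ^ 2 by norm_num, Real.log_pow]; norm_num
  rw [h4, pow_succ]
  apply le_of_eq
  field_simp
  norm_num

lemma PP_pos (x : ℕ) : 1 ≤ PP x := by
  unfold PP
  refine prod_induction _ (fun x : ℝ => 1 ≤ x) (fun a b => one_le_mul_of_one_le_of_one_le) le_rfl fun p _ => ?_
  have : (0 : ℝ) ≤ 1 / p := by positivity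
  linarith

lemma exp_inv_le {n : ℕ} (hn : 2 ≤ n) : Real.exp (4 / n) ≤ ((n : ℝ) / (n - 1)) ^ 4 := by
  have h2 : (2 : ℝ) ≤ n := by exact_mod_cast hn
  have h := Real.add_one_le_exp (-(1 / (n : ℝ)))
  have e : -(1 / (n : ℝ)) + 1 = (n - 1) / n := by field_simp; ring
  rw [e, Real.exp_neg] at h
  have h3 : Real.exp (1 / n) ≤ n / (n - 1) := by
    have hpos : (0 : ℝ) < (n - 1) / n := by apply div_pos <;> linarith
    have := le_inv_of_le_inv₀ hpos h
    rwa [inv_div] at this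
  calc Real.exp (4 / n) = Real.exp (1 / n) ^ 4 := by rw [← Real.exp_nat_mul]; congr 1; push_cast; ring
    _ ≤ _ := pow_le_pow_left₀ (Real.exp_pos _).le h3 4

lemma PP_le_aux (n : ℕ) : PP (2 ^ (n + 2)) ≤ 2 * (n + 1) ^ 4 := by
  induction n with
  | zero =>
    have : prU (2 ^ (0 + 2)) = {2, 3} := by decide
    rw [PP, this]; norm_num
  | succ n ih =>
    have hsub : prU (2 ^ (n + 2)) ⊆ prU (2 ^ (n + 1 + 2)) := by
      intro p hp
      rw [mem_prU] at hp ⊢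
      exact ⟨hp.1.trans (Nat.pow_le_pow_right (by norm_num) (by omega)), hp.2⟩
    have h1 : PP (2 ^ (n + 1 + 2)) = (∏ p ∈ prU (2 ^ (n + 1 + 2)) \ prU (2 ^ (n + 2)), (1 + 1 / (p : ℝ))) * PP (2 ^ (n + 2)) :=
      (prod_sdiff hsub).symm
    have h2 : ∏ p ∈ prU (2 ^ (n + 1 + 2)) \ prU (2 ^ (n + 2)), (1 + 1 / (p : ℝ)) ≤ Real.exp (4 / (n + 2 : ℕ)) := by
      refine (prod_le_prod (fun p _ => by positivity) fun p _ => ?_).trans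
        ((Real.exp_sum _ _).symm.le.trans (Real.exp_le_exp.2 (dyadic_sum (n + 2) (by omega))))
      rw [add_comm]; exact Real.add_one_le_exp _
    have h3 := h2.trans (exp_inv_le (n := n + 2) (by omega))
    rw [h1]
    refine (mul_le_mul h3 ih (zero_le_one.trans (PP_pos _)) (by positivity)).trans ?_
    push_cast
    apply le_of_eq
    have : (n : ℝ) + 2 - 1 ≠ 0 := by have : (0 : ℝ) ≤ n := by positivity
                                     linarith
    field_simp
    ring

lemma PP_le {n : ℕ} (hn : 1 ≤ n) : PP (2 ^ n) ≤ 2 * n ^ 4 := by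
  rcases Nat.lt_or_ge n 2 with h | h
  · obtain rfl : n = 1 := by omega
    have : prU (2 ^ 1) = {2} := by decide
    rw [PP, this]; norm_num
  · obtain ⟨m, rfl⟩ := Nat.exists_eq_add_of_le' h
    refine (PP_le_aux m).trans ?_
    have : ((m : ℝ) + 1) ^ 4 ≤ ((m + 2 : ℕ) : ℝ) ^ 4 := pow_le_pow_left₀ (by positivity) (by push_cast; linarith) 4
    linarith

/-- squarefree R-rough numbers up to Z -/
def rough (R Z : ℕ) : Finset ℕ := (Icc 1 Z).filter (fun s => Squarefree s ∧ ∀ p ∈ prU R, ¬ p ∣ s)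

lemma rough_coprime {R Z s r : ℕ} (hs : s ∈ rough R Z) (hr1 : 1 ≤ r) (hr : r ≤ R) : r.Coprime s := by
  simp only [rough, mem_filter] at hs
  refine Nat.Coprime.symm (Nat.coprime_of_dvd fun p hp h1 h2 => ?_)
  exact hs.2.2 p (mem_prU.2 ⟨(Nat.le_of_dvd hr1 h2).trans hr, hp⟩) h1

lemma sq_sum_le (Z : ℕ) : ∑ a ∈ Icc 1 Z, 1 / ((a : ℝ) ^ 2) ≤ 2 := by
  have : ∀ Z : ℕ, ∑ a ∈ Icc 1 (Z + 1), 1 / ((a : ℝ) ^ 2) ≤ 2 - 1 / ((Z : ℝ) + 1) := by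
    intro Z
    induction Z with
    | zero => norm_num
    | succ n ih =>
      rw [sum_Icc_succ_top (by omega)]
      refine (add_le_add_left ih _).trans ?_
      have : (1 : ℝ) / ((n + 1 + 1 : ℕ) : ℝ) ^ 2 ≤ 1 / (n + 1) - 1 / (n + 1 + 1) := by
        push_cast
        rw [div_sub_div _ _ (by positivity) (by positivity), div_le_div_iff₀ (by positivity) (by positivity)]
        nlinarith [(by positivity : (0 : ℝ) ≤ n)]
      push_cast at this ⊢
      linarith
  rcases Z with _ | Z
  · norm_num
  · have h := this Z
    have : (0 : ℝ) ≤ 1 / (Z + 1) := by positivity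
    linarith

lemma sum_le_prod_sum {ι κ μ : Type*} [DecidableEq κ] [DecidableEq μ] (A : Finset ι) (B : Finset κ) (C : Finset μ) (g : ι → ℝ) (u : κ → ℝ) (v : μ → ℝ)
    (φ : ι → κ) (ψ : ι → μ) (h1 : ∀ i ∈ A, φ i ∈ B) (h2 : ∀ i ∈ A, ψ i ∈ C) (he : ∀ i ∈ A, g i = u (φ i) * v (ψ i))
    (hinj : ∀ i ∈ A, ∀ j ∈ A, φ i = φ j → ψ i = ψ j → i = j) (hu : ∀ i, 0 ≤ u i) (hv : ∀ i, 0 ≤ v i) :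
    ∑ i ∈ A, g i ≤ (∑ i ∈ B, u i) * ∑ i ∈ C, v i := by
  rw [sum_mul_sum, ← sum_product']
  rw [sum_congr rfl he]
  rw [← sum_image (s := A) (g := fun i => (φ i, ψ i)) (f := fun x => u x.1 * v x.2)]
  · refine sum_le_sum_of_subset_of_nonneg ?_ fun x _ _ => mul_nonneg (hu _) (hv _)
    intro x hx
    obtain ⟨i, hi, rfl⟩ := mem_image.1 hx
    exact mem_product.2 ⟨h1 i hi, h2 i hi⟩
  · intro i hi j hj h
    simp only [Prod.mk.injEq] at h
    exact hinj i hi j hj h.1 h.2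

lemma harm_le (Z : ℕ) : Real.log Z ≤ 2 * ∑ s ∈ (Icc 1 Z).filter Squarefree, 1 / (s : ℝ) := by
  rcases Nat.eq_zero_or_pos Z with rfl | hZ
  · simp
  have h1 : Real.log Z ≤ ∑ n ∈ Icc 1 Z, 1 / (n : ℝ) := by
    have h := log_add_one_le_harmonic Z
    rw [harmonic_eq_sum_Icc] at h
    push_cast at h
    simp only [one_div]
    exact (Real.log_le_log (by exact_mod_cast hZ) (by linarith)).trans h
  refine h1.trans ?_
  have hex : ∀ n ∈ Icc 1 Z, ∃ b a : ℕ, b ^ 2 * a = n ∧ Squarefree a ∧ 1 ≤ b ∧ b ≤ Z ∧ 1 ≤ a ∧ a ≤ Z := by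
    intro n hn
    rw [mem_Icc] at hn
    obtain ⟨a, b, ha, hb, h, hs⟩ := Nat.sq_mul_squarefree_of_pos (n := n) hn.1
    refine ⟨b, a, h, hs, hb, ?_, ha, ?_⟩
    · have : b ≤ b ^ 2 * a := by nlinarith [Nat.mul_pos hb ha]
      omega
    · have : a ≤ b ^ 2 * a := Nat.le_mul_of_pos_left _ (by positivity)
      omega
  choose! b a hba hsq hb1 hbZ ha1 haZ using hex
  refine (sum_le_prod_sum (Icc 1 Z) (Icc 1 Z) ((Icc 1 Z).filter Squarefree) (fun n => 1 / (n : ℝ)) (fun b => 1 / (b : ℝ) ^ 2) (fun s => 1 / (s : ℝ)) b a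
    ?_ ?_ ?_ ?_ (fun _ => by positivity) (fun _ => by positivity)).trans
    (mul_le_mul_of_nonneg_right (sq_sum_le Z) (sum_nonneg fun _ _ => by positivity))
  · intro i hi; exact mem_Icc.2 ⟨hb1 i hi, hbZ i hi⟩
  · intro i hi; exact mem_filter.2 ⟨mem_Icc.2 ⟨ha1 i hi, haZ i hi⟩, hsq i hi⟩
  · intro i hi
    have := hba i hi
    have : (i : ℝ) = (b i : ℝ) ^ 2 * a i := by exact_mod_cast this.symm
    rw [one_div_mul_one_div, ← this]
  · intro i hi j hj e1 e2
    rw [← hba i hi, ← hba j hj, e1, e2]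

lemma sqf_le (R Z : ℕ) : ∑ s ∈ (Icc 1 Z).filter Squarefree, 1 / (s : ℝ) ≤ PP R * ∑ s ∈ rough R Z, 1 / (s : ℝ) := by
  rw [PP, prod_one_add]
  have key : ∀ s ∈ (Icc 1 Z).filter Squarefree, ∃ (t : Finset ℕ) (u : ℕ), t ∈ (prU R).powerset ∧ u ∈ rough R Z ∧ (∏ p ∈ t, p) * u = s := by
    intro s hs
    rw [mem_filter, mem_Icc] at hs
    obtain ⟨⟨h1, h2⟩, h3⟩ := hs
    refine ⟨(prU R).filter (· ∣ s), ∏ p ∈ s.primeFactors.filter (fun p => ¬ p ≤ R), p, ?_, ?_, ?_⟩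
    · exact mem_powerset.2 (filter_subset _ _)
    · have hd : (∏ p ∈ s.primeFactors.filter (fun p => ¬ p ≤ R), p) ∣ s := by
        conv_rhs => rw [← Nat.prod_primeFactors_of_squarefree h3]
        exact prod_dvd_prod_of_subset _ _ _ (filter_subset _ _)
      simp only [rough, mem_filter, mem_Icc]
      refine ⟨⟨Nat.pos_of_dvd_of_pos hd h1, (Nat.le_of_dvd h1 hd).trans h2⟩, h3.squarefree_of_dvd hd, ?_⟩
      intro p hp hpd
      rw [mem_prU] at hp
      obtain ⟨q, hq, hpq⟩ := (Prime.dvd_finsetProd_iff hp.2.prime _).1 hpd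
      rw [mem_filter, Nat.mem_primeFactors] at hq
      have := (Nat.prime_dvd_prime_iff_eq hp.2 hq.1.1).1 hpq
      exact hq.2 (this ▸ hp.1)
    · have : (prU R).filter (· ∣ s) = s.primeFactors.filter (fun p => p ≤ R) := by
        ext p
        simp only [mem_filter, mem_prU, Nat.mem_primeFactors]
        constructor
        · rintro ⟨⟨a, b⟩, c⟩; exact ⟨⟨b, c, by omega⟩, a⟩
        · rintro ⟨⟨a, b, _⟩, c⟩; exact ⟨⟨c, a⟩, b⟩
      rw [this, prod_filter_mul_prod_filter_not, Nat.prod_primeFactors_of_squarefree h3]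
  choose! t u ht hu he using key
  refine sum_le_prod_sum _ _ _ _ (fun t : Finset ℕ => ∏ p ∈ t, 1 / (p : ℝ)) (fun s : ℕ => 1 / (s : ℝ)) t u ht hu ?_ ?_ (fun _ => prod_nonneg fun _ _ => by positivity) (fun _ => by positivity)
  · intro s hs
    have : (s : ℝ) = (∏ p ∈ t s, (p : ℝ)) * u s := by rw [← Nat.cast_prod, ← Nat.cast_mul, he s hs]
    simp only [one_div, prod_inv_distrib]
    rw [← mul_inv, ← this]
  · intro i hi j hj e1 e2
    rw [← he i hi, ← he j hj, e1, e2]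

lemma G_bound {n : ℕ} (hn : 1 ≤ n) (Z : ℕ) :
    Real.log Z ≤ 4 * n ^ 4 * ∑ s ∈ rough (2 ^ n) Z, 1 / (s.totient : ℝ) := by
  have h1 := harm_le Z
  have h2 := sqf_le (2 ^ n) Z
  have h3 := PP_le hn
  have h4 : ∑ s ∈ rough (2 ^ n) Z, 1 / (s : ℝ) ≤ ∑ s ∈ rough (2 ^ n) Z, 1 / (s.totient : ℝ) := by
    refine sum_le_sum fun s hs => ?_
    simp only [rough, mem_filter, mem_Icc] at hs
    exact one_div_le_one_div_of_le (by exact_mod_cast Nat.totient_pos.2 hs.1.1) (by exact_mod_cast Nat.totient_le s)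
  have h5 : (0 : ℝ) ≤ ∑ s ∈ rough (2 ^ n) Z, 1 / (s : ℝ) := sum_nonneg fun _ _ => by positivity
  have h6 := mul_le_mul_of_nonneg_right h3 h5
  have h7 := mul_le_mul_of_nonneg_left h4 (by positivity : (0 : ℝ) ≤ 2 * n ^ 4)
  linarith
end

section
open Finset

lemma grid_orth {N : ℕ} (hN : 0 < N) (n : ℤ) :
    ∑ j ∈ range N, ec (n * ((j : ℝ) / N)) = if (N : ℤ) ∣ n then (N : ℂ) else 0 := by
  have hN' : (N : ℝ) ≠ 0 := by positivity
  have e : ∀ j : ℕ, ec (n * ((j : ℝ) / N)) = ec (n / N) ^ j := fun j => by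
    rw [← ec_nsmul]; congr 1; ring
  simp only [e]
  split_ifs with h
  · obtain ⟨m, rfl⟩ := h
    have : ec (((N * m : ℤ) : ℝ) / N) = 1 := by
      rw [← ec_int m]; congr 1; push_cast; field_simp
    rw [this]; simp
  · have h1 : ec (n / N) ≠ 1 := by
      intro h1
      have h2 := ec_sub_one_ge ((n : ℝ) / N)
      rw [h1, sub_self, norm_zero] at h2
      have h3 : (n : ℝ) / N - round ((n : ℝ) / N) = 0 := abs_eq_zero.1 (le_antisymm (by linarith) (abs_nonneg _))
      apply h
      refine ⟨round ((n : ℝ) / N), ?_⟩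
      have : (n : ℝ) = N * round ((n : ℝ) / N) := by
        rw [← sub_eq_zero.1 h3]; field_simp
      exact_mod_cast this
    rw [geom_sum_eq h1, ← ec_nsmul, mul_div_cancel₀ _ hN', ec_int, sub_self, zero_div]

lemma small_dvd {N : ℕ} {n : ℤ} (h : |n| < N) : (N : ℤ) ∣ n ↔ n = 0 :=
  ⟨fun hd => Int.eq_zero_of_abs_lt_dvd hd h, fun h => h ▸ dvd_zero _⟩

lemma parseval {N X : ℕ} (hN : X < N) (f : ℕ → ℝ) :
    ∑ j ∈ range N, ‖es f X ((j : ℝ) / N)‖ ^ 2 = N * ∑ n ∈ range (X + 1), f n ^ 2 := by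
  have hN0 : 0 < N := by omega
  apply Complex.ofReal_injective
  push_cast
  have e : ∀ j : ℕ, (‖es f X ((j : ℝ) / N)‖ : ℂ) ^ 2 =
      ∑ a ∈ range (X + 1), ∑ b ∈ range (X + 1), (f a * f b : ℂ) * ec (((a : ℤ) - b : ℤ) * ((j : ℝ) / N)) := by
    intro j
    rw [← Complex.mul_conj', es, map_sum, sum_mul_sum]
    refine sum_congr rfl fun a _ => sum_congr rfl fun b _ => ?_
    have : (((a : ℤ) - b : ℤ) : ℝ) * ((j : ℝ) / N) = a * (j / N) - b * (j / N) := by push_cast; ring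
    rw [this, ec_sub, map_mul, Complex.conj_ofReal]; ring
  simp only [e]
  rw [sum_comm, mul_sum]
  refine sum_congr rfl fun a ha => ?_
  rw [sum_comm]
  have e2 : ∀ b ∈ range (X + 1), ∑ j ∈ range N, (f a * f b : ℂ) * ec (((a : ℤ) - b : ℤ) * ((j : ℝ) / N)) =
      if a = b then (N * (f a) ^ 2 : ℂ) else 0 := by
    intro b hb
    rw [mem_range] at ha hb
    rw [← mul_sum, grid_orth hN0]
    simp only [small_dvd (N := N) (n := (a : ℤ) - b) (by rw [abs_lt]; omega)]
    by_cases h : a = b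
    · subst h; simp; ring
    · rw [if_neg (by omega), if_neg h, mul_zero]
  rw [sum_congr rfl e2, sum_ite_eq, if_pos ha]

/-- representation sum -/
def conv (f : ℕ → ℝ) (X n : ℕ) : ℝ := ∑ a ∈ range (X + 1), ∑ b ∈ range (X + 1), if a + b = n then f a * f b else 0

lemma conv_id {N X k M : ℕ} (hN : 2 * X < N) (hM : ∀ n < M, 2 * (4 * n + 3) ^ k ≤ X) (f : ℕ → ℝ) :
    ∑ j ∈ range N, es f X ((j : ℝ) / N) ^ 2 * (starRingEnd ℂ) (kK k M ((j : ℝ) / N)) =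
      N * ((∑ n ∈ range M, conv f X (2 * (4 * n + 3) ^ k) : ℝ) : ℂ) := by
  have hN0 : 0 < N := by omega
  have e : ∀ j : ℕ, es f X ((j : ℝ) / N) ^ 2 * (starRingEnd ℂ) (kK k M ((j : ℝ) / N)) =
      ∑ n ∈ range M, ∑ a ∈ range (X + 1), ∑ b ∈ range (X + 1),
        (f a * f b : ℂ) * ec (((a : ℤ) + b - (2 * (4 * n + 3) ^ k : ℕ) : ℤ) * ((j : ℝ) / N)) := by
    intro j
    rw [kK, map_sum, mul_sum]
    refine sum_congr rfl fun n _ => ?_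
    rw [sq, es, sum_mul_sum, sum_mul]
    refine sum_congr rfl fun a _ => ?_
    rw [sum_mul]
    refine sum_congr rfl fun b _ => ?_
    have : (((a : ℤ) + b - (2 * (4 * n + 3) ^ k : ℕ) : ℤ) : ℝ) * ((j : ℝ) / N)
        = (a * (j / N) + b * (j / N)) - (2 * (4 * n + 3) ^ k : ℕ) * (j / N) := by push_cast; ring
    rw [this, ec_sub, ec_add]; ring
  simp only [e]
  rw [sum_comm, Complex.ofReal_sum, mul_sum]
  refine sum_congr rfl fun n hn => ?_
  rw [conv, Complex.ofReal_sum, sum_comm, mul_sum]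
  refine sum_congr rfl fun a ha => ?_
  rw [Complex.ofReal_sum, sum_comm, mul_sum]
  refine sum_congr rfl fun b hb => ?_
  rw [mem_range] at ha hb hn
  have h1 := hM n hn
  rw [← mul_sum, grid_orth hN0]
  simp only [small_dvd (N := N) (n := (a : ℤ) + b - (2 * (4 * n + 3) ^ k : ℕ)) (by rw [abs_lt]; omega)]
  by_cases h : a + b = 2 * (4 * n + 3) ^ k
  · rw [if_pos (by omega), if_pos h]; push_cast; ring
  · rw [if_neg (by omega), if_neg h]; simp

open Classical in
lemma arc_count {R X N : ℕ} (hR : 1 ≤ R) (hX : 0 < X) (hXN : X ≤ N) (hRX : R * R ≤ X) :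
    (#((range N).filter fun j : ℕ => arc R X ((j : ℝ) / N)) : ℝ) * X ≤ 12 * R ^ 3 * N := by
  have hN0 : (0 : ℝ) < N := by exact_mod_cast hX.trans_le hXN
  have hX0 : (0 : ℝ) < X := by exact_mod_cast hX
  have hR0 : (0 : ℝ) < R := by exact_mod_cast hR
  set D : ℝ := R * N / X with hD
  have hD1 : 1 ≤ D := by
    rw [hD, le_div_iff₀ hX0, one_mul]
    have : (X : ℝ) ≤ N := by exact_mod_cast hXN
    have : (1 : ℝ) ≤ R := by exact_mod_cast hR
    nlinarith
  have hsub : ((range N).filter fun j : ℕ => arc R X ((j : ℝ) / N)) ⊆ (Icc 1 R).biUnion fun r => (Icc (-1 : ℤ) (r + 1)).biUnion fun a =>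
      ((range N).filter fun j : ℕ => |(j : ℝ) - a * N / r| ≤ D) := by
    intro j hj
    rw [mem_filter, mem_range] at hj
    obtain ⟨hjN, r, h1, h2, a, ha⟩ := hj
    have hr0 : (0 : ℝ) < r := by exact_mod_cast h1
    have hjN' : (j : ℝ) / N < 1 := by rw [div_lt_one hN0]; exact_mod_cast hjN
    have hj0 : (0 : ℝ) ≤ (j : ℝ) / N := by positivity
    have hd : |(j : ℝ) / N - a / r| ≤ R / X := by rwa [le_div_iff₀ hX0]
    have hRX' : (R : ℝ) / X ≤ 1 / r := by
      rw [div_le_div_iff₀ hX0 hr0, one_mul]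
      exact_mod_cast (Nat.mul_le_mul_left R h2).trans hRX
    have hd2 := abs_le.1 (hd.trans hRX')
    simp only [mem_biUnion, mem_Icc, mem_filter, mem_range]
    refine ⟨r, ⟨h1, h2⟩, a, ⟨?_, ?_⟩, hjN, ?_⟩
    · have : (-1 : ℝ) ≤ a := by
        have : -1 / (r : ℝ) ≤ a / r := by rw [neg_div]; linarith
        rwa [div_le_div_iff_of_pos_right hr0] at this
      exact_mod_cast this
    · have : (a : ℝ) ≤ r + 1 := by
        have : (a : ℝ) / r ≤ (r + 1) / r := by rw [add_div, div_self hr0.ne']; linarith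
        rwa [div_le_div_iff_of_pos_right hr0] at this
      exact_mod_cast this
    · have : (j : ℝ) - a * N / r = ((j : ℝ) / N - a / r) * N := by field_simp
      rw [this, abs_mul, abs_of_pos hN0, hD, mul_div_right_comm]
      exact mul_le_mul_of_nonneg_right hd hN0.le
  have hint : ∀ y : ℝ, (#((range N).filter fun j : ℕ => |(j : ℝ) - y| ≤ D) : ℝ) ≤ 3 * D := by
    intro y
    have h1 : #((range N).filter fun j : ℕ => |(j : ℝ) - y| ≤ D) ≤ #(Icc ⌈y - D⌉ ⌊y + D⌋) := by
      refine card_le_card_of_injOn (fun j : ℕ => (j : ℤ)) ?_ (fun a _ b _ h => by simpa using h)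
      intro j hj
      simp only [coe_filter, Set.mem_ofPred_eq, abs_le] at hj
      simp only [coe_Icc, Set.mem_Icc, Int.ceil_le, Int.le_floor]
      push_cast
      constructor <;> linarith [hj.2.1, hj.2.2]
    rw [Int.card_Icc] at h1
    have h2 : ((⌊y + D⌋ + 1 - ⌈y - D⌉).toNat : ℝ) ≤ 3 * D := by
      rcases le_total 0 (⌊y + D⌋ + 1 - ⌈y - D⌉) with h | h
      · have : (((⌊y + D⌋ + 1 - ⌈y - D⌉).toNat : ℤ) : ℝ) = ((⌊y + D⌋ + 1 - ⌈y - D⌉ : ℤ) : ℝ) := by rw [Int.toNat_of_nonneg h]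
        rw [← Int.cast_natCast, this]; push_cast
        have := Int.floor_le (y + D)
        have := Int.le_ceil (y - D)
        linarith
      · rw [Int.toNat_of_nonpos h]; push_cast; linarith
    exact (by exact_mod_cast h1 : (#((range N).filter fun j : ℕ => |(j : ℝ) - y| ≤ D) : ℝ) ≤ ((⌊y + D⌋ + 1 - ⌈y - D⌉).toNat : ℝ)).trans h2
  have hc : (#((range N).filter fun j : ℕ => arc R X ((j : ℝ) / N)) : ℝ) ≤ ∑ r ∈ Icc 1 R, ∑ a ∈ Icc (-1 : ℤ) (r + 1), 3 * D := by
    refine (Nat.cast_le.2 ((card_le_card hsub).trans card_biUnion_le)).trans ?_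
    push_cast
    refine sum_le_sum fun r _ => ?_
    refine (Nat.cast_le.2 card_biUnion_le).trans ?_
    push_cast
    exact sum_le_sum fun a _ => hint _
  have hc2 : ∑ r ∈ Icc 1 R, ∑ a ∈ Icc (-1 : ℤ) ((r : ℤ) + 1), 3 * D ≤ ∑ r ∈ Icc 1 R, 4 * R * (3 * D) := by
    refine sum_le_sum fun r hr => ?_
    rw [mem_Icc] at hr
    rw [sum_const, nsmul_eq_mul, Int.card_Icc]
    refine mul_le_mul_of_nonneg_right ?_ (by linarith)
    have : ((r : ℤ) + 1 + 1 - -1).toNat ≤ 4 * R := by omega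
    exact_mod_cast this
  rw [sum_const, Nat.card_Icc, nsmul_eq_mul] at hc2
  have hDX : D * X = R * N := by rw [hD]; field_simp
  have := mul_le_mul_of_nonneg_right (hc.trans hc2) hX0.le
  refine this.trans (le_of_eq ?_)
  simp only [Nat.add_sub_cancel]
  linear_combination 12 * (R : ℝ) ^ 2 * hDX
end

section
open Finset

def vV (w : ℕ) : ℕ := 8 * w.factorial
noncomputable def lam (w : ℕ) : ℝ := (vV w : ℝ) / (vV w).totient
noncomputable def f0 (w n : ℕ) : ℝ := if n % 8 = 5 ∧ n.Coprime (vV w) then lam w else 0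

def oddPr (w : ℕ) : Finset ℕ := (prU w).erase 2
lemma mem_oddPr {w p : ℕ} : p ∈ oddPr w ↔ p.Prime ∧ p ≤ w ∧ p ≠ 2 := by
  rw [oddPr, mem_erase, mem_prU]; tauto

lemma prime_dvd_vV {w p : ℕ} (hp : p.Prime) : p ∣ vV w ↔ p = 2 ∨ p ≤ w := by
  rw [vV, hp.dvd_mul, hp.dvd_factorial, show 8 = 2 ^ 3 by norm_num]
  exact or_congr ⟨fun h => (Nat.prime_dvd_prime_iff_eq hp Nat.prime_two).1 (hp.dvd_of_dvd_pow h), fun h => h ▸ dvd_pow_self _ (by norm_num)⟩ Iff.rfl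

lemma vV_pos (w : ℕ) : 0 < vV w := by unfold vV; positivity

lemma coprime_vV {w a : ℕ} (h5 : a % 8 = 5) : a.Coprime (vV w) ↔ ∀ p ∈ oddPr w, ¬ p ∣ a := by
  constructor
  · intro h p hp hpa
    rw [mem_oddPr] at hp
    exact Nat.Prime.not_dvd_one hp.1 (h ▸ Nat.dvd_gcd hpa ((prime_dvd_vV hp.1).2 (Or.inr hp.2.1)))
  · intro h
    refine Nat.coprime_of_dvd fun p hp h1 h2 => ?_
    have h3 : p ≠ 2 := by rintro rfl; omega
    exact h p (mem_oddPr.2 ⟨hp, ((prime_dvd_vV hp).1 h2).resolve_left h3, h3⟩) h1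

lemma primeFactors_vV (w : ℕ) : (vV w).primeFactors = insert 2 (oddPr w) := by
  ext p
  rw [Nat.mem_primeFactors, mem_insert, mem_oddPr]
  constructor
  · rintro ⟨h1, h2, _⟩
    have := (prime_dvd_vV h1).1 h2
    tauto
  · rintro (rfl | ⟨h1, h2, h3⟩)
    · exact ⟨Nat.prime_two, (prime_dvd_vV Nat.prime_two).2 (Or.inl rfl), (vV_pos w).ne'⟩
    · exact ⟨h1, (prime_dvd_vV h1).2 (Or.inr h2), (vV_pos w).ne'⟩

lemma lam_eq (w : ℕ) : lam w = 2 * ∏ p ∈ oddPr w, (p : ℝ) / (p - 1) := by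
  have h := Nat.totient_eq_mul_prod_factors (vV w)
  rw [primeFactors_vV, prod_insert (by simp [oddPr])] at h
  have h2 : ((vV w).totient : ℝ) = vV w * ((1 - (2 : ℝ)⁻¹) * ∏ p ∈ oddPr w, (1 - (p : ℝ)⁻¹)) := by
    have := congrArg (fun q : ℚ => (q : ℝ)) h
    push_cast at this
    exact this
  have hV : (vV w : ℝ) ≠ 0 := by exact_mod_cast (vV_pos w).ne'
  have h3 : ∏ p ∈ oddPr w, (p : ℝ) / (p - 1) = (∏ p ∈ oddPr w, (1 - (p : ℝ)⁻¹))⁻¹ := by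
    rw [← prod_inv_distrib]
    refine prod_congr rfl fun p hp => ?_
    have : (p : ℝ) ≠ 0 := by exact_mod_cast (mem_oddPr.1 hp).1.ne_zero
    rw [← inv_div, sub_div, div_self this, one_div]
  rw [lam, h2, h3, div_mul_eq_div_div, div_self hV, one_div, mul_inv]
  norm_num

lemma oddPr_ge {w p : ℕ} (hp : p ∈ oddPr w) : 3 ≤ p := by
  rw [mem_oddPr] at hp
  have := hp.1.two_le
  omega

lemma lam_le (w : ℕ) (hw : 2 ≤ w) : lam w ≤ PP w ^ 2 := by
  have h2 : prU w = insert 2 (oddPr w) := by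
    rw [oddPr, insert_erase (mem_prU.2 ⟨hw, Nat.prime_two⟩)]
  rw [lam_eq, PP, h2, prod_insert (by simp [oddPr]), mul_pow, ← prod_pow]
  refine mul_le_mul (by norm_num) (prod_le_prod (fun p hp => ?_) fun p hp => ?_) (prod_nonneg fun p hp => ?_) (by positivity)
  all_goals
    have h3 : (3 : ℝ) ≤ p := by exact_mod_cast oddPr_ge hp
  · apply div_nonneg <;> linarith
  · rw [div_le_iff₀ (by linarith)]
    have : (1 + 1 / (p : ℝ)) = (p + 1) / p := by field_simp
    rw [this, div_pow, div_mul_eq_mul_div, le_div_iff₀ (by positivity)]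
    nlinarith
  · apply div_nonneg <;> linarith

lemma lam_pos (w : ℕ) : 0 < lam w := by
  rw [lam]
  have h1 : (0 : ℝ) < vV w := by exact_mod_cast vV_pos w
  have h2 : (0 : ℝ) < (vV w).totient := by exact_mod_cast Nat.totient_pos.2 (vV_pos w)
  positivity

lemma f0_nonneg (w n : ℕ) : 0 ≤ f0 w n := by
  unfold f0; split_ifs
  · exact (lam_pos w).le
  · rfl

/-- decomposition a = u + W v -/
lemma sum_range_mul_decomp (W q : ℕ) (g : ℕ → ℕ) :
    ∑ a ∈ range (W * q), g a = ∑ u ∈ range W, ∑ v ∈ range q, g (u + W * v) := by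
  rw [sum_comm]
  induction q with
  | zero => simp
  | succ q ih =>
    rw [mul_add, mul_one, sum_range_add, ih, sum_range_succ]
    congr 1
    exact sum_congr rfl fun u _ => by rw [add_comm]

def good (N : ℤ) (S : Finset ℕ) (a : ℕ) : Prop := a % 8 = 5 ∧ ∀ p ∈ S, ¬ (p : ℤ) ∣ a ∧ ¬ (p : ℤ) ∣ N - a

open Classical in
lemma good_count (N : ℤ) (S : Finset ℕ) (hS : ∀ p ∈ S, p.Prime ∧ p ≠ 2) :
    ∏ p ∈ S, (p - 2) ≤ ∑ a ∈ range (8 * ∏ p ∈ S, p), if good N S a then 1 else 0 := by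
  induction S using Finset.induction_on with
  | empty =>
    simp only [good, prod_empty, mul_one, notMem_empty, false_imp_iff, implies_true, and_true]
    decide
  | insert p S hpS ih =>
    have ih := ih fun q hq => hS q (mem_insert_of_mem hq)
    obtain ⟨hp, hp2⟩ := hS p (mem_insert_self _ _)
    rw [prod_insert hpS, prod_insert hpS]
    set W := 8 * ∏ q ∈ S, q with hW
    have hW0 : 0 < W := by
      rw [hW]
      exact Nat.mul_pos (by norm_num) (prod_pos fun q hq => (hS q (mem_insert_of_mem hq)).1.pos)
    have hcop : IsCoprime (p : ℤ) W := by
      rw [Nat.isCoprime_iff_coprime, hW]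
      refine Nat.Coprime.mul_right ?_ (Nat.Coprime.prod_right fun q hq => ?_)
      · exact (Nat.coprime_pow_right_iff (n := 3) (by norm_num) p 2).2 ((Nat.coprime_primes hp Nat.prime_two).2 hp2)
      · refine (Nat.coprime_primes hp (hS q (mem_insert_of_mem hq)).1).2 ?_
        rintro rfl; exact hpS hq
    rw [show 8 * (p * ∏ q ∈ S, q) = W * p by rw [hW]; ring, sum_range_mul_decomp W p]
    rw [mul_comm]
    refine (Nat.mul_le_mul_right _ ih).trans ?_
    rw [sum_mul]
    refine sum_le_sum fun u _ => ?_
    split_ifs with hu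
    swap
    · simp
    rw [one_mul, ← card_filter]
    -- bad v for residue class z
    have hbad : ∀ z : ℤ, #((range p).filter fun v : ℕ => (p : ℤ) ∣ z - W * v) ≤ 1 := by
      intro z
      refine card_le_one.2 fun a ha b hb => ?_
      rw [mem_filter, mem_range] at ha hb
      have h1 : (p : ℤ) ∣ W * ((a : ℤ) - b) := by
        have := hb.2.sub ha.2
        rwa [show z - W * (b : ℤ) - (z - W * a) = W * ((a : ℤ) - b) by ring] at this
      have h2 := hcop.dvd_of_dvd_mul_left h1
      have h3 : (b : ℕ) ≡ a [MOD p] := (Nat.modEq_iff_dvd).2 h2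
      exact (Nat.ModEq.eq_of_lt_of_lt h3 hb.1 ha.1).symm
    have hcover : range p ⊆ ((range p).filter fun v : ℕ => good N (insert p S) (u + W * v)) ∪
        (((range p).filter fun v : ℕ => (p : ℤ) ∣ (-u : ℤ) - W * v) ∪ ((range p).filter fun v : ℕ => (p : ℤ) ∣ (N - u : ℤ) - W * v)) := by
      intro v hv
      simp only [mem_union, mem_filter, hv, true_and]
      by_contra hcon
      push Not at hcon
      obtain ⟨h1, h2, h3⟩ := hcon
      apply h1
      have hdW : ∀ q ∈ S, (q : ℤ) ∣ W := fun q hq => by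
        exact_mod_cast (dvd_prod_of_mem _ hq).trans (Dvd.intro_left 8 hW.symm)
      refine ⟨?_, fun q hq => ?_⟩
      · rw [hW, mul_assoc, Nat.add_mul_mod_self_left]; exact hu.1
      · rcases mem_insert.1 hq with rfl | hq
        · refine ⟨fun h => h2 ?_, fun h => h3 ?_⟩
          · rw [show (-u : ℤ) - W * v = -((u + W * v : ℕ) : ℤ) by push_cast; ring]
            exact (dvd_neg).2 h
          · rwa [show N - ((u + W * v : ℕ) : ℤ) = N - u - W * v by push_cast; ring] at h
        · have hd := (hdW q hq).mul_right (v : ℤ)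
          refine ⟨fun h => (hu.2 q hq).1 ?_, fun h => (hu.2 q hq).2 ?_⟩
          · have := h.sub hd; rwa [show ((u + W * v : ℕ) : ℤ) - W * v = u by push_cast; ring] at this
          · have := h.add hd; rwa [show N - ((u + W * v : ℕ) : ℤ) + W * v = N - u by push_cast; ring] at this
    have h1 := (card_le_card hcover).trans (card_union_le _ _)
    have h2 := card_union_le ((range p).filter fun v : ℕ => (p : ℤ) ∣ (-u : ℤ) - W * v) ((range p).filter fun v : ℕ => (p : ℤ) ∣ (N - u : ℤ) - W * v)
    have h3 := hbad (-u)
    have h4 := hbad (N - u)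
    rw [card_range] at h1
    omega

lemma telescoping (S : Finset ℕ) (hS : ∀ p ∈ S, 3 ≤ p) : (1 : ℝ) / 2 ≤ ∏ p ∈ S, ((p : ℝ) * (p - 2) / (p - 1) ^ 2) := by
  have h1 : ∀ n : ℕ, ∏ p ∈ Ico 3 (n + 3), ((p : ℝ) * (p - 2) / (p - 1) ^ 2) = ((n : ℝ) + 2) / (2 * (n + 1)) := by
    intro n
    induction n with
    | zero => norm_num
    | succ n ih =>
      rw [show n + 1 + 3 = (n + 3) + 1 by ring, prod_Ico_succ_top (by omega), ih]
      push_cast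
      have : (n : ℝ) + 3 - 1 ≠ 0 := by have : (0 : ℝ) ≤ n := by positivity
                                       linarith
      field_simp
      ring
  have hsub : S ⊆ Ico 3 (S.sup id + 3) := fun p hp => by
    rw [mem_Ico]
    have : p ≤ S.sup id := le_sup (f := id) hp
    exact ⟨hS p hp, by omega⟩
  have h2 : ∏ p ∈ Ico 3 (S.sup id + 3), ((p : ℝ) * (p - 2) / (p - 1) ^ 2) ≤ ∏ p ∈ S, ((p : ℝ) * (p - 2) / (p - 1) ^ 2) := by
    rw [← prod_sdiff hsub]
    have hpos : ∀ p : ℕ, 3 ≤ p → 0 ≤ ((p : ℝ) * (p - 2) / (p - 1) ^ 2) ∧ ((p : ℝ) * (p - 2) / (p - 1) ^ 2) ≤ 1 := by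
      intro p hp
      have : (3 : ℝ) ≤ p := by exact_mod_cast hp
      constructor
      · apply div_nonneg
        · apply mul_nonneg <;> linarith
        · positivity
      · rw [div_le_one (by nlinarith)]; nlinarith
    refine mul_le_of_le_one_left (prod_nonneg fun p hp => (hpos p (hS p hp)).1) (prod_le_one (fun p hp => ?_) fun p hp => ?_)
    · exact (hpos p (mem_Ico.1 (mem_sdiff.1 hp).1).1).1
    · exact (hpos p (mem_Ico.1 (mem_sdiff.1 hp).1).1).2
  refine le_trans ?_ h2
  rw [h1, div_le_div_iff₀ (by norm_num) (by positivity)]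
  linarith
end

section
open Finset

def wW (w : ℕ) : ℕ := 8 * ∏ p ∈ oddPr w, p

lemma f0_count (w X : ℕ) : lam w * (#((range (X + 1)).filter fun n => n % 8 = 5 ∧ n.Coprime (vV w)) : ℝ) ≤ X + 1 + vV w := by
  have h := Nat.Ico_filter_coprime_le 0 (X + 1) (vV_pos w).ne'
  have h1 : #((range (X + 1)).filter fun n => n % 8 = 5 ∧ n.Coprime (vV w)) ≤ (vV w).totient * ((X + 1) / vV w + 1) := by
    refine le_trans (card_le_card ?_) h
    intro n hn
    rw [mem_filter, mem_range] at hn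
    rw [mem_filter, mem_Ico]
    exact ⟨⟨Nat.zero_le _, by omega⟩, hn.2.2.symm⟩
  have hV : (0 : ℝ) < vV w := by exact_mod_cast vV_pos w
  have hφ : (0 : ℝ) < (vV w).totient := by exact_mod_cast Nat.totient_pos.2 (vV_pos w)
  have h2 : (#((range (X + 1)).filter fun n => n % 8 = 5 ∧ n.Coprime (vV w)) : ℝ) ≤ (vV w).totient * (((X + 1 : ℕ) : ℝ) / vV w + 1) := by
    refine (Nat.cast_le.2 h1).trans ?_
    push_cast
    have := Nat.cast_div_le (α := ℝ) (m := X + 1) (n := vV w)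
    push_cast at this
    gcongr
  refine (mul_le_mul_of_nonneg_left h2 (lam_pos w).le).trans (le_of_eq ?_)
  rw [lam]; push_cast; field_simp

lemma sum_f0 (w X : ℕ) : ∑ n ∈ range (X + 1), f0 w n ≤ X + 1 + vV w := by
  refine le_trans (le_of_eq ?_) (f0_count w X)
  simp only [f0]
  rw [← sum_filter, sum_const, nsmul_eq_mul, mul_comm]

lemma sum_f0_sq (w X : ℕ) : ∑ n ∈ range (X + 1), f0 w n ^ 2 ≤ lam w * (X + 1 + vV w) := by
  refine le_trans (le_of_eq ?_) (mul_le_mul_of_nonneg_left (f0_count w X) (lam_pos w).le)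
  have : ∀ n, f0 w n ^ 2 = if n % 8 = 5 ∧ n.Coprime (vV w) then lam w ^ 2 else 0 := by
    intro n; unfold f0; split_ifs <;> simp
  simp only [this]
  rw [← sum_filter, sum_const, nsmul_eq_mul]; ring

lemma conv_ge (g : ℕ → ℝ) (hg : ∀ n, 0 ≤ g n) {X N Q : ℕ} (hN : N ≤ X) (hQ : Q ≤ N) :
    ∑ a ∈ range Q, g a * g (N - a) ≤ conv g X N := by
  unfold conv
  have h1 : ∑ a ∈ range Q, g a * g (N - a) ≤ ∑ a ∈ range Q, ∑ b ∈ range (X + 1), if a + b = N then g a * g b else 0 := by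
    refine sum_le_sum fun a ha => ?_
    rw [mem_range] at ha
    have := single_le_sum (f := fun b => if a + b = N then g a * g b else 0) (s := range (X + 1)) (fun b _ => by
      split_ifs
      · exact mul_nonneg (hg _) (hg _)
      · rfl) (mem_range.2 (by omega : N - a < X + 1))
    rwa [if_pos (by omega)] at this
  refine h1.trans (sum_le_sum_of_subset_of_nonneg (range_subset_range.2 (by omega)) fun a _ _ => sum_nonneg fun b _ => ?_)
  split_ifs
  · exact mul_nonneg (hg _) (hg _)
  · rfl

open Classical in
lemma conv_f0_ge {w X N : ℕ} (hN8 : N % 8 = 2) (hN : N ≤ X) : ((N : ℝ) - wW w) / 4 ≤ conv (f0 w) X N := by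
  have hW0 : 0 < wW w := Nat.mul_pos (by norm_num) (prod_pos fun q hq => (mem_oddPr.1 hq).1.pos)
  set q := N / wW w with hq
  have hqN : wW w * q ≤ N := Nat.mul_div_le N (wW w)
  refine le_trans ?_ (conv_ge (f0 w) (f0_nonneg w) hN hqN)
  have hterm : ∀ a ∈ range (wW w * q), lam w ^ 2 * ((if good N (oddPr w) a then 1 else 0 : ℕ) : ℝ) ≤ f0 w a * f0 w (N - a) := by
    intro a ha
    rw [mem_range] at ha
    split_ifs with h
    · have h1 : f0 w a = lam w := by
        rw [f0, if_pos ⟨h.1, (coprime_vV h.1).2 fun p hp hd => (h.2 p hp).1 (by exact_mod_cast hd)⟩]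
      have h5 : (N - a) % 8 = 5 := by have := h.1; omega
      have h2 : f0 w (N - a) = lam w := by
        have hc : (N - a).Coprime (vV w) := (coprime_vV h5).2 fun p hp hd => (h.2 p hp).2 (by
          rw [← Nat.cast_sub (by omega)]; exact_mod_cast hd)
        rw [f0, if_pos ⟨h5, hc⟩]
      rw [h1, h2]; push_cast; exact (by ring : lam w ^ 2 * 1 = lam w * lam w).le
    · push_cast; rw [mul_zero]; exact mul_nonneg (f0_nonneg _ _) (f0_nonneg _ _)
  refine le_trans ?_ (sum_le_sum hterm)
  rw [← mul_sum, ← Nat.cast_sum, sum_range_mul_decomp]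
  have hper : ∀ u v : ℕ, good N (oddPr w) (u + wW w * v) ↔ good N (oddPr w) u := by
    intro u v
    have hd : ∀ p ∈ oddPr w, (p : ℤ) ∣ (wW w * v : ℤ) := fun p hp => by
      have : p ∣ wW w := (dvd_prod_of_mem _ hp).trans (Dvd.intro_left 8 rfl)
      exact (by exact_mod_cast this : (p : ℤ) ∣ wW w).mul_right _
    unfold good
    refine and_congr ?_ (forall₂_congr fun p hp => and_congr (not_congr ?_) (not_congr ?_))
    · rw [wW, mul_assoc, Nat.add_mul_mod_self_left]
    · push_cast; exact dvd_add_left (hd p hp)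
    · push_cast; rw [← sub_sub]; exact dvd_sub_left (hd p hp)
  simp only [hper, sum_const, card_range, smul_eq_mul]
  rw [← mul_sum]
  have hgc := good_count N (oddPr w) fun p hp => ⟨(mem_oddPr.1 hp).1, (mem_oddPr.1 hp).2.2⟩
  have h1 : (q * ∏ p ∈ oddPr w, (p - 2) : ℕ) ≤ q * ∑ a ∈ range (wW w), if good N (oddPr w) a then 1 else 0 := Nat.mul_le_mul_left _ hgc
  refine le_trans ?_ (mul_le_mul_of_nonneg_left (Nat.cast_le.2 h1) (by positivity))
  have hqr : (N : ℝ) - wW w ≤ wW w * q := by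
    have : N < wW w * q + wW w := by rw [hq]; exact Nat.lt_mul_div_succ N hW0
    have : (N : ℝ) < wW w * q + wW w := by exact_mod_cast this
    linarith
  have hpr : ((∏ p ∈ oddPr w, (p - 2) : ℕ) : ℝ) = ∏ p ∈ oddPr w, ((p : ℝ) - 2) := by
    push_cast
    refine prod_congr rfl fun p hp => ?_
    have := oddPr_ge hp
    rw [Nat.cast_sub (by omega)]; norm_num
  have hkey : lam w ^ 2 * ∏ p ∈ oddPr w, ((p : ℝ) - 2) = wW w / 2 * ∏ p ∈ oddPr w, ((p : ℝ) * (p - 2) / (p - 1) ^ 2) := by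
    rw [lam_eq, mul_pow, ← prod_pow, wW]
    push_cast
    rw [mul_assoc, ← prod_mul_distrib, mul_div_right_comm, mul_assoc, ← prod_mul_distrib]
    norm_num
    refine prod_congr rfl fun p hp => ?_
    rw [div_pow]; ring
  push_cast [Nat.cast_mul] at *
  rw [hpr] 
  have ht := telescoping (oddPr w) fun p hp => oddPr_ge hp
  have hW0r : (0 : ℝ) ≤ wW w := by positivity
  calc ((N : ℝ) - wW w) / 4 ≤ wW w * q / 4 := by linarith
    _ = q * (wW w / 2 * (1 / 2)) := by ring
    _ ≤ q * (wW w / 2 * ∏ p ∈ oddPr w, ((p : ℝ) * (p - 2) / (p - 1) ^ 2)) := by gcongr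
    _ = _ := by rw [← hkey]; ring

lemma main_lower {k w M : ℕ} (hk : Even k) (hk0 : k ≠ 0) (hM : 4 ≤ M) (hW : (2 : ℝ) ^ (k + 1) * wW w ≤ (2 * (4 * M) ^ k : ℕ)) :
    (M : ℝ) * (2 * (4 * M) ^ k : ℕ) / 2 ^ (k + 5) ≤ ∑ n ∈ range M, conv (f0 w) (2 * (4 * M) ^ k) (2 * (4 * n + 3) ^ k) := by
  set X := 2 * (4 * M) ^ k with hX
  have hconv0 : ∀ n, 0 ≤ conv (f0 w) X n := fun n => sum_nonneg fun a _ => sum_nonneg fun b _ => by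
    split_ifs
    · exact mul_nonneg (f0_nonneg _ _) (f0_nonneg _ _)
    · rfl
  have hsub : Ico ((M + 1) / 2) M ⊆ range M := fun n hn => mem_range.2 (mem_Ico.1 hn).2
  refine le_trans ?_ (sum_le_sum_of_subset_of_nonneg hsub fun n _ _ => hconv0 _)
  have hterm : ∀ n ∈ Ico ((M + 1) / 2) M, (X : ℝ) / 2 ^ (k + 3) ≤ conv (f0 w) X (2 * (4 * n + 3) ^ k) := by
    intro n hn
    rw [mem_Ico] at hn
    have h8 : (2 * (4 * n + 3) ^ k) % 8 = 2 := by
      obtain ⟨m, rfl⟩ := hk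
      rw [← two_mul, pow_mul]
      have : (4 * n + 3) ^ 2 % 4 = 1 := by ring_nf; omega
      have h4 : ((4 * n + 3) ^ 2) ^ m % 4 = 1 := by rw [Nat.pow_mod, this]; simp
      omega
    have hle : 2 * (4 * n + 3) ^ k ≤ X := by
      rw [hX]; exact Nat.mul_le_mul_left _ (Nat.pow_le_pow_left (by omega) _)
    refine le_trans ?_ (conv_f0_ge h8 hle)
    have h2 : X ≤ 2 ^ k * (2 * (4 * n + 3) ^ k) := by
      rw [hX, mul_left_comm, ← mul_pow]; exact Nat.mul_le_mul_left _ (Nat.pow_le_pow_left (by omega) _)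
    have h2' : (X : ℝ) ≤ 2 ^ k * (2 * (4 * n + 3) ^ k : ℕ) := by exact_mod_cast h2
    have hp : (0 : ℝ) < 2 ^ k := by positivity
    rw [div_le_div_iff₀ (by positivity) (by norm_num), pow_add]
    rw [pow_succ] at hW
    norm_num
    push_cast at h2'
    nlinarith
  have hcard : (M : ℝ) / 4 ≤ #(Ico ((M + 1) / 2) M) := by
    rw [Nat.card_Ico]
    have : M ≤ 4 * (M - (M + 1) / 2) := by omega
    have : (M : ℝ) ≤ 4 * ((M - (M + 1) / 2 : ℕ) : ℝ) := by exact_mod_cast this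
    linarith
  have := card_nsmul_le_sum _ _ _ hterm
  rw [nsmul_eq_mul] at this
  refine le_trans ?_ this
  refine le_trans (le_of_eq ?_) (mul_le_mul_of_nonneg_right hcard (by positivity))
  rw [pow_add, pow_add]; ring
end

section
open Finset

noncomputable def fP (Z n : ℕ) : ℝ := if n.Prime ∧ n % 8 = 5 ∧ Z < n then Real.log n else 0

lemma fP_nonneg (Z n : ℕ) : 0 ≤ fP Z n := by
  unfold fP; split_ifs
  · exact Real.log_natCast_nonneg n
  · rfl

lemma fP_le (Z n : ℕ) : fP Z n ≤ if n.Prime then Real.log n else 0 := by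
  unfold fP
  by_cases h : n.Prime
  · rw [if_pos h]; split_ifs
    · rfl
    · exact Real.log_natCast_nonneg n
  · rw [if_neg h, if_neg (fun h' => h h'.1)]

lemma log4_le : Real.log 4 ≤ 2 := by
  have := Real.log_two_lt_d9
  rw [show (4 : ℝ) = 2 ^ 2 by norm_num, Real.log_pow]
  push_cast; linarith

lemma sum_fP (Z X : ℕ) : ∑ n ∈ range (X + 1), fP Z n ≤ 2 * X := by
  refine (sum_le_sum fun n _ => fP_le Z n).trans ?_
  rw [← sum_filter]
  have h := theta_nat_le X
  have e : (range (X + 1)).filter Nat.Prime = prU X := by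
    ext p; rw [mem_filter, mem_range, mem_prU]; simp [Nat.lt_succ_iff]
  rw [e]
  exact h.trans (mul_le_mul_of_nonneg_right log4_le (by positivity))

lemma sum_fP_sq (Z X : ℕ) : ∑ n ∈ range (X + 1), fP Z n ^ 2 ≤ Real.log X * (2 * X) := by
  refine le_trans ?_ (mul_le_mul_of_nonneg_left (sum_fP Z X) (Real.log_natCast_nonneg X))
  rw [mul_sum]
  refine sum_le_sum fun n hn => ?_
  rw [mem_range] at hn
  rw [sq]
  by_cases h : fP Z n = 0
  · simp [h]
  · refine mul_le_mul_of_nonneg_right ?_ (fP_nonneg _ _)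
    unfold fP at h ⊢
    split_ifs at h ⊢ with h1
    · exact Real.log_le_log (by exact_mod_cast h1.1.pos) (by exact_mod_cast Nat.lt_succ_iff.1 hn)
    · exact absurd rfl h

lemma arc_mono {R R' X : ℕ} {α : ℝ} (h : R ≤ R') (ha : arc R X α) : arc R' X α := by
  obtain ⟨r, h1, h2, a, h3⟩ := ha
  exact ⟨r, h1, h2.trans h, a, h3.trans (by exact_mod_cast h)⟩

lemma arc_fP {X n N : ℕ} (hn : 1 ≤ n) (hL : 4 ≤ Nat.log 2 X) (hN : X < N)
    (hcond : 1 + 3 * n + 2 * (Nat.log 2 X / 4) < Nat.log 2 X)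
    (hdN : ∀ s, 1 ≤ s → s ≤ 2 ^ (Nat.log 2 X / 4) → s ∣ N) [DecidablePred (arc (2 ^ n) X)] :
    ∑ j ∈ range N, (if arc (2 ^ n) X ((j : ℝ) / N) then ‖es (fP (2 ^ (Nat.log 2 X / 4))) X (j / N)‖ ^ 2 else 0)
      ≤ 64 * n ^ 4 * N * X := by
  classical
  set L := Nat.log 2 X with hLdef
  set Z := 2 ^ (L / 4) with hZ
  have hX0 : X ≠ 0 := by rintro rfl; simp at hLdef; omega
  have hXL : 2 ^ L ≤ X := Nat.pow_log_le_self 2 hX0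
  have hXL' : X < 2 ^ (L + 1) := Nat.lt_pow_succ_log_self (by norm_num) X
  have hX : 2 * (2 ^ n) ^ 3 * Z ^ 2 < X := by
    refine lt_of_lt_of_le ?_ hXL
    rw [hZ, ← pow_mul, ← pow_mul, ← pow_succ', ← pow_add]
    exact Nat.pow_lt_pow_right (by norm_num) (by omega)
  have h := arc_L2 (f := fP Z) (R := 2 ^ n) (X := X) (Z := Z) (N := N) (by omega) hX (rough (2 ^ n) Z)
    (fun s hs => (mem_Icc.1 (mem_filter.1 hs).1).1) (fun s hs => (mem_filter.1 hs).2.1)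
    (fun s hs => (mem_Icc.1 (mem_filter.1 hs).1).2)
    (fun s hs => hdN s (mem_Icc.1 (mem_filter.1 hs).1).1 (mem_Icc.1 (mem_filter.1 hs).1).2)
    (fun s hs r h1 h2 => rough_coprime hs h1 h2)
    (fun s hs m hm => by
      unfold fP at hm
      split_ifs at hm with h1
      · have hs' := mem_Icc.1 (mem_filter.1 hs).1
        exact (Nat.Prime.coprime_iff_not_dvd h1.1).2 fun hd => absurd (Nat.le_of_dvd hs'.1 hd) (by omega)
      · exact absurd rfl hm)
  rw [parseval hN] at h
  have hs : ∑ j ∈ range N, (if arc (2 ^ n) X ((j : ℝ) / N) then ‖es (fP Z) X (j / N)‖ ^ 2 else 0) =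
    ∑ j ∈ range N, @ite _ (arc (2 ^ n) X ((j : ℝ) / N)) (Classical.propDecidable _) (‖es (fP Z) X (j / N)‖ ^ 2) 0 :=
    sum_congr rfl fun j _ => by split_ifs <;> rfl
  rw [hs]
  set S := ∑ j ∈ range N, @ite _ (arc (2 ^ n) X ((j : ℝ) / N)) (Classical.propDecidable _) (‖es (fP Z) X (j / N)‖ ^ 2) 0 with hS
  have hS0 : 0 ≤ S := sum_nonneg fun j _ => by split_ifs <;> positivity
  have hG := G_bound hn Z
  set G := ∑ s ∈ rough (2 ^ n) Z, 1 / (s.totient : ℝ) with hGd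
  have hl2 : 0 < Real.log 2 := Real.log_pos (by norm_num)
  have hlogZ : Real.log Z = (L / 4 : ℕ) * Real.log 2 := by rw [hZ]; push_cast; rw [Real.log_pow]
  have hlogX : Real.log X ≤ (L + 1 : ℕ) * Real.log 2 := by
    rw [← Real.log_pow]; exact Real.log_le_log (by exact_mod_cast Nat.pos_of_ne_zero hX0) (by exact_mod_cast hXL'.le)
  have hlX0 : 0 < Real.log X := by
    refine Real.log_pos ?_
    have : 2 ^ 1 ≤ X := (Nat.pow_le_pow_right (by norm_num) (by omega)).trans hXL
    exact_mod_cast (by omega : 1 < X)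
  have hXZ : Real.log X ≤ 8 * Real.log Z := by
    rw [hlogZ]
    have : ((L + 1 : ℕ) : ℝ) ≤ 8 * (L / 4 : ℕ) := by exact_mod_cast (by omega : L + 1 ≤ 8 * (L / 4))
    nlinarith
  have h2 : G * S ≤ N * (Real.log X * (2 * X)) := h.trans (mul_le_mul_of_nonneg_left (sum_fP_sq Z X) (by positivity))
  have h3 : Real.log X * S ≤ Real.log X * (64 * n ^ 4 * N * X) := by
    calc Real.log X * S ≤ (8 * (4 * n ^ 4 * G)) * S := mul_le_mul_of_nonneg_right (hXZ.trans (by linarith)) hS0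
      _ = 32 * n ^ 4 * (G * S) := by ring
      _ ≤ 32 * n ^ 4 * (N * (Real.log X * (2 * X))) := mul_le_mul_of_nonneg_left h2 (by positivity)
      _ = _ := by ring
  exact le_of_mul_le_mul_left h3 hlX0

lemma poly_exp (c : ℕ) : ∃ B : ℝ, 0 < B ∧ ∀ j : ℕ, 64 * ((c * (j + 2) : ℕ) : ℝ) ^ 4 ≤ B * (3 / 2) ^ j := by
  have h := tendsto_pow_const_mul_const_pow_of_abs_lt_one 4 (r := (2 : ℝ) / 3) (by rw [abs_of_pos] <;> norm_num)
  obtain ⟨B, hB⟩ := h.bddAbove_range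
  refine ⟨64 * c ^ 4 * ((3 / 2) ^ 2 * |B|) + 1, by positivity, fun j => ?_⟩
  have h1 := hB ⟨j + 2, rfl⟩
  simp only at h1
  have h2 : ((j + 2 : ℕ) : ℝ) ^ 4 ≤ (3 / 2) ^ 2 * |B| * (3 / 2) ^ j := by
    have e : (2 / 3 : ℝ) ^ (j + 2) = ((3 / 2) ^ 2 * (3 / 2) ^ j)⁻¹ := by
      rw [← pow_add, ← inv_pow, add_comm 2 j]; norm_num
    rw [e, ← div_eq_mul_inv, div_le_iff₀ (by positivity)] at h1
    have := mul_le_mul_of_nonneg_right (le_abs_self B) (by positivity : (0 : ℝ) ≤ (3 / 2) ^ 2 * (3 / 2) ^ j)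
    linarith
  push_cast at h2 ⊢
  rw [mul_pow]
  have h3 := mul_le_mul_of_nonneg_left h2 (by positivity : (0 : ℝ) ≤ 64 * c ^ 4)
  have h4 : (0 : ℝ) ≤ (3 / 2) ^ j := by positivity
  linarith

lemma geom_tail (j0 J : ℕ) : ∑ j ∈ Ico j0 J, (3 / 4 : ℝ) ^ j ≤ 4 * (3 / 4) ^ j0 := by
  rcases le_total j0 J with h | h
  · rw [geom_sum_Ico (by norm_num) h]
    have : (0 : ℝ) ≤ (3 / 4) ^ J := by positivity
    rw [div_le_iff_of_neg (by norm_num)]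
    linarith
  · rw [Ico_eq_empty_of_le h, sum_empty]; positivity

open Filter in
lemma end_term (c : ℕ) (ε : ℝ) (hε : 0 < ε) : ∃ L0 : ℕ, ∀ L ≥ L0, 2 * ((L : ℝ) + 1) ≤ ε * 2 ^ (L / (12 * (c + 1))) := by
  have h := tendsto_pow_const_mul_const_pow_of_abs_lt_one 1 (r := (1 : ℝ) / 2) (by rw [abs_of_pos] <;> norm_num)
  have h2 : Tendsto (fun n : ℕ => ((n : ℝ) ^ 1 * (1 / 2) ^ n + (1 / 2 : ℝ) ^ n) * (24 * ((c : ℝ) + 1))) atTop (nhds ((0 + 0) * (24 * ((c : ℝ) + 1)))) :=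
    (h.add (tendsto_pow_atTop_nhds_zero_of_lt_one (by norm_num) (by norm_num))).mul_const _
  rw [add_zero, zero_mul] at h2
  obtain ⟨J0, hJ0⟩ := eventually_atTop.1 (h2.eventually (gt_mem_nhds hε))
  refine ⟨J0 * (12 * (c + 1)), fun L hL => ?_⟩
  set J := L / (12 * (c + 1)) with hJ
  have h3 := hJ0 J ((Nat.le_div_iff_mul_le (by positivity)).2 hL)
  have h4 : L + 1 ≤ (12 * (c + 1)) * (J + 1) := by
    have := Nat.lt_mul_div_succ L (b := 12 * (c + 1)) (by positivity)
    exact this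
  have h4' : (L : ℝ) + 1 ≤ (12 * ((c : ℝ) + 1)) * (J + 1) := by exact_mod_cast h4
  have e : ((J : ℝ) ^ 1 * (1 / 2) ^ J + (1 / 2 : ℝ) ^ J) * (24 * ((c : ℝ) + 1)) = (J + 1) * (24 * ((c : ℝ) + 1)) / 2 ^ J := by
    rw [one_div, inv_pow]; field_simp
  rw [e, div_lt_iff₀ (by positivity)] at h3
  linarith

open Classical in
lemma tail_F {k c : ℕ} (hc1 : 1 ≤ c)
    (hc : ∀ (t M : ℕ) (α : ℝ), 1 ≤ M → (M : ℝ) ≤ 2 ^ t * ‖kK k M α‖ → arc (2 ^ (c * (t + 1))) (2 * (4 * M) ^ k) α) :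
    ∃ D : ℝ, 0 < D ∧ ∀ j0 : ℕ, ∃ L0 : ℕ, ∀ M X N : ℕ, 1 ≤ M → X = 2 * (4 * M) ^ k → L0 ≤ Nat.log 2 X → X < N →
      (∀ s, 1 ≤ s → s ≤ 2 ^ (Nat.log 2 X / 4) → s ∣ N) →
      ∑ j ∈ range N, (if (2 : ℝ) ^ j0 * ‖kK k M ((j : ℝ) / N)‖ ≤ M then
        ‖es (fP (2 ^ (Nat.log 2 X / 4))) X (j / N)‖ ^ 2 * ‖kK k M ((j : ℝ) / N)‖ else 0) ≤ D * (3 / 4) ^ j0 * (N * M * X) := by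
  obtain ⟨B, hB0, hB⟩ := poly_exp c
  refine ⟨4 * B + 1, by positivity, fun j0 => ?_⟩
  obtain ⟨L1, hL1⟩ := end_term c ((3 / 4) ^ j0) (by positivity)
  refine ⟨max L1 (12 * c + 8), fun M X N hM hXM hL hXN hdN => ?_⟩
  set L := Nat.log 2 X with hLd
  have hLa : L1 ≤ L := (le_max_left _ _).trans hL
  have hLb : 12 * c + 8 ≤ L := (le_max_right _ _).trans hL
  set J := L / (12 * (c + 1)) with hJ
  set F : ℕ → ℝ := fun j => ‖es (fP (2 ^ (L / 4))) X ((j : ℝ) / N)‖ ^ 2 with hF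
  have hF0 : ∀ j, 0 ≤ F j := fun j => by positivity
  have hM0 : (0 : ℝ) < M := by exact_mod_cast hM
  have hpt : ∀ α : ℝ, (2 : ℝ) ^ j0 * ‖kK k M α‖ ≤ M → ∀ i : ℕ, (2 : ℝ) ^ (j0 + i) * ‖kK k M α‖ ≤ M ∨
      ∃ j ∈ Ico j0 (j0 + i), arc (2 ^ (c * (j + 2))) X α ∧ (2 : ℝ) ^ j * ‖kK k M α‖ ≤ M := by
    intro α h0 i
    induction i with
    | zero => exact Or.inl h0
    | succ i ih =>
      rcases ih with h | ⟨j, hj, h⟩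
      · by_cases h2 : (2 : ℝ) ^ (j0 + (i + 1)) * ‖kK k M α‖ ≤ M
        · exact Or.inl h2
        · refine Or.inr ⟨j0 + i, by rw [mem_Ico]; omega, ?_, h⟩
          rw [hXM]
          exact hc (j0 + i + 1) M α hM (not_le.1 h2).le
      · exact Or.inr ⟨j, by rw [mem_Ico] at hj ⊢; omega, h⟩
  have hpt2 : ∀ j ∈ range N, (if (2 : ℝ) ^ j0 * ‖kK k M ((j : ℝ) / N)‖ ≤ M then F j * ‖kK k M ((j : ℝ) / N)‖ else 0) ≤
      (∑ i ∈ Ico j0 J, (M * (1 / 2) ^ i) * (if arc (2 ^ (c * (i + 2))) X ((j : ℝ) / N) then F j else 0)) + M * (1 / 2) ^ J * F j := by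
    intro j _
    have hs0 : ∀ i ∈ Ico j0 J, 0 ≤ (M * (1 / 2 : ℝ) ^ i) * (if arc (2 ^ (c * (i + 2))) X ((j : ℝ) / N) then F j else 0) := fun i _ => by
      have := hF0 j
      split_ifs <;> positivity
    have hconv : ∀ i : ℕ, (2 : ℝ) ^ i * ‖kK k M ((j : ℝ) / N)‖ ≤ M → F j * ‖kK k M ((j : ℝ) / N)‖ ≤ M * (1 / 2) ^ i * F j := by
      intro i h
      rw [mul_comm]
      refine mul_le_mul_of_nonneg_right ?_ (hF0 j)
      rw [one_div, inv_pow, ← div_eq_mul_inv, le_div_iff₀ (by positivity)]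
      linarith
    split_ifs with h
    · rcases le_total J j0 with hJ0 | hJ0
      · have h1 := hconv J (le_trans (mul_le_mul_of_nonneg_right (pow_le_pow_right₀ (by norm_num) hJ0) (norm_nonneg _)) h)
        exact h1.trans (le_add_of_nonneg_left (sum_nonneg hs0))
      · obtain ⟨i, hi⟩ := Nat.exists_eq_add_of_le hJ0
        rcases hpt _ h i with h1 | ⟨i', hi', ha, h1⟩
        · rw [← hi] at h1
          exact (hconv J h1).trans (le_add_of_nonneg_left (sum_nonneg hs0))
        · rw [← hi] at hi'
          have h2 := single_le_sum hs0 hi'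
          rw [if_pos ha] at h2
          have h3 := hconv i' h1
          have h4 : 0 ≤ M * (1 / 2 : ℝ) ^ J * F j := by have := hF0 j; positivity
          linarith
    · refine add_nonneg (sum_nonneg hs0) ?_
      have := hF0 j; positivity
  refine (sum_le_sum hpt2).trans ?_
  rw [sum_add_distrib, sum_comm]
  have hA : ∀ i ∈ Ico j0 J, ∑ j ∈ range N, (M * (1 / 2 : ℝ) ^ i) * (if arc (2 ^ (c * (i + 2))) X ((j : ℝ) / N) then F j else 0)
      ≤ B * (N * M * X) * (3 / 4) ^ i := by
    intro i hi
    rw [mem_Ico] at hi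
    rw [← mul_sum]
    have hJL : 12 * (c + 1) * J ≤ L := Nat.mul_div_le L _
    have hiJ : c * (i + 1) ≤ c * J := Nat.mul_le_mul_left _ hi.2
    have h1 := arc_fP (X := X) (n := c * (i + 2)) (N := N) (Nat.mul_pos hc1 (by omega)) (by omega) hXN (by
      have : c * (i + 2) = c * (i + 1) + c := by ring
      have : 12 * (c + 1) * J = 12 * (c * J) + 12 * J := by ring
      omega) hdN
    have h2 := hB i
    calc _ ≤ (M * (1 / 2 : ℝ) ^ i) * (64 * ((c * (i + 2) : ℕ) : ℝ) ^ 4 * N * X) := mul_le_mul_of_nonneg_left h1 (by positivity)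
      _ ≤ (M * (1 / 2 : ℝ) ^ i) * (B * (3 / 2) ^ i * N * X) := by gcongr
      _ = _ := by rw [show (3 / 4 : ℝ) = 1 / 2 * (3 / 2) by norm_num, mul_pow]; ring
  have h1 := (sum_le_sum hA).trans_eq (mul_sum _ _ _).symm
  have h2 := h1.trans (mul_le_mul_of_nonneg_left (geom_tail j0 J) (by positivity))
  have h3 : ∑ j ∈ range N, M * (1 / 2 : ℝ) ^ J * F j ≤ (3 / 4) ^ j0 * (N * M * X) := by
    rw [← mul_sum, hF, parseval hXN]
    have hlogX : Real.log X ≤ L + 1 := by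
      have hX0 : X ≠ 0 := by rintro rfl; simp at hLd; omega
      have h1 : Real.log X ≤ (L + 1 : ℕ) * Real.log 2 := by
        rw [← Real.log_pow]
        exact Real.log_le_log (by exact_mod_cast Nat.pos_of_ne_zero hX0) (by exact_mod_cast (Nat.lt_pow_succ_log_self (by norm_num) X).le)
      have h2 := Real.log_two_lt_d9
      push_cast at h1
      nlinarith [(by positivity : (0 : ℝ) ≤ L)]
    have h4 := hL1 L hLa
    calc (M * (1 / 2 : ℝ) ^ J) * (N * ∑ n ∈ range (X + 1), fP (2 ^ (L / 4)) n ^ 2)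
        ≤ (M * (1 / 2 : ℝ) ^ J) * (N * ((L + 1) * (2 * X))) := by
          gcongr
          exact (sum_fP_sq _ X).trans (mul_le_mul_of_nonneg_right hlogX (by positivity))
      _ = (1 / 2 : ℝ) ^ J * (2 * ((L : ℝ) + 1)) * (N * M * X) := by ring
      _ ≤ (1 / 2 : ℝ) ^ J * ((3 / 4) ^ j0 * 2 ^ J) * (N * M * X) := by gcongr
      _ = _ := by
          rw [show (1 / 2 : ℝ) ^ J * ((3 / 4) ^ j0 * 2 ^ J) = (1 / 2 * 2) ^ J * (3 / 4) ^ j0 by rw [mul_pow]; ring]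
          norm_num
  linarith
end

section
open Finset

lemma ratio_bound {g : ℕ → ℝ} {c : ℝ} (h : Filter.Tendsto (fun n : ℕ => g n / n) Filter.atTop (nhds c)) {ε : ℝ} (hε : 0 < ε) :
    ∃ C : ℝ, 0 ≤ C ∧ ∀ n : ℕ, |g n - c * n| ≤ ε * n + C := by
  obtain ⟨N, hN⟩ := Metric.tendsto_atTop.1 h ε hε
  refine ⟨∑ n ∈ range (N + 1), |g n - c * n|, by positivity, fun n => ?_⟩
  by_cases hn : n ∈ range (N + 1)
  · have := single_le_sum (f := fun n : ℕ => |g n - c * n|) (fun i _ => abs_nonneg _) hn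
    have h2 : 0 ≤ ε * n := by positivity
    linarith
  · rw [mem_range, not_lt] at hn
    have h1 := (hN n (by omega)).le
    have h0 : (0 : ℝ) < n := by exact_mod_cast (by omega : 0 < n)
    rw [Real.dist_eq] at h1
    have h2 : |g n - c * n| = |g n / n - c| * n := by
      rw [← abs_of_pos h0, ← abs_mul, abs_of_pos h0]; congr 1; field_simp
    have h3 : 0 ≤ ∑ n ∈ range (N + 1), |g n - c * n| := by positivity
    rw [h2]
    nlinarith

lemma vm_sub_fP {X Z : ℕ} (hX : 1 ≤ X) (hZ : Z * Z ≤ X) (S : Finset ℕ) (hS : ∀ n ∈ S, n % 8 = 5 ∧ n ≤ X) :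
    |∑ n ∈ S, (ArithmeticFunction.vonMangoldt n - fP Z n)| ≤ 4 * (√X * Real.log X) := by
  have hl : 0 ≤ Real.log X := Real.log_natCast_nonneg X
  have h1 : ∀ n ∈ S, |ArithmeticFunction.vonMangoldt n - fP Z n| ≤
      (if n.Prime then 0 else ArithmeticFunction.vonMangoldt n) + (if n ≤ Z then Real.log X else 0) := by
    intro n hn
    obtain ⟨h5, hnX⟩ := hS n hn
    by_cases hp : n.Prime
    · rw [ArithmeticFunction.vonMangoldt_apply_prime hp, if_pos hp, fP, zero_add]
      by_cases hz : n ≤ Z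
      · rw [if_pos hz, if_neg (by omega), sub_zero, abs_of_nonneg (Real.log_natCast_nonneg n)]
        exact Real.log_le_log (by exact_mod_cast hp.pos) (by exact_mod_cast hnX)
      · rw [if_neg hz, if_pos ⟨hp, h5, by omega⟩, sub_self, abs_zero]
    · rw [if_neg hp, fP, if_neg (fun h => hp h.1), sub_zero, abs_of_nonneg ArithmeticFunction.vonMangoldt_nonneg]
      have : (0 : ℝ) ≤ if n ≤ Z then Real.log X else 0 := by split_ifs <;> simp [hl]
      linarith
  have hsub : S ⊆ Ioc 0 X := fun n hn => by
    have := hS n hn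
    rw [mem_Ioc]; omega
  have h2 : ∑ n ∈ S, (if n.Prime then 0 else ArithmeticFunction.vonMangoldt n) ≤ 2 * √X * Real.log X := by
    refine le_trans (sum_le_sum_of_subset_of_nonneg hsub fun n _ _ => ?_) (le_trans (le_of_eq ?_)
      ((le_abs_self _).trans (Chebyshev.abs_psi_sub_theta_le_sqrt_mul_log (x := X) (by exact_mod_cast hX))))
    · split_ifs
      · rfl
      · exact ArithmeticFunction.vonMangoldt_nonneg
    · rw [Chebyshev.psi_sub_theta_eq_sum_not_prime, Nat.floor_natCast, sum_filter]
      refine sum_congr rfl fun n _ => ?_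
      by_cases hp : n.Prime <;> simp [hp]
  have hZX : (Z : ℝ) ≤ √X := Real.le_sqrt_of_sq_le (by rw [sq]; exact_mod_cast hZ)
  have h3 : ∑ n ∈ S, (if n ≤ Z then Real.log X else 0) ≤ √X * Real.log X := by
    rw [← sum_filter, sum_const, nsmul_eq_mul]
    refine mul_le_mul_of_nonneg_right (le_trans ?_ hZX) hl
    have : S.filter (· ≤ Z) ⊆ Ioc 0 Z := fun n hn => by
      rw [mem_filter] at hn
      have := hS n hn.1
      rw [mem_Ioc]; omega
    have := card_le_card this
    rw [Nat.card_Ioc] at this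
    exact_mod_cast this
  refine (abs_sum_le_sum_abs _ _).trans ((sum_le_sum h1).trans ?_)
  rw [sum_add_distrib]
  have : 0 ≤ √X * Real.log X := by positivity
  nlinarith

lemma count_class (V v Y : ℕ) (hV : 0 < V) (hv : v < V) :
    |(#((range (Y + 1)).filter fun n => n % V = v) : ℝ) - Y / V| ≤ 1 := by
  have h := Nat.count_modEq_card (Y + 1) hV v
  rw [Nat.count_eq_card_filter_range] at h
  have e : ((range (Y + 1)).filter fun n => n ≡ v [MOD V]) = (range (Y + 1)).filter fun n => n % V = v :=
    filter_congr fun n _ => by rw [Nat.ModEq, Nat.mod_eq_of_lt hv]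
  rw [e] at h
  have h1 := Nat.div_add_mod (Y + 1) V
  have h2 := Nat.mod_lt (Y + 1) hV
  set c := #((range (Y + 1)).filter fun n => n % V = v)
  set A := (Y + 1) / V
  set B := (Y + 1) % V
  have hV' : (0 : ℝ) < V := by exact_mod_cast hV
  have h3 : c * V ≤ Y + V := by
    rw [h]; split_ifs
    · have : 1 ≤ B := by omega
      nlinarith
    · nlinarith
  have h4 : Y ≤ c * V + V := by
    rw [h]; split_ifs <;> nlinarith
  rw [abs_sub_le_iff]
  constructor
  · rw [sub_le_iff_le_add, ← sub_le_iff_le_add', le_div_iff₀ hV']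
    have : (c : ℝ) * V ≤ Y + V := by exact_mod_cast h3
    linarith
  · rw [sub_le_iff_le_add, div_le_iff₀ hV']
    have : (Y : ℝ) ≤ c * V + V := by exact_mod_cast h4
    linarith

open Filter in
lemma sqrt_log_small (C : ℝ) {ε : ℝ} (hε : 0 < ε) : ∃ X0 : ℕ, ∀ X : ℕ, X0 ≤ X → 4 * (√X * Real.log X) + C ≤ ε * X := by
  have h1 : (fun x : ℝ => Real.log x) =o[atTop] fun x => x ^ (1 / 2 : ℝ) := isLittleO_log_rpow_atTop (by norm_num)
  have h2 := h1.bound (show 0 < ε / 8 by positivity)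
  have h3 := h2.and ((eventually_ge_atTop (2 * |C| / ε)).and (eventually_ge_atTop 1))
  obtain ⟨X0, hX0⟩ := eventually_atTop.1 (tendsto_natCast_atTop_atTop.eventually h3)
  refine ⟨X0, fun X hX => ?_⟩
  obtain ⟨h4, h5, h6⟩ := hX0 X hX
  rw [← Real.sqrt_eq_rpow, Real.norm_of_nonneg (Real.log_nonneg h6), Real.norm_of_nonneg (Real.sqrt_nonneg _)] at h4
  rw [div_le_iff₀ hε] at h5
  have h7 := mul_le_mul_of_nonneg_left h4 (Real.sqrt_nonneg (X : ℝ))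
  have h8 := Real.mul_self_sqrt (show (0 : ℝ) ≤ X by positivity)
  have h9 : √(X : ℝ) * (ε / 8 * √X) = ε / 8 * X := by rw [← h8]; ring_nf; rw [Real.sqrt_sq (by positivity)]
  have := le_abs_self C
  linarith

lemma class_sum (w v : ℕ) (hv : v < vV w) {ε : ℝ} (hε : 0 < ε) : ∃ X0 : ℕ, ∀ X : ℕ, X0 ≤ X → ∀ Z : ℕ, w ≤ Z → Z * Z ≤ X →
    ∀ Y ≤ X, |∑ n ∈ (range (Y + 1)).filter (fun n => n % vV w = v), (fP Z n - f0 w n)| ≤ ε * X := by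
  have h8 : 8 ∣ vV w := Dvd.intro _ rfl
  have hm8 : ∀ n, n % vV w = v → n % 8 = v % 8 := fun n hn => by rw [← hn, Nat.mod_mod_of_dvd _ h8]
  have hcop : ∀ n, n % vV w = v → (n.Coprime (vV w) ↔ v.Coprime (vV w)) := fun n hn => by
    rw [← hn]; unfold Nat.Coprime; rw [← Nat.gcd_rec, Nat.gcd_comm]
  by_cases hg : v % 8 = 5 ∧ v.Coprime (vV w)
  · have : NeZero (vV w) := ⟨(vV_pos w).ne'⟩
    have hu : IsUnit ((v : ℕ) : ZMod (vV w)) := (ZMod.isUnit_iff_coprime v (vV w)).2 hg.2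
    have hp := (pnt_ap hu).comp tendsto_natCast_atTop_atTop
    set g : ℕ → ℝ := fun Y => ∑ n ∈ (range (Y + 1)).filter (fun n => n % vV w = v), ArithmeticFunction.vonMangoldt n with hgdef
    have hp' : Filter.Tendsto (fun n : ℕ => g n / n) Filter.atTop (nhds ((vV w).totient : ℝ)⁻¹) := by
      refine hp.congr fun Y => ?_
      simp only [Function.comp, Nat.floor_natCast, hgdef]
      congr 1
      rw [sum_filter, range_eq_Ico, sum_eq_sum_Ico_succ_bot (by omega)]
      simp only [ArithmeticFunction.map_zero, ite_self, zero_add]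
      refine sum_congr (by ext; simp) fun n _ => ?_
      have e : ((n : ZMod (vV w)) = v) ↔ n % vV w = v := by rw [ZMod.natCast_eq_natCast_iff', Nat.mod_eq_of_lt hv]
      by_cases hn : n % vV w = v
      · rw [if_pos hn]; exact Set.indicator_of_mem (show n ∈ {n : ℕ | (n : ZMod (vV w)) = v} from e.2 hn) _
      · rw [if_neg hn]; exact Set.indicator_of_notMem (show n ∉ {n : ℕ | (n : ZMod (vV w)) = v} from fun h => hn (e.1 h)) _
    obtain ⟨C, hC0, hC⟩ := ratio_bound hp' (show 0 < ε / 2 by positivity)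
    obtain ⟨X0, hX0⟩ := sqrt_log_small (C + lam w) (show 0 < ε / 2 by positivity)
    refine ⟨max X0 1, fun X hX Z hwZ hZX Y hY => ?_⟩
    have h1 := hX0 X ((le_max_left _ _).trans hX)
    have h2 := hC Y
    have h3 := vm_sub_fP ((le_max_right _ _).trans hX) hZX ((range (Y + 1)).filter (fun n => n % vV w = v)) fun n hn => by
      rw [mem_filter, mem_range] at hn
      exact ⟨(hm8 n hn.2).trans hg.1, by omega⟩
    have h4 : ∑ n ∈ (range (Y + 1)).filter (fun n => n % vV w = v), f0 w n = #((range (Y + 1)).filter fun n => n % vV w = v) * lam w := by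
      rw [← nsmul_eq_mul, ← sum_const]
      refine sum_congr rfl fun n hn => ?_
      rw [mem_filter] at hn
      rw [f0, if_pos ⟨(hm8 n hn.2).trans hg.1, (hcop n hn.2).2 hg.2⟩]
    have h5 := count_class (vV w) v Y (vV_pos w) hv
    have hV0 : (0 : ℝ) < vV w := by exact_mod_cast vV_pos w
    have h6 : ((vV w).totient : ℝ)⁻¹ * Y = Y / vV w * lam w := by
      rw [lam]; field_simp
    have h7 : |(#((range (Y + 1)).filter fun n => n % vV w = v) : ℝ) * lam w - Y / vV w * lam w| ≤ lam w := by
      rw [← sub_mul, abs_mul, abs_of_pos (lam_pos w)]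
      have := lam_pos w
      nlinarith
    rw [sum_sub_distrib] at h3 ⊢
    rw [h4]
    rw [h6] at h2
    simp only [hgdef] at h2
    have h9 : (Y : ℝ) ≤ X := by exact_mod_cast hY
    have h10 : ε / 2 * Y ≤ ε / 2 * X := mul_le_mul_of_nonneg_left h9 (by positivity)
    rw [abs_le] at h2 h3 h7 ⊢
    constructor <;> linarith [h2.1, h2.2, h3.1, h3.2, h7.1, h7.2]
  · refine ⟨0, fun X _ Z hwZ _ Y _ => ?_⟩
    rw [sum_eq_zero, abs_zero]
    · positivity
    intro n hn
    rw [mem_filter] at hn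
    have e1 := hm8 n hn.2
    have e2 := hcop n hn.2
    rw [f0, if_neg (by rw [e1, e2]; exact hg), fP, if_neg, sub_zero]
    rintro ⟨h1, h2, h3⟩
    apply hg
    refine ⟨by omega, e2.1 ((coprime_vV h2).2 fun p hp hpn => ?_)⟩
    rw [mem_oddPr] at hp
    have := (Nat.prime_dvd_prime_iff_eq hp.1 h1).1 hpn
    omega

lemma abel_bound (h : ℕ → ℝ) (u : ℕ → ℂ) {E δ : ℝ} (N : ℕ) (hE : ∀ Y ≤ N, |∑ n ∈ range Y, h n| ≤ E) (hu : ∀ n, ‖u n‖ = 1)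
    (hδ : ∀ n, ‖u (n + 1) - u n‖ ≤ δ) : ‖∑ n ∈ range N, (h n : ℂ) * u n‖ ≤ E * (1 + N * δ) := by
  have hE0 : 0 ≤ E := (abs_nonneg _).trans (hE 0 (by omega))
  have hid : ∀ K, ∑ n ∈ range K, (h n : ℂ) * u n = ((∑ n ∈ range K, h n : ℝ) : ℂ) * u K
      - ∑ n ∈ range K, ((∑ i ∈ range (n + 1), h i : ℝ) : ℂ) * (u (n + 1) - u n) := by
    intro K
    induction K with
    | zero => simp
    | succ K ih =>
      rw [sum_range_succ, ih, sum_range_succ _ K]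
      simp only [sum_range_succ _ K]
      push_cast; ring
  rw [hid]
  refine (norm_sub_le _ _).trans ?_
  have h1 : ‖((∑ n ∈ range N, h n : ℝ) : ℂ) * u N‖ ≤ E := by
    rw [norm_mul, hu, mul_one, Complex.norm_real]; exact hE N le_rfl
  have h2 : ‖∑ n ∈ range N, ((∑ i ∈ range (n + 1), h i : ℝ) : ℂ) * (u (n + 1) - u n)‖ ≤ ∑ n ∈ range N, E * δ := by
    refine norm_sum_le_of_le _ fun n hn => ?_
    rw [mem_range] at hn
    rw [norm_mul, Complex.norm_real]
    exact mul_le_mul (hE _ hn) (hδ n) (norm_nonneg _) hE0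
  rw [sum_const, card_range, nsmul_eq_mul] at h2
  nlinarith

lemma sup_H (w R : ℕ) (hR : R ≤ w) {ε : ℝ} (hε : 0 < ε) : ∃ X0 : ℕ, ∀ X : ℕ, X0 ≤ X → ∀ Z : ℕ, w ≤ Z → Z * Z ≤ X →
    ∀ α : ℝ, arc R X α → ‖es (fP Z) X α - es (f0 w) X α‖ ≤ ε * X := by
  have hV0 : (0 : ℝ) < vV w := by exact_mod_cast vV_pos w
  set ε' := ε / (vV w * (1 + 4 * Real.pi * R)) with hε'
  have hpi := Real.pi_pos
  have hε'0 : 0 < ε' := by positivity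
  have hcl : ∀ v : ℕ, ∃ X0 : ℕ, v < vV w → ∀ X : ℕ, X0 ≤ X → ∀ Z : ℕ, w ≤ Z → Z * Z ≤ X →
    ∀ Y ≤ X, |∑ n ∈ (range (Y + 1)).filter (fun n => n % vV w = v), (fP Z n - f0 w n)| ≤ ε' * X := by
    intro v
    by_cases hv : v < vV w
    · obtain ⟨X0, h⟩ := class_sum w v hv hε'0
      exact ⟨X0, fun _ => h⟩
    · exact ⟨0, fun h => absurd h hv⟩
  choose X0 hX0 using hcl
  refine ⟨max 1 ((range (vV w)).sup X0), fun X hX Z hwZ hZX α hα => ?_⟩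
  have hX1 : 1 ≤ X := (le_max_left _ _).trans hX
  have hX1' : (1 : ℝ) ≤ X := by exact_mod_cast hX1
  obtain ⟨r, hr1, hr2, a, ha⟩ := hα
  set β := α - a / r with hβ
  have hrV : r ∣ vV w := Dvd.dvd.mul_left (Nat.dvd_factorial hr1 (hr2.trans hR)) 8
  have hr0 : (0 : ℝ) < r := by exact_mod_cast hr1
  have hec : ∀ n : ℕ, ec (n * α) = ec ((n % vV w : ℕ) * (a / r)) * ec (n * β) := by
    intro n
    obtain ⟨t, ht⟩ := hrV
    have h1 : (n : ℝ) = (n % vV w : ℕ) + vV w * (n / vV w : ℕ) := by exact_mod_cast (Nat.mod_add_div n (vV w)).symm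
    generalize n % vV w = s at h1 ⊢
    generalize n / vV w = m at h1
    have h2 : (n : ℝ) * α = (s * (a / r) + n * β) + ((t * m * a : ℤ) : ℝ) := by
      have e : α = a / r + β := by rw [hβ]; ring
      have e2 : (vV w : ℝ) = r * t := by exact_mod_cast ht
      rw [e, mul_add]
      nth_rewrite 1 [h1]
      rw [e2]
      push_cast
      field_simp
      ring
    rw [h2, ec_add_int, ec_add]
  have hes : es (fP Z) X α - es (f0 w) X α = ∑ v ∈ range (vV w), ec ((v : ℕ) * (a / r)) *
      ∑ n ∈ range (X + 1), ((if n % vV w = v then fP Z n - f0 w n else 0 : ℝ) : ℂ) * ec (n * β) := by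
    rw [es, es, ← sum_sub_distrib]
    simp_rw [mul_sum]
    rw [sum_comm]
    refine sum_congr rfl fun n _ => ?_
    rw [sum_eq_single (n % vV w)]
    · rw [if_pos rfl, hec]; push_cast; ring
    · intro v _ hv
      rw [if_neg hv.symm]; simp
    · intro h; exact absurd (mem_range.2 (Nat.mod_lt _ (vV_pos w))) h
  have hv : ∀ v ∈ range (vV w), ‖ec ((v : ℕ) * (a / r)) *
      ∑ n ∈ range (X + 1), ((if n % vV w = v then fP Z n - f0 w n else 0 : ℝ) : ℂ) * ec (n * β)‖ ≤ ε / vV w * X := by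
    intro v hv
    rw [norm_mul, ec_norm, one_mul]
    have hXv : X0 v ≤ X := (le_sup (f := X0) hv).trans ((le_max_right _ _).trans hX)
    have h1 := abel_bound (fun n => if n % vV w = v then fP Z n - f0 w n else 0) (fun n => ec (n * β)) (E := ε' * X)
      (δ := 2 * Real.pi * |β|) (X + 1) (fun Y hY => ?_) (fun n => ec_norm _) (fun n => ?_)
    · refine h1.trans ?_
      have h2 : ((X + 1 : ℕ) : ℝ) * (2 * Real.pi * |β|) ≤ 4 * Real.pi * R := by
        have h3 : ((X + 1 : ℕ) : ℝ) ≤ 2 * X := by push_cast; linarith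
        have := mul_le_mul_of_nonneg_right h3 (show 0 ≤ 2 * Real.pi * |β| by positivity)
        have h4 := mul_le_mul_of_nonneg_left ha (show 0 ≤ 4 * Real.pi by positivity)
        linarith
      calc ε' * X * (1 + ((X + 1 : ℕ) : ℝ) * (2 * Real.pi * |β|)) ≤ ε' * X * (1 + 4 * Real.pi * R) :=
            mul_le_mul_of_nonneg_left (by linarith) (by positivity)
        _ = _ := by rw [hε']; field_simp
    · rcases Y with _ | Y
      · simp; positivity
      · rw [← sum_filter]
        exact hX0 v (mem_range.1 hv) X hXv Z hwZ hZX Y (by omega)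
    · have : ec ((n + 1 : ℕ) * β) - ec (n * β) = ec (n * β) * (ec β - 1) := by
        push_cast; rw [add_mul, one_mul, ec_add]; ring
      rw [this, norm_mul, ec_norm, one_mul]
      exact ec_sub_one_le β
  rw [hes]
  refine (norm_sum_le_of_le _ hv).trans ?_
  rw [sum_const, card_range, nsmul_eq_mul]
  apply le_of_eq; field_simp
end

section
open Finset

lemma kK_le (k M : ℕ) (α : ℝ) : ‖kK k M α‖ ≤ M := by
  refine (norm_sum_le_of_le _ fun n _ => (ec_norm _).le).trans ?_
  simp

lemma es_norm_le {f : ℕ → ℝ} (hf : ∀ n, 0 ≤ f n) (X : ℕ) (α : ℝ) : ‖es f X α‖ ≤ ∑ n ∈ range (X + 1), f n := by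
  refine norm_sum_le_of_le _ fun n _ => ?_
  rw [norm_mul, ec_norm, mul_one, Complex.norm_real, Real.norm_of_nonneg (hf n)]

open Filter in
lemma choose_j0 (c : ℕ) {D η : ℝ} (hη : 0 < η) : ∃ j0 : ℕ, D * (3 / 4) ^ j0 ≤ η ∧
    (1 / 2 : ℝ) ^ j0 * (2 * (4 * ((c * (j0 + 1) : ℕ) : ℝ) ^ 8)) ≤ η := by
  have h1 : Tendsto (fun j : ℕ => D * (3 / 4 : ℝ) ^ j) atTop (nhds (D * 0)) :=
    (tendsto_pow_atTop_nhds_zero_of_lt_one (by norm_num) (by norm_num)).const_mul D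
  have h := tendsto_pow_const_mul_const_pow_of_abs_lt_one 8 (r := (1 : ℝ) / 2) (by rw [abs_of_pos] <;> norm_num)
  have h2 := (h.comp (tendsto_add_atTop_nat 1)).const_mul (16 * (c : ℝ) ^ 8)
  rw [mul_zero] at h1 h2
  obtain ⟨j, hj1, hj2⟩ := ((h1.eventually (gt_mem_nhds hη)).and (h2.eventually (gt_mem_nhds hη))).exists
  refine ⟨j, hj1.le, le_trans (le_of_eq ?_) hj2.le⟩
  simp only [Function.comp]
  push_cast
  ring

lemma conv_zero {k B Z X m : ℕ} (hm : m % 4 = 3) (hZ : B ^ k ≤ Z)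
    (hno : ∀ m p q : ℕ, B < m → m % 4 = 3 → p.Prime → q.Prime → p % 8 = 5 → p + q ≠ 2 * m ^ k) :
    conv (fP Z) X (2 * m ^ k) = 0 := by
  rw [conv]
  refine sum_eq_zero fun a _ => sum_eq_zero fun b _ => ?_
  split_ifs with h
  · by_contra h0
    have ha : fP Z a ≠ 0 := left_ne_zero_of_mul h0
    have hb : fP Z b ≠ 0 := right_ne_zero_of_mul h0
    rw [fP, ne_eq, ite_eq_right_iff, Classical.not_imp] at ha hb
    refine hno m a b ?_ hm ha.1.1 hb.1.1 ha.1.2.1 h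
    have h1 : B ^ k < m ^ k := by omega
    exact lt_of_pow_lt_pow_left₀ k (by omega) h1
  · rfl

open Classical in
lemma combine_bound {k M X N w Z j0 : ℕ} {η ε : ℝ} (hM : 1 ≤ M) (hX : 1 ≤ X) (hw : 1 ≤ w) (hwX : w * w ≤ X) (hNX : 2 * X < N)
    (hε0 : 0 < ε) (hεη : ε * (48 * (w : ℝ) ^ 3) = η) (hVX : (X : ℝ) + 1 + vV w ≤ 2 * X)
    (hlam : (1 / 2 : ℝ) ^ j0 * (2 * lam w) ≤ η) (harc : ∀ α, (M : ℝ) ≤ 2 ^ j0 * ‖kK k M α‖ → arc w X α)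
    (hsup : ∀ α : ℝ, arc w X α → ‖es (fP Z) X α - es (f0 w) X α‖ ≤ ε * X)
    (htail : ∑ j ∈ range N, (if (2 : ℝ) ^ j0 * ‖kK k M ((j : ℝ) / N)‖ ≤ M then
        ‖es (fP Z) X (j / N)‖ ^ 2 * ‖kK k M ((j : ℝ) / N)‖ else 0) ≤ η * (N * M * X))
    (hNn : ∀ n < M, 2 * (4 * n + 3) ^ k ≤ X)
    (hz : ∑ n ∈ range M, conv (fP Z) X (2 * (4 * n + 3) ^ k) = 0) :
    (N : ℝ) * ∑ n ∈ range M, conv (f0 w) X (2 * (4 * n + 3) ^ k) ≤ 3 * (η * (N * M * X)) := by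
  have hid1 := conv_id (N := N) hNX hNn (fP Z)
  have hid2 := conv_id (N := N) hNX hNn (f0 w)
  have hN0 : (0 : ℝ) < N := by exact_mod_cast (by omega : 0 < N)
  have hXr : (0 : ℝ) < X := by exact_mod_cast (by omega : 0 < X)
  have hMr : (0 : ℝ) < M := by exact_mod_cast (by omega : 0 < M)
  set F : ℕ → ℂ := fun j => es (fP Z) X ((j : ℝ) / N) with hF
  set F0 : ℕ → ℂ := fun j => es (f0 w) X ((j : ℝ) / N) with hF0
  set Kj : ℕ → ℂ := fun j => kK k M ((j : ℝ) / N) with hKj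
  have hFle : ∀ j, ‖F j‖ ≤ 2 * X := fun j => (es_norm_le (fP_nonneg Z) X _).trans (sum_fP Z X)
  have hF0le : ∀ j, ‖F0 j‖ ≤ 2 * X := fun j => ((es_norm_le (f0_nonneg w) X _).trans (sum_f0 w X)).trans hVX
  have hKle : ∀ j, ‖Kj j‖ ≤ M := fun j => kK_le k M _
  have hpt : ∀ j ∈ range N, ‖(F0 j ^ 2 - F j ^ 2) * (starRingEnd ℂ) (Kj j)‖ ≤
      (if (2 : ℝ) ^ j0 * ‖Kj j‖ ≤ M then ‖F j‖ ^ 2 * ‖Kj j‖ else 0) + (M * (1 / 2) ^ j0) * ‖F0 j‖ ^ 2 +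
      (if arc w X ((j : ℝ) / N) then M * (ε * X) * (4 * X) else 0) := by
    intro j _
    rw [norm_mul, RCLike.norm_conj]
    have hpos : 0 ≤ M * (ε * X) * (4 * X) := by positivity
    by_cases h : (2 : ℝ) ^ j0 * ‖Kj j‖ ≤ M
    · rw [if_pos h]
      have h1 : ‖F0 j ^ 2 - F j ^ 2‖ ≤ ‖F0 j‖ ^ 2 + ‖F j‖ ^ 2 := by
        refine (norm_sub_le _ _).trans ?_
        rw [norm_pow, norm_pow]
      have h2 : ‖Kj j‖ ≤ M * (1 / 2) ^ j0 := by
        rw [one_div, inv_pow, ← div_eq_mul_inv, le_div_iff₀ (by positivity), mul_comm]; exact h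
      have h3 : (0 : ℝ) ≤ if arc w X ((j : ℝ) / N) then M * (ε * X) * (4 * X) else 0 := by
        split_ifs
        · exact hpos
        · rfl
      have h4 := mul_le_mul_of_nonneg_right h1 (norm_nonneg (Kj j))
      have h5 := mul_le_mul_of_nonneg_left h2 (sq_nonneg ‖F0 j‖)
      linarith
    · rw [if_neg h]
      have ha : arc w X ((j : ℝ) / N) := harc _ (not_le.1 h).le
      rw [if_pos ha]
      have h1 := hsup _ ha
      have h2 : F0 j ^ 2 - F j ^ 2 = -((F j - F0 j) * (F j + F0 j)) := by ring
      have h3 : ‖F j + F0 j‖ ≤ 4 * X := (norm_add_le _ _).trans (by linarith [hFle j, hF0le j])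
      have h5 : 0 ≤ (M * (1 / 2) ^ j0) * ‖F0 j‖ ^ 2 := by positivity
      have h6 : ‖F0 j ^ 2 - F j ^ 2‖ ≤ ε * X * (4 * X) := by
        rw [h2, norm_neg, norm_mul]
        exact mul_le_mul h1 h3 (norm_nonneg _) (by positivity)
      have h7 := mul_le_mul h6 (hKle j) (norm_nonneg _) (by positivity)
      linarith
  have hsum : ∑ j ∈ range N, (F0 j ^ 2 - F j ^ 2) * (starRingEnd ℂ) (Kj j) =
      (((N : ℝ) * ∑ n ∈ range M, conv (f0 w) X (2 * (4 * n + 3) ^ k) : ℝ) : ℂ) := by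
    simp_rw [sub_mul]
    rw [sum_sub_distrib, hid1, hid2, hz]
    push_cast; ring
  have hbound := norm_sum_le_of_le _ hpt
  rw [hsum, Complex.norm_real, sum_add_distrib, sum_add_distrib, ← mul_sum, parseval (by omega) (f0 w),
    ← sum_filter (fun j : ℕ => arc w X ((j : ℝ) / N)), sum_const, nsmul_eq_mul] at hbound
  have hcount := arc_count (R := w) (X := X) (N := N) (by omega) (by omega) (by omega) (by omega)
  have hsq := (sum_f0_sq w X).trans (mul_le_mul_of_nonneg_left hVX (lam_pos w).le)
  have hP : (0 : ℝ) < N * M * X := by positivity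
  have hb2 : (M * (1 / 2) ^ j0) * (N * ∑ n ∈ range (X + 1), f0 w n ^ 2) ≤ η * (N * M * X) := by
    calc (M * (1 / 2) ^ j0) * (N * ∑ n ∈ range (X + 1), f0 w n ^ 2) ≤ (M * (1 / 2) ^ j0) * (N * (lam w * (2 * X))) :=
          mul_le_mul_of_nonneg_left (mul_le_mul_of_nonneg_left hsq hN0.le) (by positivity)
      _ = ((1 / 2 : ℝ) ^ j0 * (2 * lam w)) * (N * M * X) := by ring
      _ ≤ _ := mul_le_mul_of_nonneg_right hlam hP.le
  have hb3 : (#((range N).filter fun j : ℕ => arc w X ((j : ℝ) / N)) : ℝ) * (M * (ε * X) * (4 * X)) ≤ η * (N * M * X) := by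
    calc (#((range N).filter fun j : ℕ => arc w X ((j : ℝ) / N)) : ℝ) * (M * (ε * X) * (4 * X))
        = ((#((range N).filter fun j : ℕ => arc w X ((j : ℝ) / N)) : ℝ) * X) * (4 * ε * M * X) := by ring
      _ ≤ (12 * (w : ℝ) ^ 3 * N) * (4 * ε * M * X) := mul_le_mul_of_nonneg_right (by exact_mod_cast hcount) (by positivity)
      _ = _ := by rw [← hεη]; ring
  refine (Real.le_norm_self _).trans (hbound.trans ?_)
  linarith

theorem goldbach (k : ℕ) (hk : Even k) (hk0 : k ≠ 0) (B : ℕ) :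
    ∃ m p q : ℕ, B < m ∧ m % 4 = 3 ∧ p.Prime ∧ q.Prime ∧ p % 8 = 5 ∧ p + q = 2 * m ^ k := by
  classical
  by_contra hcon
  have hno : ∀ m p q : ℕ, B < m → m % 4 = 3 → p.Prime → q.Prime → p % 8 = 5 → p + q ≠ 2 * m ^ k := by
    intro m p q h1 h2 h3 h4 h5 h6
    exact hcon ⟨m, p, q, h1, h2, h3, h4, h5, h6⟩
  clear hcon
  obtain ⟨c0, hc0⟩ := weyl_K k (by omega)
  set c := c0 + 1 with hcdef
  have hc : ∀ (t M : ℕ) (α : ℝ), 1 ≤ M → (M : ℝ) ≤ 2 ^ t * ‖kK k M α‖ → arc (2 ^ (c * (t + 1))) (2 * (4 * M) ^ k) α :=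
    fun t M α h1 h2 => arc_mono (Nat.pow_le_pow_right (by omega) (Nat.mul_le_mul_right _ (by omega))) (hc0 t M α h1 h2)
  obtain ⟨D, hD0, hD⟩ := tail_F (by omega : 1 ≤ c) hc
  set η : ℝ := 1 / 2 ^ (k + 8) with hηd
  have hη : 0 < η := by positivity
  obtain ⟨j0, hj1, hj2⟩ := choose_j0 c (D := D) hη
  obtain ⟨L0, hL0⟩ := hD j0
  set n := c * (j0 + 1) with hn
  have hn1 : 1 ≤ n := by rw [hn]; nlinarith
  set w := 2 ^ n with hw
  have hw2 : 2 ≤ w := by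
    calc 2 = 2 ^ 1 := rfl
      _ ≤ 2 ^ n := Nat.pow_le_pow_right (by omega) hn1
  have hlam : lam w ≤ 4 * (n : ℝ) ^ 8 := by
    refine (lam_le w hw2).trans ?_
    have h1 := PP_le hn1
    have h2 := PP_pos w
    calc PP w ^ 2 ≤ (2 * (n : ℝ) ^ 4) ^ 2 := pow_le_pow_left₀ (by linarith) h1 2
      _ = _ := by ring
  have hw0 : (0 : ℝ) < w := by exact_mod_cast (by omega : 0 < w)
  set ε := η / (48 * (w : ℝ) ^ 3) with hε
  have hε0 : 0 < ε := by positivity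
  obtain ⟨X0, hX0⟩ := sup_H w w le_rfl hε0
  set T := L0 + 4 * (w + B ^ k) + X0 + vV w + 2 ^ (k + 1) * wW w + w * w + 4 with hT
  set M := 2 ^ T with hM
  set X := 2 * (4 * M) ^ k with hX
  have hTM : T < M := Nat.lt_two_pow_self
  have hMX : M ≤ X := by
    have : 4 * M ≤ (4 * M) ^ k := Nat.le_self_pow hk0 _
    omega
  have hTL : T ≤ Nat.log 2 X := Nat.le_log_of_pow_le (by omega) hMX
  set L := Nat.log 2 X with hL
  set Z := 2 ^ (L / 4) with hZ
  have hX0' : X ≠ 0 := by omega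
  have hZX : Z * Z ≤ X := by
    rw [hZ, ← pow_add]
    exact (Nat.pow_le_pow_right (by omega) (by omega)).trans (Nat.pow_log_le_self 2 hX0')
  have hZb : w + B ^ k ≤ Z := by
    have h1 : w + B ^ k ≤ L / 4 := by omega
    exact h1.trans Nat.lt_two_pow_self.le
  set N := (2 * X + 1) * Z.factorial with hN
  have hNX : 2 * X < N := by
    have := Nat.factorial_pos Z
    nlinarith
  have hN0 : (0 : ℝ) < N := by exact_mod_cast (by omega : 0 < N)
  have hXr : (0 : ℝ) < X := by exact_mod_cast (by omega : 0 < X)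
  have hMr : (0 : ℝ) < M := by exact_mod_cast (by omega : 0 < M)
  have hNd : ∀ s, 1 ≤ s → s ≤ Z → s ∣ N := fun s h1 h2 => Dvd.dvd.mul_left (Nat.dvd_factorial h1 h2) _
  have hVX : (X : ℝ) + 1 + vV w ≤ 2 * X := by
    have : X + 1 + vV w ≤ 2 * X := by omega
    exact_mod_cast this
  have htail := hL0 M X N (by omega) rfl (by omega) (by omega) hNd
  have hmain := main_lower (w := w) (M := M) hk hk0 (by omega) (by
    have : 2 ^ (k + 1) * wW w ≤ 2 * (4 * M) ^ k := by omega
    exact_mod_cast this)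
  have hNn : ∀ n < M, 2 * (4 * n + 3) ^ k ≤ X := fun n hn =>
    Nat.mul_le_mul_left 2 (Nat.pow_le_pow_left (by omega) k)
  have hz : ∑ n ∈ range M, conv (fP Z) X (2 * (4 * n + 3) ^ k) = 0 :=
    sum_eq_zero fun n _ => conv_zero (by omega) (by omega) hno
  have hfin := combine_bound (ε := ε) (by omega) (by omega) (by omega) (by omega) hNX hε0 (by rw [hε]; field_simp) hVX
    (le_trans (mul_le_mul_of_nonneg_left (by linarith) (by positivity)) hj2) (fun α h => hc j0 M α (by omega) h)
    (fun α h => hX0 X (by omega) Z (by omega) hZX α h)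
    (htail.trans (mul_le_mul_of_nonneg_right hj1 (by positivity))) hNn hz
  have hm2 := mul_le_mul_of_nonneg_left hmain hN0.le
  have e : (N : ℝ) * (M * X / 2 ^ (k + 5)) = 8 * (η * (N * M * X)) := by
    rw [hηd, show k + 8 = (k + 5) + 3 by ring, pow_add _ (k + 5) 3]; field_simp; norm_num
  have : 0 < η * (N * M * X) := by positivity
  push_cast at hm2
  have hXc : (X : ℝ) = 2 * (4 * M) ^ k := by rw [hX]; push_cast; ring
  rw [← hXc] at hm2
  linarith
end

section
open NumberField

abbrev QR (d : ℕ) := QuadraticAlgebra ℤ (-(d : ℤ)) 0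

lemma qr_norm {d : ℕ} (z : QR d) : QuadraticAlgebra.norm z = z.re ^ 2 + d * z.im ^ 2 := by
  rw [QuadraticAlgebra.norm_def]; ring

lemma rat_int_arith {d : ℕ} (hsq : Squarefree d) (hd4 : d % 4 = 1) {u v : ℚ} {A N : ℤ} (hA : 2 * u = A) (hN : u ^ 2 + d * v ^ 2 = N) :
    ∃ x y : ℤ, u = x ∧ v = y := by
  have h1 : (d : ℚ) * (2 * v) ^ 2 = ((4 * N - A ^ 2 : ℤ) : ℚ) := by
    push_cast; rw [← hA, ← hN]; ring
  have hden : (2 * v).den = 1 := by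
    set t := 2 * v with ht
    have h2 : (d : ℤ) * t.num ^ 2 = (4 * N - A ^ 2) * t.den ^ 2 := by
      have h3 : t = t.num / t.den := (Rat.num_div_den t).symm
      have h4 : (t.den : ℚ) ≠ 0 := by exact_mod_cast t.den_nz
      rw [h3, div_pow, mul_div_assoc', div_eq_iff (by positivity)] at h1
      exact_mod_cast h1
    have h5 : ((t.den : ℤ) ^ 2) ∣ (d : ℤ) * t.num ^ 2 := ⟨4 * N - A ^ 2, by rw [h2]; ring⟩
    have h6 : IsCoprime ((t.den : ℤ) ^ 2) (t.num ^ 2) := by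
      apply IsCoprime.pow
      rw [Int.isCoprime_iff_gcd_eq_one, Int.gcd, Int.natAbs_natCast]
      exact t.reduced.symm
    have h7 := h6.dvd_of_dvd_mul_right h5
    have h8 : t.den * t.den ∣ d := by rw [← sq]; exact_mod_cast h7
    exact Nat.isUnit_iff.1 (hsq _ h8)
  obtain ⟨B, hB⟩ : ∃ B : ℤ, 2 * v = B := ⟨(2 * v).num, ((Rat.den_eq_one_iff _).1 hden).symm⟩
  rw [hB] at h1
  have h9 : (d : ℤ) * B ^ 2 = 4 * N - A ^ 2 := by exact_mod_cast h1
  have h10 : A % 2 = 0 ∧ B % 2 = 0 := by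
    obtain ⟨e, he⟩ : ∃ e : ℤ, (d : ℤ) = 4 * e + 1 := ⟨d / 4, by omega⟩
    rw [he] at h9
    have h11 : A ^ 2 + B ^ 2 = 4 * (N - e * B ^ 2) := by linarith
    rcases Int.even_or_odd' A with ⟨a, ha | ha⟩ <;> rcases Int.even_or_odd' B with ⟨b, hb | hb⟩
    · omega
    · exfalso
      have : 4 * (a ^ 2 + b ^ 2 + b) + 1 = 4 * (N - e * B ^ 2) := by rw [← h11, ha, hb]; ring
      omega
    · exfalso
      have : 4 * (a ^ 2 + b ^ 2 + a) + 1 = 4 * (N - e * B ^ 2) := by rw [← h11, ha, hb]; ring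
      omega
    · exfalso
      have : 4 * (a ^ 2 + b ^ 2 + a + b) + 2 = 4 * (N - e * B ^ 2) := by rw [← h11, ha, hb]; ring
      omega
  obtain ⟨x, hx⟩ := Int.dvd_of_emod_eq_zero h10.1
  obtain ⟨y, hy⟩ := Int.dvd_of_emod_eq_zero h10.2
  refine ⟨x, y, ?_, ?_⟩
  · rw [hx] at hA; push_cast at hA; linarith
  · rw [hy] at hB; push_cast at hB; linarith

lemma qr_dedekind {d : ℕ} (hsq : Squarefree d) (hd4 : d % 4 = 1) (K : Type) [Field K] [NumberField K] (α : K) (hα : α ^ 2 = -(d : K))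
    (htop : IntermediateField.adjoin ℚ {α} = ⊤) :
    ∃ _ : IsDedekindDomain (QR d), Nonempty (ClassGroup (𝓞 K) ≃* ClassGroup (QR d)) := by
  have hd0 : 0 < d := by omega
  let f : QR d →ₐ[ℤ] K := QuadraticAlgebra.lift ⟨α, by rw [← sq, hα]; simp⟩
  let g : QuadraticAlgebra ℚ (-(d : ℚ)) 0 →ₐ[ℚ] K := QuadraticAlgebra.lift ⟨α, by rw [← sq, hα]; simp [Algebra.smul_def]⟩
  have hf : ∀ z : QR d, f z = z.re + z.im * α := fun z => by simp [f, QuadraticAlgebra.lift]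
  have hg : ∀ z, g z = z.re + z.im * α := fun z => by simp [g, QuadraticAlgebra.lift, Algebra.smul_def]
  have hginj : Function.Injective g := by
    have : Fact (∀ r : ℚ, r ^ 2 ≠ -(d : ℚ) + 0 * r) := ⟨fun r h => by
      have : (0 : ℚ) < d := by exact_mod_cast hd0
      nlinarith [sq_nonneg r]⟩
    exact g.toRingHom.injective
  have hgsurj : Function.Surjective g := by
    intro x
    have hint : IsIntegral ℚ α := Algebra.IsIntegral.isIntegral α
    have h1 : x ∈ (IntermediateField.adjoin ℚ {α}).toSubalgebra := by rw [htop]; trivial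
    rw [IntermediateField.adjoin_simple_toSubalgebra_of_isAlgebraic hint.isAlgebraic] at h1
    have h2 : Algebra.adjoin ℚ {α} ≤ g.range := Algebra.adjoin_le (by
      rintro _ rfl
      exact ⟨⟨0, 1⟩, by change g _ = _; rw [hg]; simp⟩)
    exact h2 h1
  have hfg : ∀ z : QR d, f z = g ⟨z.re, z.im⟩ := fun z => by rw [hf, hg]; simp
  have hfinj : Function.Injective f := by
    intro x y h
    rw [hfg, hfg] at h
    have := hginj h
    rw [QuadraticAlgebra.mk.injEq] at this
    ext
    · exact_mod_cast this.1
    · exact_mod_cast this.2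
  algebraize [f.toRingHom]
  have hic : IsIntegralClosure (QR d) ℤ K := by
    refine ⟨hfinj, fun {x} => ⟨fun hx => ?_, ?_⟩⟩
    · obtain ⟨z, rfl⟩ := hgsurj x
      have hz : IsIntegral ℤ z := (isIntegral_algHom_iff (g.restrictScalars ℤ) hginj).1 hx
      have hz' : IsIntegral ℤ (star z) := by
        have := hz.map ((starRingEnd (QuadraticAlgebra ℚ (-(d : ℚ)) 0)).toIntAlgHom)
        exact this
      have hrat : ∀ r : ℚ, IsIntegral ℤ (algebraMap ℚ (QuadraticAlgebra ℚ (-(d : ℚ)) 0) r) → ∃ n : ℤ, r = n := by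
        intro r hr
        have h1 : IsIntegral ℤ r := (isIntegral_algebraMap_iff (QuadraticAlgebra.algebraMap_injective)).1 hr
        obtain ⟨n, hn⟩ := IsIntegrallyClosed.isIntegral_iff.1 h1
        exact ⟨n, by rw [← hn]; simp⟩
      obtain ⟨A, hA⟩ := hrat (2 * z.re) (by
        have := hz.add hz'
        convert this using 1
        rw [← QuadraticAlgebra.algebraMap_trace_eq_add_star, QuadraticAlgebra.trace_def]
        congr 1; ring)
      obtain ⟨N, hN⟩ := hrat (z.re ^ 2 + d * z.im ^ 2) (by
        have := hz.mul hz'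
        convert this using 1
        rw [← QuadraticAlgebra.algebraMap_norm_eq_mul_star, QuadraticAlgebra.norm_def]
        congr 1; ring)
      obtain ⟨x, y, hx, hy⟩ := rat_int_arith hsq hd4 hA hN
      refine ⟨⟨x, y⟩, ?_⟩
      change f _ = _
      rw [hfg]
      congr 1
      ext
      · exact hx.symm
      · exact hy.symm
    · rintro ⟨z, rfl⟩
      exact (Algebra.IsIntegral.isIntegral (R := ℤ) z).map f
  have hst : IsScalarTower ℤ (QR d) K := IsScalarTower.of_algebraMap_eq fun n => by
    change _ = f _
    rw [hf]; simp
  have hdd : IsDedekindDomain (QR d) := by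
    have : IsDomain (QR d) := hfinj.isDomain f.toRingHom
    exact IsIntegralClosure.isDedekindDomain ℤ ℚ K (QR d)
  exact ⟨hdd, ⟨ClassGroup.mulEquiv (NumberField.RingOfIntegers.equiv (QR d))⟩⟩
end

section
lemma struct_lemma {G : Type*} [CommGroup G] [Finite G] (ℓ : ℕ) (a b : G) (ha : a ^ 2 = 1)
    (hb : orderOf b = 2 ^ ℓ) (ha' : ¬ IsSquare a) (hb' : ¬ IsSquare b) (hab : ¬ IsSquare (a * b))
    (t : Finset G) (ht : t.card ≤ 4) (ht' : ∀ x : G, x ^ 2 = 1 → x ∈ t) (P : Sylow 2 G) :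
    Nonempty ((P : Subgroup G) ≃* Multiplicative (ZMod 2 × ZMod (2 ^ ℓ))) := by
  classical
  have hrep : ∀ y : G, ∃ i j : ℕ, ∃ z, y = a ^ i * b ^ j * z ^ 2 := by
    intro y
    set s : G →* G := powMonoidHom 2 with hs
    have hker : Nat.card s.ker ≤ 4 := by
      refine le_trans ?_ ht
      rw [← SetLike.coe_sort_coe, Nat.card_coe_set_eq, ← Set.ncard_coe_finset]
      apply Set.ncard_le_ncard _ (Finset.finite_toSet _)
      intro x hx
      exact ht' x hx
    have hidx : Nat.card (G ⧸ s.range) ≤ 4 := by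
      have h1 := s.range.card_eq_card_quotient_mul_card_subgroup
      have h2 := s.ker.card_eq_card_quotient_mul_card_subgroup
      rw [Nat.card_congr (QuotientGroup.quotientKerEquivRange s).toEquiv, h1, mul_comm] at h2
      have h3 : 0 < Nat.card s.range := Nat.card_pos
      exact (Nat.eq_of_mul_eq_mul_left h3 h2).trans_le hker
    have hmk : ∀ x : G, (x : G ⧸ s.range) = 1 ↔ IsSquare x := by
      intro x
      rw [QuotientGroup.eq_one_iff]
      constructor
      · rintro ⟨z, rfl⟩; exact ⟨z, by simp [hs, sq]⟩
      · rintro ⟨z, rfl⟩; exact ⟨z, by simp [hs, sq]⟩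
    set A : G ⧸ s.range := QuotientGroup.mk a
    set B : G ⧸ s.range := QuotientGroup.mk b
    have hA : A ≠ 1 := fun h => ha' ((hmk a).1 h)
    have hB : B ≠ 1 := fun h => hb' ((hmk b).1 h)
    have hAB : A * B ≠ 1 := fun h => hab ((hmk (a * b)).1 h)
    have hAA : A * A = 1 := (hmk (a * a)).2 ⟨a, rfl⟩
    have hBA : A ≠ B := fun h => hAB (h ▸ hAA)
    have hset : ({1, A, B, A * B} : Finset (G ⧸ s.range)).card = 4 := by
      rw [Finset.card_insert_of_notMem, Finset.card_insert_of_notMem, Finset.card_insert_of_notMem,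
        Finset.card_singleton]
      · simpa using hA
      · simpa using ⟨hBA, hB⟩
      · simpa using ⟨hA.symm, hB.symm, hAB.symm⟩
    have : Fintype (G ⧸ s.range) := Fintype.ofFinite _
    have huniv : ({1, A, B, A * B} : Finset (G ⧸ s.range)) = Finset.univ := by
      apply Finset.eq_univ_of_card
      apply le_antisymm (Finset.card_le_univ _)
      rw [hset, ← Nat.card_eq_fintype_card]; exact hidx
    have hy : (y : G ⧸ s.range) ∈ ({1, A, B, A * B} : Finset (G ⧸ s.range)) := by rw [huniv]; simp
    have key : ∀ i j : ℕ, (y : G ⧸ s.range) = ((a ^ i * b ^ j : G) : G ⧸ s.range) → ∃ i j : ℕ, ∃ z, y = a ^ i * b ^ j * z ^ 2 := by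
      intro i j h
      obtain ⟨z, hz⟩ := QuotientGroup.eq.1 h.symm
      exact ⟨i, j, z, by rw [show z ^ 2 = s z from rfl, hz, mul_inv_cancel_left]⟩
    simp only [Finset.mem_insert, Finset.mem_singleton] at hy
    rcases hy with h | h | h | h
    · exact key 0 0 (by simpa using h)
    · exact key 1 0 (by simpa using h)
    · exact key 0 1 (by simpa using h)
    · exact key 1 1 (by simpa using h)
  have hbl : b ^ 2 ^ ℓ = 1 := by rw [← hb]; exact pow_orderOf_eq_one b
  let fa : ZMod 2 →+ Additive G := ZMod.lift 2 ⟨zmultiplesHom _ (Additive.ofMul a), by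
    simp only [zmultiplesHom_apply]
    rw [natCast_zsmul, ← ofMul_pow, ha]; rfl⟩
  let fb : ZMod (2 ^ ℓ) →+ Additive G := ZMod.lift (2 ^ ℓ) ⟨zmultiplesHom _ (Additive.ofMul b), by
    simp only [zmultiplesHom_apply]
    rw [natCast_zsmul, ← ofMul_pow, hbl]; rfl⟩
  have hfa : ∀ i : ℕ, fa (i : ZMod 2) = Additive.ofMul (a ^ i) := fun i => by
    have := ZMod.lift_coe 2 ⟨zmultiplesHom _ (Additive.ofMul a), by
      simp only [zmultiplesHom_apply]
      rw [natCast_zsmul, ← ofMul_pow, ha]; rfl⟩ (i : ℤ)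
    simpa using this
  have hfb : ∀ i : ℕ, fb (i : ZMod (2 ^ ℓ)) = Additive.ofMul (b ^ i) := fun i => by
    have := ZMod.lift_coe (2 ^ ℓ) ⟨zmultiplesHom _ (Additive.ofMul b), by
      simp only [zmultiplesHom_apply]
      rw [natCast_zsmul, ← ofMul_pow, hbl]; rfl⟩ (i : ℤ)
    simpa using this
  let φ : Multiplicative (ZMod 2 × ZMod (2 ^ ℓ)) →* G := AddMonoidHom.toMultiplicativeLeft (fa.coprod fb)
  have hφ : ∀ i j : ℕ, φ (Multiplicative.ofAdd ((i : ZMod 2), (j : ZMod (2 ^ ℓ)))) = a ^ i * b ^ j := fun i j => by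
    change Additive.toMul (fa i + fb j) = _
    rw [hfa, hfb]; rfl
  have hex : ∀ x : Multiplicative (ZMod 2 × ZMod (2 ^ ℓ)), ∃ i j : ℕ, i < 2 ∧ x = Multiplicative.ofAdd ((i : ZMod 2), (j : ZMod (2 ^ ℓ))) := by
    intro x
    refine ⟨x.toAdd.1.val, x.toAdd.2.val, ZMod.val_lt _, ?_⟩
    simp
  have hinj : Function.Injective φ := by
    rw [injective_iff_map_eq_one]
    intro x hx
    obtain ⟨i, j, hi, rfl⟩ := hex x
    rw [hφ] at hx
    interval_cases i
    · rw [pow_zero, one_mul] at hx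
      have := orderOf_dvd_of_pow_eq_one hx
      rw [hb] at this
      rw [(ZMod.natCast_eq_zero_iff _ _).2 this]; rfl
    · exfalso
      rw [pow_one] at hx
      rcases Nat.even_or_odd' j with ⟨u, hu | hu⟩
      · exact ha' ⟨(b ^ u)⁻¹, by rw [eq_inv_of_mul_eq_one_left hx, hu, ← mul_inv, ← pow_add, two_mul]⟩
      · exact hab ⟨(b ^ u)⁻¹, by
          rw [← mul_inv, ← pow_add, ← two_mul]
          apply eq_inv_of_mul_eq_one_left
          rw [← hx, hu, pow_succ]
          rw [mul_assoc, mul_comm b]⟩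
  have hpH : IsPGroup 2 φ.range := by
    have h1 : IsPGroup 2 (Multiplicative (ZMod 2 × ZMod (2 ^ ℓ))) := by
      apply IsPGroup.of_card (n := ℓ + 1)
      rw [Nat.card_congr Multiplicative.toAdd, Nat.card_prod, Nat.card_zmod, Nat.card_zmod, pow_succ, mul_comm]
    exact h1.of_surjective φ.rangeRestrict φ.rangeRestrict_surjective
  have hrange : ∀ i j : ℕ, a ^ i * b ^ j ∈ φ.range := fun i j => ⟨_, hφ i j⟩
  have hiter : ∀ n : ℕ, ∀ x : G, ∃ h ∈ φ.range, ∃ y, x = h * y ^ 2 ^ n := by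
    intro n
    induction n with
    | zero => intro x; exact ⟨1, one_mem _, x, by simp⟩
    | succ n ih =>
      intro x
      obtain ⟨h, hh, y, rfl⟩ := ih x
      obtain ⟨i, j, z, rfl⟩ := hrep y
      refine ⟨h * (a ^ i * b ^ j) ^ 2 ^ n, mul_mem hh (pow_mem (hrange i j) _), z, ?_⟩
      rw [mul_pow, ← pow_mul, mul_assoc, pow_succ' 2]
  have hle : (P : Subgroup G) ≤ φ.range := by
    intro x hx
    obtain ⟨s, m, hm, hcard⟩ := Nat.exists_eq_two_pow_mul_odd (n := Nat.card G) Nat.card_pos.ne'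
    obtain ⟨h, hh, y, hxy⟩ := hiter s x
    have h1 : x ^ m ∈ φ.range := by
      rw [hxy, mul_pow, ← pow_mul, ← hcard, pow_card_eq_one', mul_one]
      exact pow_mem hh _
    obtain ⟨r, hr⟩ := P.isPGroup' ⟨x, hx⟩
    have hr' : x ^ 2 ^ r = 1 := congrArg Subtype.val hr
    have hcop : Nat.gcd m (2 ^ r) = 1 := Nat.Coprime.pow_right _ (Nat.coprime_two_right.2 hm)
    have : x = (x ^ m) ^ (Nat.gcdA m (2 ^ r)) := by
      have h2 := Nat.gcd_eq_gcd_ab m (2 ^ r)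
      rw [hcop] at h2
      have h3 : x ^ ((1 : ℕ) : ℤ) = x ^ ((m : ℤ) * Nat.gcdA m (2 ^ r) + ((2 ^ r : ℕ) : ℤ) * Nat.gcdB m (2 ^ r)) := by rw [← h2]
      rw [zpow_add, zpow_mul, zpow_mul, zpow_natCast, zpow_natCast, zpow_natCast, hr', pow_one, one_zpow, mul_one] at h3
      exact h3
    rw [this]
    exact zpow_mem h1 _
  have heq : φ.range = P := P.is_maximal' hpH hle
  rw [← heq]
  exact ⟨(MonoidHom.ofInjective hinj).symm⟩
end

section
open nonZeroDivisors

lemma qr_absNorm {d : ℕ} [IsDedekindDomain (QR d)] (z : QR d) : (Ideal.absNorm (Ideal.span {z}) : ℤ) = z.re ^ 2 + d * z.im ^ 2 := by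
  have h : Algebra.norm ℤ z = QuadraticAlgebra.norm z := by
    rw [Algebra.norm_apply, ← QuadraticAlgebra.det_toLinearMap_eq_norm]
    congr 1
  rw [Ideal.absNorm_span_singleton, h, qr_norm, Int.natCast_natAbs, abs_of_nonneg (by positivity)]

lemma descent {p n d : ℕ} (hp : p.Prime) (hpd : p ∣ d) (hpp : ¬ p * p ∣ d) : ∀ t x y : ℕ, t ≠ 0 → x ^ 2 + d * y ^ 2 = n * t ^ 2 → IsSquare (n : ZMod p) := by
  have : Fact p.Prime := ⟨hp⟩
  obtain ⟨e, rfl⟩ := hpd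
  have hpe : ¬ p ∣ e := fun h => hpp (Nat.mul_dvd_mul_left p h)
  intro t
  induction t using Nat.strong_induction_on with
  | _ t ih =>
    intro x y ht h
    by_cases hpt : p ∣ t
    · obtain ⟨s, rfl⟩ := hpt
      have hx : p ∣ x := by
        apply hp.dvd_of_dvd_pow (n := 2)
        rw [Nat.dvd_add_iff_left (Dvd.intro (e * y ^ 2) (by ring : p * (e * y ^ 2) = p * e * y ^ 2)), h]
        exact ⟨n * p * s ^ 2, by ring⟩
      obtain ⟨u, rfl⟩ := hx
      have h1 : p * u ^ 2 + e * y ^ 2 = p * (n * s ^ 2) := by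
        apply Nat.eq_of_mul_eq_mul_left hp.pos
        linarith
      have hy : p ∣ y := by
        apply hp.dvd_of_dvd_pow (n := 2)
        apply ((Nat.Prime.dvd_mul hp).1 _).resolve_left hpe
        rw [Nat.dvd_add_iff_right (Dvd.intro (u ^ 2) rfl), h1]
        exact Dvd.intro _ rfl
      obtain ⟨v, rfl⟩ := hy
      have hs : s ≠ 0 := by rintro rfl; simp at ht
      refine ih s ?_ u v hs ?_
      · nlinarith [hp.two_le, Nat.pos_of_ne_zero hs]
      · apply Nat.eq_of_mul_eq_mul_left hp.pos
        linarith
    · have h1 : (x : ZMod p) ^ 2 = n * (t : ZMod p) ^ 2 := by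
        have := congrArg (Nat.cast : ℕ → ZMod p) h
        push_cast at this
        simpa using this
      have h2 : (t : ZMod p) ≠ 0 := by rwa [Ne, ZMod.natCast_eq_zero_iff]
      exact ⟨x / t, by field_simp; rw [h1]⟩

lemma nonsq {d p : ℕ} [IsDedekindDomain (QR d)] (hp : p.Prime) (hpd : p ∣ d) (hpp : ¬ p * p ∣ d)
    (I : (Ideal (QR d))⁰) (hI : IsSquare (ClassGroup.mk0 I)) : IsSquare ((Ideal.absNorm (I : Ideal (QR d)) : ℕ) : ZMod p) := by
  obtain ⟨c, hc⟩ := hI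
  obtain ⟨J, hJ⟩ := ClassGroup.mk0_surjective c⁻¹
  have h1 : ClassGroup.mk0 (I * (J * J)) = 1 := by
    rw [map_mul, map_mul, hc, hJ]; group
  obtain ⟨z, hz⟩ := (ClassGroup.mk0_eq_one_iff (I * (J * J)).2).1 h1
  have h2 := qr_absNorm z
  have hz' : (I : Ideal (QR d)) * (J * J) = Ideal.span {z} := by simpa using hz
  rw [← hz', map_mul, map_mul] at h2
  have hJ0 : Ideal.absNorm (J : Ideal (QR d)) ≠ 0 := by
    rw [Ne, Ideal.absNorm_eq_zero_iff]
    exact nonZeroDivisors.ne_zero J.2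
  refine descent hp hpd hpp _ z.re.natAbs z.im.natAbs hJ0 ?_
  zify
  rw [sq_abs, sq_abs, ← h2]
  push_cast; ring
end

section
open nonZeroDivisors

def JJ (d : ℕ) (e : ℤ) : Ideal (QR d) := Ideal.span {⟨e, 0⟩, ⟨0, 1⟩}
def KK (d : ℕ) (e : ℤ) : Ideal (QR d) := Ideal.span {⟨2 * e, 0⟩, ⟨e, 1⟩}

lemma span_mul_pair {R : Type*} [CommRing R] (x y z : R) : Ideal.span {x} * Ideal.span {y, z} = Ideal.span {x * y, x * z} := by
  rw [Ideal.span_mul_span', Set.singleton_mul, Set.image_pair]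

lemma span_pair_eq {R : Type*} [CommRing R] {x y z w : R} (h1 : ∃ a b, a * z + b * w = x) (h2 : ∃ a b, a * z + b * w = y)
    (h3 : ∃ a b, a * x + b * y = z) (h4 : ∃ a b, a * x + b * y = w) : Ideal.span {x, y} = Ideal.span {z, w} := by
  apply le_antisymm <;> rw [Ideal.span_le, Set.insert_subset_iff, Set.singleton_subset_iff] <;>
    exact ⟨Ideal.mem_span_pair.2 (by assumption), Ideal.mem_span_pair.2 (by assumption)⟩

lemma JJ_rel {d : ℕ} {e f : ℤ} (h : e * f = d) : Ideal.span {(⟨0, 1⟩ : QR d)} * JJ d e = Ideal.span {(⟨e, 0⟩ : QR d)} * JJ d f := by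
  rw [JJ, JJ, span_mul_pair, span_mul_pair]
  apply span_pair_eq
  · exact ⟨0, 1, by ext <;> simp⟩
  · exact ⟨-1, 0, by ext <;> simp [h]⟩
  · exact ⟨0, -1, by ext <;> simp [h]⟩
  · exact ⟨1, 0, by ext <;> simp⟩

lemma KK_rel {d : ℕ} {e f : ℤ} (h : e * f = d) : Ideal.span {(⟨0, 1⟩ : QR d)} * KK d e = Ideal.span {(⟨e, 0⟩ : QR d)} * KK d f := by
  rw [KK, KK, span_mul_pair, span_mul_pair]
  apply span_pair_eq
  · exact ⟨-1, ⟨2, 0⟩, by ext <;> simp <;> linarith⟩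
  · exact ⟨-1, 1, by ext <;> simp <;> linarith⟩
  · exact ⟨1, ⟨-2, 0⟩, by ext <;> simp <;> linarith⟩
  · exact ⟨1, -1, by ext <;> simp <;> linarith⟩

lemma inv_class {d : ℕ} (J : Ideal (QR d)) (hJ : J ≠ ⊥) (hst : ∀ x ∈ J, star x ∈ J) :
    ∃ c e : ℤ, c ≠ 0 ∧ e ∣ d ∧ (J = Ideal.span {⟨c, 0⟩} * JJ d e ∨ J = Ideal.span {⟨c, 0⟩} * KK d e) := by
  obtain ⟨c, hc⟩ := (IsPrincipalIdealRing.principal ((J.restrictScalars ℤ).map (QuadraticAlgebra.imₗ (-(d : ℤ)) 0) : Ideal ℤ)).principal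
  have him : ∀ z ∈ J, c ∣ z.im := fun z hz => by
    rw [← Ideal.mem_span_singleton, Ideal.span, ← hc]
    exact Submodule.mem_map_of_mem (f := QuadraticAlgebra.imₗ (-(d : ℤ)) 0) hz
  have hre : ∀ z ∈ J, c ∣ z.re := fun z hz => by
    have := him _ (J.mul_mem_left ⟨0, 1⟩ hz)
    simpa using this
  obtain ⟨z0, hz0, hz0c⟩ : ∃ z ∈ J, z.im = c := by
    have : c ∈ ((J.restrictScalars ℤ).map (QuadraticAlgebra.imₗ (-(d : ℤ)) 0) : Ideal ℤ) := by
      rw [hc]; exact Submodule.mem_span_singleton_self c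
    obtain ⟨z, hz, h⟩ := this
    exact ⟨z, hz, h⟩
  have hc0 : c ≠ 0 := by
    rintro rfl
    apply hJ
    rw [eq_bot_iff]
    intro z hz
    have h1 := hre z hz
    have h2 := him z hz
    rw [zero_dvd_iff] at h1 h2
    exact QuadraticAlgebra.ext h1 h2
  obtain ⟨b, hb⟩ := hre z0 hz0
  obtain ⟨a0, ha0⟩ := (IsPrincipalIdealRing.principal (J.comap (algebraMap ℤ (QR d)))).principal
  have hmem : ∀ r : ℤ, (⟨r, 0⟩ : QR d) ∈ J → a0 ∣ r := fun r hr => by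
    rw [← Ideal.mem_span_singleton, Ideal.span, ← ha0]
    exact hr
  have ha0J : (⟨a0, 0⟩ : QR d) ∈ J := by
    have : a0 ∈ (J.comap (algebraMap ℤ (QR d))) := by rw [ha0]; exact Submodule.mem_span_singleton_self _
    exact this
  obtain ⟨a, ha⟩ := hre _ ha0J
  have ha : a0 = c * a := ha
  have h2b : a ∣ 2 * b := by
    have : (⟨2 * (c * b), 0⟩ : QR d) ∈ J := by
      have := J.add_mem hz0 (hst _ hz0)
      convert this using 1
      ext <;> simp [hb]; ring
    have := hmem _ this
    rw [ha, show 2 * (c * b) = c * (2 * b) by ring] at this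
    exact Int.dvd_of_mul_dvd_mul_left hc0 this
  have hbd : a ∣ b ^ 2 + d := by
    have : (⟨c * (b ^ 2 + d), 0⟩ : QR d) ∈ J := by
      have := J.mul_mem_left ⟨b, -1⟩ hz0
      convert this using 1
      ext <;> simp [hb, hz0c] <;> ring
    have := hmem _ this
    rw [ha] at this
    exact Int.dvd_of_mul_dvd_mul_left hc0 this
  have hJeq : J = Ideal.span {⟨c, 0⟩} * Ideal.span {⟨a, 0⟩, ⟨b, 1⟩} := by
    rw [span_mul_pair]
    apply le_antisymm
    · intro z hz
      obtain ⟨y, hy⟩ := him z hz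
      have h1 : (⟨z.re - y * (c * b), 0⟩ : QR d) ∈ J := by
        have := J.sub_mem hz (J.mul_mem_left ⟨y, 0⟩ hz0)
        convert this using 1
        ext <;> simp [hb, hy, hz0c]
        ring
      obtain ⟨x, hx⟩ := hmem _ h1
      refine Ideal.mem_span_pair.2 ⟨⟨x, 0⟩, ⟨y, 0⟩, ?_⟩
      ext <;> simp
      · rw [ha] at hx; linarith
      · rw [hy]; ring
    · rw [Ideal.span_le, Set.insert_subset_iff, Set.singleton_subset_iff]
      constructor
      · rw [SetLike.mem_coe]
        convert ha0J using 1
        ext <;> simp [ha]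
      · rw [SetLike.mem_coe]
        convert hz0 using 1
        ext <;> simp [hb, hz0c]
  by_cases hab : a ∣ b
  · refine ⟨c, a, hc0, ?_, Or.inl ?_⟩
    · exact (Int.dvd_add_right (Dvd.dvd.pow hab two_ne_zero)).1 hbd
    · rw [hJeq, JJ]
      congr 1
      obtain ⟨k, rfl⟩ := hab
      apply span_pair_eq
      · exact ⟨1, 0, by simp⟩
      · exact ⟨⟨k, 0⟩, 1, by ext <;> simp; ring⟩
      · exact ⟨1, 0, by simp⟩
      · exact ⟨⟨-k, 0⟩, 1, by ext <;> simp; ring⟩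
  · obtain ⟨k, hk⟩ := h2b
    have hkodd : k % 2 = 1 := by
      by_contra hk2
      exact hab ⟨k / 2, by
        have : k = 2 * (k / 2) := by omega
        rw [this] at hk; linarith⟩
    obtain ⟨e, rfl⟩ : (2 : ℤ) ∣ a := by
      have : (2 : ℤ) ∣ a * k := ⟨b, hk.symm⟩
      exact (Int.prime_two.dvd_or_dvd this).resolve_right (by omega)
    obtain ⟨j, hj⟩ : ∃ j, k = 2 * j + 1 := ⟨k / 2, by omega⟩
    have hbe : b = e + j * (2 * e) := by rw [hj] at hk; linarith
    refine ⟨c, e, hc0, ?_, Or.inr ?_⟩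
    · have h1 : e ∣ b ^ 2 := Dvd.dvd.pow ⟨1 + 2 * j, by rw [hbe]; ring⟩ two_ne_zero
      exact (Int.dvd_add_right h1).1 ((Dvd.intro_left _ rfl).trans hbd)
    · rw [hJeq, KK, hbe]
      congr 1
      apply span_pair_eq
      · exact ⟨1, 0, by simp⟩
      · exact ⟨⟨j, 0⟩, 1, by ext <;> simp; ring⟩
      · exact ⟨1, 0, by simp⟩
      · exact ⟨⟨-j, 0⟩, 1, by ext <;> simp⟩
end

section
open nonZeroDivisors

lemma JJ_neg {d : ℕ} (e : ℤ) : JJ d (-e) = JJ d e := span_pair_eq ⟨-1, 0, by ext <;> simp⟩ ⟨0, 1, by simp⟩ ⟨-1, 0, by ext <;> simp⟩ ⟨0, 1, by simp⟩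

lemma KK_neg {d : ℕ} (e : ℤ) : KK d (-e) = KK d e :=
  span_pair_eq ⟨-1, 0, by ext <;> simp⟩ ⟨-1, 1, by ext <;> simp; ring⟩ ⟨-1, 0, by ext <;> simp⟩ ⟨-1, 1, by ext <;> simp; ring⟩

lemma JJ_mem {d : ℕ} [IsDomain (QR d)] (e : ℤ) : JJ d e ∈ (Ideal (QR d))⁰ := by
  rw [mem_nonZeroDivisors_iff_ne_zero]
  intro h
  have h1 : (⟨0, 1⟩ : QR d) ∈ JJ d e := Ideal.subset_span (by simp)
  rw [h] at h1
  have := congrArg QuadraticAlgebra.im h1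
  simp at this

lemma KK_mem {d : ℕ} [IsDomain (QR d)] (e : ℤ) : KK d e ∈ (Ideal (QR d))⁰ := by
  rw [mem_nonZeroDivisors_iff_ne_zero]
  intro h
  have h1 : (⟨e, 1⟩ : QR d) ∈ KK d e := Ideal.subset_span (by simp)
  rw [h] at h1
  have := congrArg QuadraticAlgebra.im h1
  simp at this

lemma inv_ideal {d : ℕ} [IsDedekindDomain (QR d)] (I : Ideal (QR d)) (hI : I ≠ ⊥) (hpr : (I ^ 2).IsPrincipal) :
    ∃ w : QR d, w ≠ 0 ∧ ∀ x ∈ Ideal.span {w} * I, star x ∈ Ideal.span {w} * I := by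
  obtain ⟨γ0, hγ0⟩ := hpr
  set n := Ideal.absNorm I with hn
  have hn0 : n ≠ 0 := by rwa [hn, Ne, Ideal.absNorm_eq_zero_iff]
  have hnR : (n : QR d) ≠ 0 := by exact_mod_cast hn0
  obtain ⟨γ, hγ, hne⟩ : ∃ γ : QR d, I ^ 2 = Ideal.span {γ} ∧ (n : QR d) + γ ≠ 0 := by
    by_cases h : (n : QR d) + γ0 = 0
    · refine ⟨-γ0, by rw [Ideal.span_singleton_neg]; exact hγ0, ?_⟩
      rw [← eq_neg_of_add_eq_zero_left h]
      exact fun h' => hnR (by simpa using h')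
    · exact ⟨γ0, hγ0, h⟩
  have hN : γ * star γ = (n : QR d) ^ 2 := by
    rw [← QuadraticAlgebra.algebraMap_norm_eq_mul_star, qr_norm, ← qr_absNorm, ← hγ, map_pow]
    simp [hn]
  set σ := starRingEnd (QR d) with hσ
  have hσ' : ∀ x, σ x = star x := fun x => rfl
  have h1 : I * I.map σ = Ideal.span {(n : QR d)} := by
    have h2 : (I * I.map σ) ^ 2 = Ideal.span {(n : QR d)} ^ 2 := by
      rw [mul_pow, ← Ideal.map_pow, hγ, Ideal.map_span, Set.image_singleton, Ideal.span_singleton_mul_span_singleton,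
        Ideal.span_singleton_pow, hσ', hN]
    apply dvd_antisymm <;> rw [← UniqueFactorizationMonoid.pow_dvd_pow_iff_dvd two_ne_zero, h2]
  have h3 : Ideal.span {(n : QR d) + γ} * I.map σ = Ideal.span {(n : QR d) + star γ} * I := by
    have h4 : I * (Ideal.span {(n : QR d) + γ} * I.map σ) = I * (Ideal.span {(n : QR d) + star γ} * I) := by
      rw [mul_left_comm, h1, mul_left_comm, ← sq, hγ, Ideal.span_singleton_mul_span_singleton, Ideal.span_singleton_mul_span_singleton]
      congr 2
      rw [add_mul, add_mul, mul_comm (star γ), hN]; ring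
    exact mul_left_cancel₀ hI h4
  refine ⟨(n : QR d) + star γ, ?_, ?_⟩
  · intro h
    apply hne
    have := congrArg star h
    simpa using this
  · intro x hx
    have := Ideal.mem_map_of_mem σ hx
    rw [Ideal.map_mul, Ideal.map_span, Set.image_singleton, map_add, map_natCast, hσ', star_star, h3] at this
    exact this

lemma mk0_one {R : Type*} [CommRing R] [IsDedekindDomain R] (I : (Ideal R)⁰) : ClassGroup.mk0 I = 1 ↔ (I : Ideal R).IsPrincipal := by
  obtain ⟨I, hI⟩ := I
  exact ClassGroup.mk0_eq_one_iff hI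

lemma two_tors {d p q : ℕ} (hp : p.Prime) (hq : q.Prime) (hd : p * q = d) [IsDedekindDomain (QR d)] :
    ∃ t : Finset (ClassGroup (QR d)), t.card ≤ 4 ∧ ∀ x, x ^ 2 = 1 → x ∈ t := by
  classical
  obtain ⟨cJ, hcJ⟩ : ∃ F : ℤ → ClassGroup (QR d), ∀ e, F e = ClassGroup.mk0 ⟨JJ d e, JJ_mem e⟩ := ⟨_, fun _ => rfl⟩
  obtain ⟨cK, hcK⟩ : ∃ F : ℤ → ClassGroup (QR d), ∀ e, F e = ClassGroup.mk0 ⟨KK d e, KK_mem e⟩ := ⟨_, fun _ => rfl⟩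
  have hd0 : (d : ℤ) ≠ 0 := by rw [← hd]; exact_mod_cast Nat.mul_ne_zero hp.ne_zero hq.ne_zero
  have hmk : ∀ e : ℤ, e ≠ 0 → (⟨e, 0⟩ : QR d) ≠ 0 := fun e he h => he (congrArg QuadraticAlgebra.re h)
  have hω : (⟨0, 1⟩ : QR d) ≠ 0 := fun h => one_ne_zero (congrArg QuadraticAlgebra.im h)
  have hJ : ∀ e f : ℤ, e * f = d → cJ e = cJ f := fun e f h => by
    rw [hcJ, hcJ]
    refine (ClassGroup.mk0_eq_mk0_iff ..).2 ⟨⟨0, 1⟩, ⟨e, 0⟩, hω, hmk e ?_, JJ_rel h⟩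
    rintro rfl; simp at h; exact hd0 (by exact_mod_cast h.symm)
  have hK : ∀ e f : ℤ, e * f = d → cK e = cK f := fun e f h => by
    rw [hcK, hcK]
    refine (ClassGroup.mk0_eq_mk0_iff ..).2 ⟨⟨0, 1⟩, ⟨e, 0⟩, hω, hmk e ?_, KK_rel h⟩
    rintro rfl; simp at h; exact hd0 (by exact_mod_cast h.symm)
  refine ⟨{cJ 1, cJ p, cK 1, cK p}, Finset.card_le_four, fun x hx => ?_⟩
  obtain ⟨I, rfl⟩ := ClassGroup.mk0_surjective x
  rw [← map_pow] at hx
  have hpr := (mk0_one (I ^ 2)).1 hx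
  rw [SubmonoidClass.coe_pow] at hpr
  obtain ⟨w, hw, hst⟩ := inv_ideal (I : Ideal (QR d)) (nonZeroDivisors.ne_zero I.2) hpr
  have hne : Ideal.span {w} * (I : Ideal (QR d)) ≠ ⊥ := by
    apply mul_ne_zero
    · simpa using hw
    · exact nonZeroDivisors.ne_zero I.2
  obtain ⟨c, e, hc, hed, h⟩ := inv_class _ hne hst
  have he : e.natAbs ∈ ({1, p, q, p * q} : Finset ℕ) := by
    have : e.natAbs ∣ p * q := by rw [hd]; exact Int.natAbs_dvd_natAbs.2 hed
    obtain ⟨y, z, hy, hz, hyz⟩ := (Nat.dvd_mul).1 this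
    rcases (Nat.dvd_prime hp).1 hy with rfl | rfl <;> rcases (Nat.dvd_prime hq).1 hz with rfl | rfl <;> simp [← hyz]
  have hf : ∀ F : ℤ → ClassGroup (QR d), (∀ e, F (-e) = F e) → (∀ e f : ℤ, e * f = d → F e = F f) →
      F e = F 1 ∨ F e = F p := by
    intro F h1 h2
    have h3 : F e = F (e.natAbs : ℤ) := by
      rcases Int.natAbs_eq e with h | h
      · rw [← h]
      · rw [← h1 e]; congr 1; omega
    rw [h3]
    simp only [Finset.mem_insert, Finset.mem_singleton] at he
    rcases he with h | h | h | h <;> rw [h]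
    · left; rfl
    · right; rfl
    · right; exact h2 _ _ (by rw [← hd]; push_cast; ring)
    · left; exact h2 _ _ (by rw [← hd]; push_cast; ring)
  rcases h with h | h
  · have h1 : ClassGroup.mk0 I = cJ e := (hcJ e).symm ▸ (ClassGroup.mk0_eq_mk0_iff ..).2 ⟨w, ⟨c, 0⟩, hw, hmk c hc, h⟩
    rw [h1]
    rcases hf cJ (fun e => by rw [hcJ, hcJ]; congr 2; exact JJ_neg e) hJ with h | h <;> rw [h] <;> simp only [Finset.mem_insert, true_or, or_true, Finset.mem_singleton]
  · have h1 : ClassGroup.mk0 I = cK e := (hcK e).symm ▸ (ClassGroup.mk0_eq_mk0_iff ..).2 ⟨w, ⟨c, 0⟩, hw, hmk c hc, h⟩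
    rw [h1]
    rcases hf cK (fun e => by rw [hcK, hcK]; congr 2; exact KK_neg e) hK with h | h <;> rw [h] <;> simp only [Finset.mem_insert, true_or, or_true, Finset.mem_singleton]
end

section
open nonZeroDivisors NumberField

lemma absNorm_of_sq {d : ℕ} [IsDedekindDomain (QR d)] {I : Ideal (QR d)} {n : ℕ} (h : I * I = Ideal.span {(⟨n, 0⟩ : QR d)}) : Ideal.absNorm I = n := by
  have h1 := qr_absNorm (⟨n, 0⟩ : QR d)
  rw [← h, map_mul] at h1
  have h2 : (Ideal.absNorm I) ^ 2 = n ^ 2 := by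
    zify; push_cast at h1; linarith
  exact Nat.pow_left_injective two_ne_zero h2

lemma pair_sq {R : Type*} [CommRing R] {x y n : R} (h1 : n ∣ x * x) (h2 : n ∣ x * y) (h3 : n ∣ y * y)
    (h : ∃ a b c, n = a * (x * x) + b * (x * y) + c * (y * y)) : Ideal.span {x, y} * Ideal.span {x, y} = Ideal.span {n} := by
  have hx : x ∈ Ideal.span {x, y} := Ideal.subset_span (by simp)
  have hy : y ∈ Ideal.span {x, y} := Ideal.subset_span (by simp)
  apply le_antisymm
  · rw [Ideal.span_pair_mul_span_pair, Ideal.span_le]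
    rintro z (rfl | rfl | rfl | rfl)
    · exact Ideal.mem_span_singleton.2 h1
    · exact Ideal.mem_span_singleton.2 h2
    · exact Ideal.mem_span_singleton.2 (mul_comm x y ▸ h2)
    · exact Ideal.mem_span_singleton.2 h3
  · rw [Ideal.span_singleton_le_iff_mem]
    obtain ⟨a, b, c, h⟩ := h
    rw [h]
    exact add_mem (add_mem (Ideal.mul_mem_left _ _ (Ideal.mul_mem_mul hx hx)) (Ideal.mul_mem_left _ _ (Ideal.mul_mem_mul hx hy)))
      (Ideal.mul_mem_left _ _ (Ideal.mul_mem_mul hy hy))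

lemma KK_sq {d : ℕ} (hd4 : d % 4 = 1) : KK d 1 * KK d 1 = Ideal.span {(⟨(2 : ℕ), 0⟩ : QR d)} := by
  obtain ⟨j, hj⟩ : ∃ j : ℤ, (d : ℤ) = 4 * j + 1 := ⟨d / 4, by omega⟩
  apply pair_sq
  · exact ⟨⟨2, 0⟩, by ext <;> simp⟩
  · exact ⟨⟨1, 1⟩, by ext <;> simp⟩
  · exact ⟨⟨-2 * j, 1⟩, by ext <;> simp [hj]; ring⟩
  · exact ⟨⟨-j, 0⟩, 1, -1, by ext <;> simp [hj]; ring⟩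

lemma JJ_sq {d q : ℕ} (hq : q % 3 = 1) (hd : 3 * q = d) : JJ d 3 * JJ d 3 = Ideal.span {(⟨(3 : ℕ), 0⟩ : QR d)} := by
  obtain ⟨j, hj⟩ : ∃ j : ℤ, (q : ℤ) = 3 * j + 1 := ⟨q / 3, by omega⟩
  have hd' : (d : ℤ) = 3 * q := by exact_mod_cast hd.symm
  apply pair_sq
  · exact ⟨⟨3, 0⟩, by ext <;> simp⟩
  · exact ⟨⟨0, 1⟩, by ext <;> simp⟩
  · exact ⟨⟨-q, 0⟩, by ext <;> simp [hd']⟩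
  · exact ⟨⟨-j, 0⟩, 0, -1, by ext <;> simp [hd', hj]; ring⟩

lemma crit {d p q ℓ : ℕ} (hp : p.Prime) (hq : q.Prime) (hpq : p ≠ q) (hd : p * q = d) (hd4 : d % 4 = 1)
    (h2 : ∃ r, (r = p ∨ r = q) ∧ ¬ IsSquare ((2 : ℕ) : ZMod r))
    (hB : ∀ [IsDedekindDomain (QR d)], ∃ (I : (Ideal (QR d))⁰) (n : ℕ), orderOf (ClassGroup.mk0 I) = 2 ^ ℓ ∧
      Ideal.absNorm (I : Ideal (QR d)) = n ∧ (∃ r, (r = p ∨ r = q) ∧ ¬ IsSquare (n : ZMod r)) ∧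
      (∃ r, (r = p ∨ r = q) ∧ ¬ IsSquare ((2 * n : ℕ) : ZMod r))) :
    Squarefree d ∧ twoClassGroupIso d (Multiplicative (ZMod 2 × ZMod (2 ^ ℓ))) := by
  classical
  have hsq : Squarefree d := by
    rw [← hd, Nat.squarefree_mul ((Nat.coprime_primes hp hq).2 hpq)]
    exact ⟨hp.squarefree, hq.squarefree⟩
  refine ⟨hsq, fun K _ _ α hα htop P => ?_⟩
  obtain ⟨_, ⟨e⟩⟩ := qr_dedekind hsq hd4 K α hα htop
  obtain ⟨I, n, hord, hn, hr1, hr2⟩ := hB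
  obtain ⟨t, ht, ht'⟩ := two_tors hp hq hd
  have hr : ∀ (L : (Ideal (QR d))⁰) (r : ℕ), (r = p ∨ r = q) → IsSquare (ClassGroup.mk0 L) → IsSquare ((Ideal.absNorm (L : Ideal (QR d)) : ℕ) : ZMod r) := by
    intro L r hr hL
    have hrp : r.Prime := by rcases hr with rfl | rfl <;> assumption
    refine nonsq hrp ?_ ?_ L hL
    · rcases hr with rfl | rfl <;> rw [← hd]
      · exact Dvd.intro _ rfl
      · exact Dvd.intro_left _ rfl
    · intro h; exact hrp.not_isUnit (hsq r h)
  have hmap : ∀ x, IsSquare (e.symm x) → IsSquare x := fun x hx => by simpa using hx.map e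
  have hK2 := absNorm_of_sq (KK_sq hd4)
  have hK1 : (ClassGroup.mk0 ⟨KK d 1, KK_mem 1⟩) ^ 2 = 1 := by
    rw [sq, ← map_mul, mk0_one, Submonoid.coe_mul]
    exact ⟨_, KK_sq hd4⟩
  refine struct_lemma ℓ (e.symm (ClassGroup.mk0 ⟨KK d 1, KK_mem 1⟩)) (e.symm (ClassGroup.mk0 I)) ?_ ?_ ?_ ?_ ?_
    (t.image e.symm) (Finset.card_image_le.trans ht) ?_ P
  · rw [← map_pow, hK1, map_one]
  · rw [MulEquiv.orderOf_eq, hord]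
  · intro h
    obtain ⟨r, hr', h'⟩ := h2
    have := hr _ r hr' (hmap _ h)
    rw [hK2] at this
    exact h' this
  · intro h
    obtain ⟨r, hr', h'⟩ := hr1
    have := hr _ r hr' (hmap _ h)
    rw [hn] at this
    exact h' this
  · intro h
    obtain ⟨r, hr', h'⟩ := hr2
    rw [← map_mul, ← map_mul] at h
    have := hr _ r hr' (hmap _ h)
    rw [Submonoid.coe_mul, map_mul, hn, hK2] at this
    exact h' this
  · intro x hx
    rw [Finset.mem_image]
    exact ⟨e x, ht' _ (by rw [← map_pow, hx, map_one]), by simp⟩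
end

section
open nonZeroDivisors NumberField NumberTheorySymbols

lemma case_one (B : ℕ) : ∃ d : ℕ, B < d ∧ Squarefree d ∧ twoClassGroupIso d (Multiplicative (ZMod 2 × ZMod (2 ^ 1))) := by
  obtain ⟨q, hqB, hq, hmod⟩ := Nat.forall_exists_prime_gt_and_modEq (B + 3) (q := 24) (a := 7) (by norm_num) (by norm_num)
  have hmod : q % 24 = 7 := hmod
  have hJ3 : J(3 | q) = -1 := by
    have h1 : J((3 : ℕ) | q) = -J(q | 3) := jacobiSym.quadratic_reciprocity_three_mod_four (by norm_num) (by omega)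
    have h2 : J((q : ℤ) | 3) = 1 := by
      rw [jacobiSym.mod_left, show (q : ℤ) % (3 : ℕ) = 1 by omega, jacobiSym.one_left]
    rw [h2] at h1
    exact_mod_cast h1
  have hJ6 : J(6 | q) = -1 := by
    rw [show (6 : ℤ) = 2 * 3 by norm_num, jacobiSym.mul_left, hJ3, jacobiSym.at_two (by rw [Nat.odd_iff]; omega),
      ZMod.χ₈_nat_mod_eight, show q % 8 = 7 by omega]
    rfl
  refine ⟨3 * q, by omega, crit Nat.prime_three hq (by omega) rfl (by omega) ⟨3, Or.inl rfl, by decide⟩ ?_⟩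
  intro _
  have h3 := JJ_sq (d := 3 * q) (q := q) (by omega) rfl
  have hn := absNorm_of_sq h3
  have hsq3 : ¬ IsSquare ((3 : ℕ) : ZMod q) := by
    have := ZMod.nonsquare_of_jacobiSym_eq_neg_one hJ3
    exact_mod_cast this
  refine ⟨⟨JJ (3 * q) 3, JJ_mem 3⟩, 3, ?_, hn, ⟨q, Or.inr rfl, hsq3⟩, ⟨q, Or.inr rfl, ?_⟩⟩
  · rw [pow_one]
    have : Fact (Nat.Prime 2) := ⟨Nat.prime_two⟩
    apply orderOf_eq_prime
    · rw [sq, ← map_mul, mk0_one, Submonoid.coe_mul]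
      exact ⟨_, h3⟩
    · intro h
      have h1 := nonsq hq (Dvd.intro_left 3 rfl) (fun h => ?_) ⟨JJ (3 * q) 3, JJ_mem 3⟩ (h ▸ ⟨1, by simp⟩)
      · rw [hn] at h1
        exact hsq3 h1
      · have := (Nat.dvd_prime Nat.prime_three).1 (Nat.dvd_of_mul_dvd_mul_right hq.pos h)
        omega
  · have := ZMod.nonsquare_of_jacobiSym_eq_neg_one hJ6
    exact_mod_cast this

lemma J_exists {p q n : ℕ} (hp : p.Prime) (hq : q.Prime) (h : J(n | p * q) = -1) : ∃ r, (r = p ∨ r = q) ∧ ¬ IsSquare (n : ZMod r) := by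
  rw [jacobiSym.mul_right' _ hp.ne_zero hq.ne_zero] at h
  by_contra hcon
  push Not at hcon
  have key : ∀ r, (r = p ∨ r = q) → J(n | r) ≠ -1 := fun r hr h1 =>
    ZMod.nonsquare_of_jacobiSym_eq_neg_one h1 (by exact_mod_cast hcon r hr)
  have hp' := key p (Or.inl rfl)
  have hq' := key q (Or.inr rfl)
  rcases jacobiSym.trichotomy n p with h1 | h1 | h1 <;> rcases jacobiSym.trichotomy n q with h2 | h2 | h2 <;> simp_all

lemma qr_unit {d : ℕ} (hd : 1 < d) {u : QR d} (hu : IsUnit u) : u.im = 0 ∧ (u.re = 1 ∨ u.re = -1) := by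
  rw [QuadraticAlgebra.isUnit_iff_norm_isUnit, qr_norm, Int.isUnit_iff] at hu
  have h1 : u.re ^ 2 + d * u.im ^ 2 = 1 := by
    rcases hu with h | h
    · exact h
    · nlinarith [sq_nonneg u.re, mul_nonneg (Int.natCast_nonneg d) (sq_nonneg u.im)]
  have h2 : u.im = 0 := by
    by_contra h
    have : 0 < u.im ^ 2 := by positivity
    have hd' : (1 : ℤ) < d := by exact_mod_cast hd
    nlinarith [sq_nonneg u.re]
  refine ⟨h2, ?_⟩
  rw [h2] at h1
  have h3 : (u.re - 1) * (u.re + 1) = 0 := by linarith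
  rcases mul_eq_zero.1 h3 with h | h
  · left; linarith
  · right; linarith

lemma case_big {n m p q : ℕ} (hn : 1 ≤ n) (hm : m % 4 = 3) (hp : p.Prime) (hq : q.Prime) (hp8 : p % 8 = 5) (hpq : p + q = 2 * m ^ 2 ^ n) :
    Squarefree (p * q) ∧ twoClassGroupIso (p * q) (Multiplicative (ZMod 2 × ZMod (2 ^ (n + 1)))) := by
  set k := 2 ^ n with hk
  have hk2 : 2 ≤ k := by rw [hk]; calc 2 = 2 ^ 1 := rfl
    _ ≤ 2 ^ n := Nat.pow_le_pow_right (by norm_num) hn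
  have hmk8 : m ^ k % 8 = 1 := by
    obtain ⟨j, hj⟩ : 2 ∣ k := dvd_pow_self 2 (by omega)
    have h1 : m ^ 2 % 8 = 1 := by
      rw [Nat.pow_mod]
      have : m % 8 = 3 ∨ m % 8 = 7 := by omega
      rcases this with h | h <;> rw [h]
    rw [hj, pow_mul, Nat.pow_mod, h1, one_pow]; rfl
  have hne : p ≠ q := by
    rintro rfl
    have : p = m ^ k := by omega
    exact Nat.Prime.not_prime_pow hk2 (this ▸ hp)
  have hq8 : q % 8 = 5 := by omega
  have hd8 : p * q % 8 = 1 := by rw [Nat.mul_mod, hp8, hq8]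
  have hd4 : p * q % 4 = 1 := by omega
  obtain ⟨s, hs⟩ : ∃ s : ℤ, s = p - m ^ k := ⟨_, rfl⟩
  have hp' : (p : ℤ) = m ^ k + s := by rw [hs]; ring
  have hq' : (q : ℤ) = m ^ k - s := by rw [hs]; have : (p : ℤ) + q = 2 * m ^ k := by exact_mod_cast hpq
                                       linarith
  have hd : ((p * q : ℕ) : ℤ) = m ^ (2 * k) - s ^ 2 := by push_cast; rw [hp', hq']; ring
  have hmodd : Odd m := by rw [Nat.odd_iff]; omega
  have hcop : IsCoprime s (m : ℤ) := by
    rw [Int.isCoprime_iff_gcd_eq_one]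
    by_contra hg
    obtain ⟨r, hr, hrg⟩ := Nat.exists_prime_and_dvd hg
    have h1 : (r : ℤ) ∣ s := (Int.natCast_dvd_natCast.2 hrg).trans (Int.gcd_dvd_left ..)
    have h2 : (r : ℤ) ∣ m ^ k := dvd_pow ((Int.natCast_dvd_natCast.2 hrg).trans (Int.gcd_dvd_right ..)) (by omega)
    have h3 : r ∣ p := by zify; rw [hp']; exact dvd_add h2 h1
    have h4 : r ∣ q := by zify; rw [hq']; exact dvd_sub h2 h1
    exact hne (((Nat.prime_dvd_prime_iff_eq hr hp).1 h3).symm.trans ((Nat.prime_dvd_prime_iff_eq hr hq).1 h4))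
  have hJm : J(m | p * q) = -1 := by
    rw [← jacobiSym.quadratic_reciprocity_one_mod_four hd4 hmodd, hd,
      jacobiSym.mod_left' (a₂ := -1 * s ^ 2), jacobiSym.mul_left, jacobiSym.sq_one' (Int.isCoprime_iff_gcd_eq_one.1 hcop),
      jacobiSym.at_neg_one hmodd, ZMod.χ₄_nat_mod_four, hm]
    · rfl
    · rw [Int.emod_emod_of_dvd _ dvd_rfl |>.symm]
      apply Int.emod_emod_of_dvd _ dvd_rfl |>.symm.trans
      rw [Int.emod_emod_of_dvd _ dvd_rfl, Int.emod_emod_of_dvd _ dvd_rfl]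
      apply Int.emod_emod_of_dvd _ dvd_rfl |>.symm.trans
      rw [Int.emod_emod_of_dvd _ dvd_rfl]
      apply Int.ModEq.symm
      rw [Int.modEq_iff_dvd]
      exact (dvd_pow_self (m : ℤ) (by omega : 2 * k ≠ 0)).trans ⟨1, by ring⟩
  have hJ2m : J((2 * m : ℕ) | p * q) = -1 := by
    push_cast
    rw [jacobiSym.mul_left, hJm, jacobiSym.at_two (by rw [Nat.odd_iff]; omega), ZMod.χ₈_nat_mod_eight, hd8]
    rfl
  refine crit hp hq hne rfl hd4 ⟨p, Or.inl rfl, ?_⟩ ?_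
  · have : Fact p.Prime := ⟨hp⟩
    have := (ZMod.exists_sq_eq_two_iff (p := p) (by omega)).not.2 (by omega)
    exact_mod_cast this
  intro _
  generalize hdd : p * q = d at *
  have hψ : Ideal.span {(⟨s, 1⟩ : QR d)} * Ideal.span {(⟨s, -1⟩ : QR d)} = Ideal.span {(m : QR d)} ^ (2 * k) := by
    rw [Ideal.span_singleton_mul_span_singleton, Ideal.span_singleton_pow]
    congr 2
    have : ((m : QR d)) ^ (2 * k) = (((m : ℤ) ^ (2 * k) : ℤ) : QR d) := by push_cast; rfl
    rw [this]
    ext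
    · rw [QuadraticAlgebra.re_intCast]; simp; linarith
    · rw [QuadraticAlgebra.im_intCast]; simp
  have hcp : IsCoprime (Ideal.span {(⟨s, 1⟩ : QR d)}) (Ideal.span {(⟨s, -1⟩ : QR d)}) := by
    rw [Ideal.isCoprime_span_singleton_iff]
    have h1 : IsCoprime (2 * s) ((m : ℤ) ^ (2 * k)) := by
      apply IsCoprime.pow_right
      apply IsCoprime.mul_left _ hcop
      rw [Int.isCoprime_iff_gcd_eq_one]
      exact_mod_cast Nat.coprime_two_left.2 hmodd
    obtain ⟨x, y, hxy⟩ := h1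
    refine ⟨⟨x + y * s, -y⟩, ⟨x, 0⟩, ?_⟩
    rw [show (m : ℤ) ^ (2 * k) = d + s ^ 2 by linarith] at hxy
    ext <;> simp [QuadraticAlgebra.re_one, QuadraticAlgebra.im_one]
    linarith
  obtain ⟨M, hM⟩ := exists_eq_pow_of_mul_eq_pow_of_coprime hcp hψ
  have hM0 : M ∈ (Ideal (QR d))⁰ := by
    rw [mem_nonZeroDivisors_iff_ne_zero]
    rintro rfl
    rw [zero_pow (by omega), Ideal.zero_eq_bot, Ideal.span_singleton_eq_bot] at hM
    have := congrArg QuadraticAlgebra.im hM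
    simp at this
  have hnorm : Ideal.absNorm M = m := by
    have h1 := qr_absNorm (⟨s, 1⟩ : QR d)
    rw [hM, map_pow] at h1
    have h2 : Ideal.absNorm M ^ (2 * k) = m ^ (2 * k) := by zify; push_cast at h1; linarith
    exact Nat.pow_left_injective (by omega) h2
  refine ⟨⟨M, hM0⟩, m, ?_, hnorm, J_exists hp hq (hdd ▸ hJm), J_exists hp hq (hdd ▸ hJ2m)⟩
  have : Fact (Nat.Prime 2) := ⟨Nat.prime_two⟩
  apply orderOf_eq_prime_pow
  · rw [← hk, ← map_pow, mk0_one, SubmonoidClass.coe_pow]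
    rintro ⟨ξ, hξ⟩
    have hξ : M ^ k = Ideal.span {ξ} := hξ
    rw [mul_comm, pow_mul, hξ, Ideal.span_singleton_pow, Ideal.span_singleton_eq_span_singleton] at hM
    obtain ⟨u, hu⟩ := hM.symm
    have hd1 : 1 < d := by rw [← hdd]; exact Nat.one_lt_mul_iff.2 ⟨hp.pos, hq.pos, Or.inl hp.one_lt⟩
    obtain ⟨hu1, hu2⟩ := qr_unit hd1 u.isUnit
    have := congrArg QuadraticAlgebra.im hu
    simp [sq, hu1] at this
    rcases hu2 with h | h <;> rw [h] at this
    · have : 2 * (ξ.re * ξ.im) = 1 := by linarith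
      omega
    · have : 2 * (ξ.re * ξ.im) = -1 := by linarith
      omega
  · rw [pow_succ', ← hk, ← map_pow, mk0_one, SubmonoidClass.coe_pow]
    exact ⟨_, hM.symm⟩
end

/-- For every positive integer `ℓ` there are infinitely many squarefree positive integers `d`
such that the 2-class group of `ℚ(√-d)` is isomorphic to `(ℤ/2ℤ) × (ℤ/2^ℓℤ)`. -/
theorem infinitely_many_two_class_groups_of_type_two_twoPow (ℓ : ℕ) (hℓ : 0 < ℓ) :
    {d : ℕ | Squarefree d ∧
      twoClassGroupIso d (Multiplicative (ZMod 2 × ZMod (2 ^ ℓ)))}.Infinite := by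
  apply Set.infinite_of_forall_exists_gt
  intro B
  obtain ⟨n, rfl⟩ : ∃ n, ℓ = n + 1 := ⟨ℓ - 1, by omega⟩
  rcases Nat.eq_zero_or_pos n with rfl | hn
  · obtain ⟨d, hd, h⟩ := case_one B
    exact ⟨d, h, hd⟩
  · have hk : Even (2 ^ n) := (Nat.even_pow.2 ⟨even_two, by omega⟩)
    obtain ⟨m, p, q, hm, hm4, hp, hq, hp8, hpq⟩ := goldbach (2 ^ n) hk (by positivity) B
    refine ⟨p * q, case_big hn hm4 hp hq hp8 hpq, ?_⟩
    have h1 : m ≤ m ^ 2 ^ n := Nat.le_self_pow (by positivity) m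
    have h2 : p + q ≤ p * q := by nlinarith [hp.two_le, hq.two_le]
    omega
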